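/- (Quantitative propagation of chaos for the first marginal.) Assume the interaction kernel K satisfies (HK1)-(HK2) with constant L. Let f^in be a probability density on ℝ^d with a := ∫|z|^{d+5} f^in(z) dz < ∞, let P_N^in := (f^in·Leb)^{⊗N}, let P_N(t) := T_t#P_N^in, and let f(t,·) be the unique weak solution of the mean field PDE ∂_t f + div_z(f 𝒦f) = 0 with f(0,·) = f^in. Then there is a constant C(a,d) > 0 depending only on a and d such that for all t ∈ ℝ and all N ≥ 1, dist_{MK,1}(P_{N:1}(t), f(t,·)·Leb) ≤ C(a,d) e^{2L|t|} / N^{1/(d+4)}. -/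

import Mathlib

open MeasureTheory Real Filter Topology
open scoped ENNReal NNReal

noncomputable section

/-- The measure with density `g` with respect to Lebesgue measure on `ℝ^d`. -/
def densMeasure {d : ℕ} (g : EuclideanSpace ℝ (Fin d) → ℝ) :
    Measure (EuclideanSpace ℝ (Fin d)) :=
  volume.withDensity (fun z => ENNReal.ofReal (g z))

/-- The set of couplings of two Borel measures on `ℝ^d`. -/
def couplings {d : ℕ} (μ ν : Measure (EuclideanSpace ℝ (Fin d))) :
    Set (Measure (EuclideanSpace ℝ (Fin d) × EuclideanSpace ℝ (Fin d))) :=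
  {γ | γ.map Prod.fst = μ ∧ γ.map Prod.snd = ν}

/-- The Monge-Kantorovich distance with exponent 1 (with values in `ℝ≥0∞`). -/
def distMK1 {d : ℕ} (μ ν : Measure (EuclideanSpace ℝ (Fin d))) : ℝ≥0∞ :=
  ⨅ γ ∈ couplings μ ν, ∫⁻ p, edist p.1 p.2 ∂γ

/-- `f` is a weak solution of the mean field PDE `∂ₜ f + div_z (f 𝒦f) = 0`. -/
def IsWeakMeanFieldSol {d : ℕ}
    (K : EuclideanSpace ℝ (Fin d) × EuclideanSpace ℝ (Fin d) → EuclideanSpace ℝ (Fin d))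
    (f : ℝ → EuclideanSpace ℝ (Fin d) → ℝ) : Prop :=
  ∀ φ : EuclideanSpace ℝ (Fin d) → ℝ, ContDiff ℝ 1 φ →
    (∃ C : ℝ, ∀ z, |φ z| ≤ C) → (∃ C : ℝ, ∀ z, ‖fderiv ℝ φ z‖ ≤ C) →
    ∀ t : ℝ,
      HasDerivAt (fun s => ∫ z, φ z * f s z)
        (∫ z, fderiv ℝ φ z (∫ z', f t z' • K (z, z')) * f t z) t

section AuxiliaryResults

open scoped ContDiff Convolution

section Mollification

variable {E : Type*} [NormedAddCommGroup E] [InnerProductSpace ℝ E] [FiniteDimensional ℝ E]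
  [MeasurableSpace E] [BorelSpace E]

theorem continuous_of_norm_sub_le {F G : Type*} [NormedAddCommGroup F] [NormedAddCommGroup G]
    {W : F → G} {Λ : ℝ}
    (hW : ∀ x y, ‖W x - W y‖ ≤ Λ * ‖x - y‖) : Continuous W := by
  have : LipschitzWith (Real.toNNReal Λ) W := by
    refine LipschitzWith.of_dist_le_mul fun x y => ?_
    rw [dist_eq_norm, dist_eq_norm]
    exact (hW x y).trans (mul_le_mul_of_nonneg_right (Real.le_coe_toNNReal _) (norm_nonneg _))
  exact this.continuous

theorem norm_fderiv_le_of_norm_sub_le {F G : Type*} [NormedAddCommGroup F] [NormedAddCommGroup G]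
    [NormedSpace ℝ F] [NormedSpace ℝ G]
    {W : F → G} {Λ : ℝ} (hΛ : 0 ≤ Λ)
    (hW : ∀ x y, ‖W x - W y‖ ≤ Λ * ‖x - y‖) (x : F) : ‖fderiv ℝ W x‖ ≤ Λ := by
  have : LipschitzWith (Real.toNNReal Λ) W := by
    refine LipschitzWith.of_dist_le_mul fun x y => ?_
    rw [dist_eq_norm, dist_eq_norm]
    exact (hW x y).trans (mul_le_mul_of_nonneg_right (Real.le_coe_toNNReal _) (norm_nonneg _))
  simpa [hΛ] using norm_fderiv_le_of_lipschitz ℝ (x₀ := x) this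

theorem norm_sub_le_of_norm_fderiv_le {F G : Type*} [NormedAddCommGroup F] [NormedAddCommGroup G]
    [NormedSpace ℝ F] [NormedSpace ℝ G]
    {W : F → G} {Λ : ℝ} (hd : Differentiable ℝ W)
    (hW : ∀ x, ‖fderiv ℝ W x‖ ≤ Λ) (x y : F) : ‖W x - W y‖ ≤ Λ * ‖x - y‖ :=
  convex_univ.norm_image_sub_le_of_norm_fderiv_le (𝕜 := ℝ) (fun z _ => hd z) (fun z _ => hW z)
    (Set.mem_univ y) (Set.mem_univ x)

/-- Smooth approximation of Lipschitz vector fields, with bounds uniform in the field. -/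
theorem exists_mollification (Λ : ℝ) (hΛ : 0 ≤ Λ) (ε : ℝ) (hε : 0 < ε) :
    ∃ B : ℝ, 0 ≤ B ∧ ∀ W : E → E, (∀ x y, ‖W x - W y‖ ≤ Λ * ‖x - y‖) →
      ∃ v : E → E, ContDiff ℝ ∞ v ∧ (∀ x, ‖v x - W x‖ ≤ Λ * ε) ∧ (∀ x, ‖fderiv ℝ v x‖ ≤ Λ) ∧
        ∀ x y, ‖fderiv ℝ v x - fderiv ℝ v y‖ ≤ B * ‖x - y‖ := by
  let φ : ContDiffBump (0 : E) := ⟨ε / 2, ε, by linarith, by linarith⟩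
  let ρ : E → ℝ := φ.normed volume
  have hρc : HasCompactSupport ρ := φ.hasCompactSupport_normed
  have hρs : ContDiff ℝ ∞ ρ := φ.contDiff_normed
  have hρi : ∫ y, ρ y = 1 := φ.integral_normed
  have hρ0 : ∀ y, 0 ≤ ρ y := fun y => φ.nonneg_normed y
  have hDc : HasCompactSupport (fderiv ℝ ρ) := hρc.fderiv ℝ
  have hDcont : Continuous (fderiv ℝ ρ) := hρs.continuous_fderiv (by simp)
  have hDi : Integrable (fun y => ‖fderiv ℝ ρ y‖) :=
    (hDcont.integrable_of_hasCompactSupport hDc).norm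
  have hρint : Integrable ρ := hρs.continuous.integrable_of_hasCompactSupport hρc
  refine ⟨(∫ y, ‖fderiv ℝ ρ y‖) * Λ, mul_nonneg (integral_nonneg fun _ => norm_nonneg _) hΛ, ?_⟩
  intro W hW
  have hWc : Continuous W := continuous_of_norm_sub_le hW
  let L : ℝ →L[ℝ] E →L[ℝ] E := ContinuousLinearMap.lsmul ℝ ℝ
  let v : E → E := ρ ⋆[L, volume] W
  have hvs : ContDiff ℝ ∞ v :=
    hρc.contDiff_convolution_left (n := ⊤) L hρs hWc.locallyIntegrable
  have hder : ∀ x, HasFDerivAt v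
      ((fderiv ℝ ρ ⋆[L.precompL E, volume] W : E → E →L[ℝ] E) x) x := fun x =>
    hρc.hasFDerivAt_convolution_left L (hρs.of_le (by simp)) hWc.locallyIntegrable x
  have hve : ∀ x, ConvolutionExistsAt ρ W x L := fun x =>
    (hρc.convolutionExists_left L hρs.continuous hWc.locallyIntegrable) x
  have hDe : ∀ x, ConvolutionExistsAt (fderiv ℝ ρ) W x (L.precompL E) := fun x =>
    (hDc.convolutionExists_left (L.precompL E) hDcont hWc.locallyIntegrable) x
  refine ⟨v, hvs, ?_, ?_, ?_⟩
  · intro x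
    rw [← dist_eq_norm]
    refine φ.dist_normed_convolution_le hWc.aestronglyMeasurable fun y hy => ?_
    rw [dist_eq_norm]
    rw [Metric.mem_ball, dist_eq_norm] at hy
    exact (hW y x).trans (mul_le_mul_of_nonneg_left hy.le hΛ)
  · apply norm_fderiv_le_of_norm_sub_le hΛ
    intro x y
    have : v x - v y = ∫ t, ρ t • (W (x - t) - W (y - t)) := by
      have h1 := hve x
      have h2 := hve y
      simp only [v, convolution_def]
      rw [← integral_sub h1 h2]
      congr 1; ext1 t; simp [L, smul_sub]
    rw [this]
    have h3 : ∀ t, ‖ρ t • (W (x - t) - W (y - t))‖ ≤ ρ t * (Λ * ‖x - y‖) := by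
      intro t
      rw [norm_smul, Real.norm_of_nonneg (hρ0 t)]
      refine mul_le_mul_of_nonneg_left ?_ (hρ0 t)
      simpa using hW (x - t) (y - t)
    refine (norm_integral_le_of_norm_le (hρint.mul_const _) (ae_of_all _ h3)).trans ?_
    rw [integral_mul_const, hρi, one_mul]
  · intro x y
    rw [(hder x).fderiv, (hder y).fderiv]
    have : ((fderiv ℝ ρ ⋆[L.precompL E, volume] W : E → E →L[ℝ] E) x) -
        ((fderiv ℝ ρ ⋆[L.precompL E, volume] W : E → E →L[ℝ] E) y) =
        ∫ t, (L.precompL E) (fderiv ℝ ρ t) (W (x - t) - W (y - t)) := by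
      have h1 := hDe x
      have h2 := hDe y
      rw [convolution_def, convolution_def, ← integral_sub h1 h2]
      congr 1; ext1 t; rw [map_sub]
    rw [this]
    have h3 : ∀ t, ‖(L.precompL E) (fderiv ℝ ρ t) (W (x - t) - W (y - t))‖ ≤
        ‖fderiv ℝ ρ t‖ * (Λ * ‖x - y‖) := by
      intro t
      refine ContinuousLinearMap.opNorm_le_bound _ (by positivity) fun u => ?_
      rw [ContinuousLinearMap.precompL_apply]
      simp only [L, ContinuousLinearMap.lsmul_apply, norm_smul]
      have h4 := hW (x - t) (y - t)
      rw [sub_sub_sub_cancel_right] at h4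
      have h5 := (fderiv ℝ ρ t).le_opNorm u
      calc _ ≤ (‖fderiv ℝ ρ t‖ * ‖u‖) * (Λ * ‖x - y‖) := by gcongr
        _ = _ := by ring
    refine (norm_integral_le_of_norm_le (hDi.mul_const _) (ae_of_all _ h3)).trans ?_
    rw [integral_mul_const]
    exact le_of_eq (by ring)

end Mollification

section EulerScheme

set_option linter.unusedSectionVars false

variable {E : Type*} [NormedAddCommGroup E] [InnerProductSpace ℝ E] [FiniteDimensional ℝ E]

/-- Smooth compactly supported functions. -/
structure IsTest (φ : E → ℝ) : Prop where
  smooth : ContDiff ℝ ∞ φ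
  supp : HasCompactSupport φ

/-- Test functions with quantitative bounds on gradient, Hessian and support. -/
structure TestClass (G B r : ℝ) (g : E → ℝ) : Prop where
  smooth : ContDiff ℝ ∞ g
  grad : ∀ x, ‖fderiv ℝ g x‖ ≤ G
  lip : ∀ x y, ‖fderiv ℝ g x - fderiv ℝ g y‖ ≤ B * ‖x - y‖
  supp : ∀ x, r < 1 + ‖x‖ → g x = 0

theorem hasCompactSupport_of_eq_zero {F : Type*} [Zero F] {g : E → F} {r : ℝ}
    (h : ∀ x, r < 1 + ‖x‖ → g x = 0) : HasCompactSupport g := by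
  refine HasCompactSupport.intro (isCompact_closedBall (0 : E) (r - 1)) fun x hx => h x ?_
  rw [mem_closedBall_zero_iff, not_le] at hx
  linarith

theorem fderiv_eq_zero_of_eq_zero {g : E → ℝ} {r : ℝ}
    (h : ∀ x, r < 1 + ‖x‖ → g x = 0) (x : E) (hx : r < 1 + ‖x‖) : fderiv ℝ g x = 0 := by
  have : g =ᶠ[𝓝 x] fun _ => 0 := by
    have ho : IsOpen {y : E | r < 1 + ‖y‖} := isOpen_lt continuous_const (by fun_prop)
    filter_upwards [ho.mem_nhds hx] with y hy using h y hy
  rw [this.fderiv_eq]; simp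

theorem TestClass.isTest {G B r : ℝ} {g : E → ℝ} (h : TestClass G B r g) : IsTest g :=
  ⟨h.smooth, hasCompactSupport_of_eq_zero h.supp⟩

theorem TestClass.mono {G B r G' B' r' : ℝ} {g : E → ℝ} (h : TestClass G B r g)
    (hG : G ≤ G') (hB : B ≤ B') (hr : r ≤ r') : TestClass G' B' r' g :=
  ⟨h.smooth, fun x => (h.grad x).trans hG, fun x y => (h.lip x y).trans (by gcongr),
    fun x hx => h.supp x (hr.trans_lt hx)⟩

theorem HasCompactSupport.exists_norm_le {X F : Type*} [TopologicalSpace X]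
    [SeminormedAddCommGroup F] {u : X → F}
    (hs : HasCompactSupport u) (hu : Continuous u) : ∃ B, ∀ x, ‖u x‖ ≤ B :=
  hs.exists_bound_of_continuous hu

theorem IsTest.exists_testClass {g : E → ℝ} (hg : IsTest g) :
    ∃ G B r : ℝ, 0 ≤ G ∧ 1 ≤ B ∧ 0 ≤ r ∧ TestClass G B r g := by
  have hD : ContDiff ℝ ∞ (fderiv ℝ g) := hg.smooth.fderiv_right (by simp)
  have hDc : HasCompactSupport (fderiv ℝ g) := hg.supp.fderiv ℝ
  have hD2 : Continuous (fderiv ℝ (fderiv ℝ g)) := hD.continuous_fderiv (by simp)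
  have hDc2 : HasCompactSupport (fderiv ℝ (fderiv ℝ g)) := hDc.fderiv ℝ
  obtain ⟨G, hG⟩ : ∃ G, ∀ x, ‖fderiv ℝ g x‖ ≤ G :=
    hDc.exists_bound_of_continuous hD.continuous
  obtain ⟨B, hB⟩ : ∃ B, ∀ x, ‖fderiv ℝ (fderiv ℝ g) x‖ ≤ B :=
    HasCompactSupport.exists_norm_le (u := fderiv ℝ (fderiv ℝ g)) hDc2 hD2
  obtain ⟨r, hr⟩ := hg.supp.isBounded.subset_closedBall (0 : E)
  refine ⟨G, max B 1, max (1 + r) 0, (norm_nonneg (fderiv ℝ g 0)).trans (hG 0), le_max_right _ _,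
    le_max_right _ _, hg.smooth, hG, fun x y => ?_, fun x hx => ?_⟩
  · exact norm_sub_le_of_norm_fderiv_le (W := fderiv ℝ g) (hD.differentiable (by simp))
      (fun z => (hB z).trans (le_max_left _ _)) x y
  · by_contra h0
    have := hr (subset_tsupport _ (Function.mem_support.2 h0))
    rw [mem_closedBall_zero_iff] at this
    have h1 := le_max_left (1 + r) 0
    linarith

theorem TestClass.comp_euler {G B r Λ Bv m h : ℝ} {g : E → ℝ} {v : E → E}
    (hg : TestClass G B r g) (hB : 1 ≤ B) (hr0 : 0 ≤ r) (hm : 0 ≤ m)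
    (hΛ0 : 0 ≤ Λ) (hBv : 0 ≤ Bv)
    (hv : ContDiff ℝ ∞ v) (hvΛ : ∀ x, ‖fderiv ℝ v x‖ ≤ Λ)
    (hvB : ∀ x y, ‖fderiv ℝ v x - fderiv ℝ v y‖ ≤ Bv * ‖x - y‖)
    (hvm : ∀ x, ‖v x‖ ≤ m * (1 + ‖x‖)) (h0 : 0 ≤ h) (hhΛ : h * Λ ≤ 1) (hhm : h * m ≤ 1 / 2) :
    TestClass (G * exp (Λ * h)) (B * exp ((3 * Λ + G * Bv) * h)) (r * exp (2 * m * h))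
      (fun x => g (x + h • v x)) := by
  have hG : 0 ≤ G := (norm_nonneg _).trans (hg.grad 0)
  have hgd : ∀ x, HasFDerivAt g (fderiv ℝ g x) x := fun x =>
    (hg.smooth.differentiable (by simp) x).hasFDerivAt
  have hΦ : ∀ x, HasFDerivAt (fun x => x + h • v x)
      (ContinuousLinearMap.id ℝ E + h • fderiv ℝ v x) x := fun x =>
    (hasFDerivAt_id x).add ((hv.differentiable (by simp) x).hasFDerivAt.const_smul h)
  have hA : ∀ x, ‖ContinuousLinearMap.id ℝ E + h • fderiv ℝ v x‖ ≤ 1 + Λ * h := fun x => by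
    refine (norm_add_le _ _).trans (add_le_add ContinuousLinearMap.norm_id_le ?_)
    rw [norm_smul, Real.norm_of_nonneg h0, mul_comm]
    exact mul_le_mul_of_nonneg_right (hvΛ x) h0
  have hfd : ∀ x, fderiv ℝ (fun x => g (x + h • v x)) x =
      (fderiv ℝ g (x + h • v x)).comp (ContinuousLinearMap.id ℝ E + h • fderiv ℝ v x) := fun x =>
    ((hgd (x + h • v x)).comp x (hΦ x)).fderiv
  have hΦL : ∀ x y, ‖(x + h • v x) - (y + h • v y)‖ ≤ (1 + Λ * h) * ‖x - y‖ := fun x y =>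
    norm_sub_le_of_norm_fderiv_le (W := fun x => x + h • v x)
      (fun z => (hΦ z).differentiableAt) (fun z => by rw [(hΦ z).fderiv]; exact hA z) x y
  have hexp : 1 + Λ * h ≤ exp (Λ * h) := by linarith [add_one_le_exp (Λ * h)]
  refine ⟨?_, ?_, ?_, ?_⟩
  · exact hg.smooth.comp (contDiff_id.add (contDiff_const.smul hv))
  · intro x
    rw [hfd]
    refine (ContinuousLinearMap.opNorm_comp_le _ _).trans ?_
    exact mul_le_mul (hg.grad _) ((hA x).trans hexp) (norm_nonneg _) hG
  · intro x y
    rw [hfd, hfd]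
    set P := fderiv ℝ g (x + h • v x)
    set Q := fderiv ℝ g (y + h • v y)
    set A := ContinuousLinearMap.id ℝ E + h • fderiv ℝ v x with hAdef
    set A' := ContinuousLinearMap.id ℝ E + h • fderiv ℝ v y with hAdef'
    have e1 : P.comp A - Q.comp A' = (P - Q).comp A + Q.comp (A - A') := by
      rw [ContinuousLinearMap.sub_comp, ContinuousLinearMap.comp_sub]; abel
    have e2 : A - A' = h • (fderiv ℝ v x - fderiv ℝ v y) := by
      rw [hAdef, hAdef', smul_sub]; abel
    have n1 : ‖(P - Q).comp A‖ ≤ (B * ((1 + Λ * h) * ‖x - y‖)) * (1 + Λ * h) := by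
      refine (ContinuousLinearMap.opNorm_comp_le _ _).trans ?_
      refine mul_le_mul ((hg.lip _ _).trans ?_) (hA x) (norm_nonneg _) (by positivity)
      exact mul_le_mul_of_nonneg_left (hΦL x y) (by linarith)
    have n2 : ‖Q.comp (A - A')‖ ≤ G * (h * (Bv * ‖x - y‖)) := by
      refine (ContinuousLinearMap.opNorm_comp_le _ _).trans ?_
      rw [e2, norm_smul, Real.norm_of_nonneg h0]
      exact mul_le_mul (hg.grad _) (mul_le_mul_of_nonneg_left (hvB x y) h0) (by positivity) hG
    rw [e1]
    refine (norm_add_le _ _).trans ((add_le_add n1 n2).trans ?_)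
    have e3 := add_one_le_exp ((3 * Λ + G * Bv) * h)
    have e4 : B * (1 + Λ * h) * (1 + Λ * h) + G * h * Bv ≤ B * exp ((3 * Λ + G * Bv) * h) := by
      have : B * (1 + Λ * h) * (1 + Λ * h) + G * h * Bv ≤ B * ((3 * Λ + G * Bv) * h + 1) := by
        have h5 : 0 ≤ Λ * h := by positivity
        have h6 : Λ * h * (Λ * h) ≤ Λ * h := by nlinarith
        have h7 : 0 ≤ G * h * Bv := by positivity
        nlinarith
      exact this.trans (by gcongr)
    calc _ = (B * (1 + Λ * h) * (1 + Λ * h) + G * h * Bv) * ‖x - y‖ := by ring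
      _ ≤ _ := by gcongr
  · intro x hx
    refine hg.supp _ ?_
    have h1 : ‖x‖ - h * (m * (1 + ‖x‖)) ≤ ‖x + h • v x‖ := by
      have h2 := norm_sub_norm_le x (-(h • v x))
      rw [sub_neg_eq_add, norm_neg, norm_smul, Real.norm_of_nonneg h0] at h2
      have := mul_le_mul_of_nonneg_left (hvm x) h0
      linarith
    have h3 := add_one_le_exp (2 * m * h)
    have h4 : 0 ≤ h * m := by positivity
    have h5 : r * 1 ≤ r * (exp (2 * m * h) * (1 - h * m)) := by
      refine mul_le_mul_of_nonneg_left ?_ hr0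
      nlinarith
    have h6 : r * exp (2 * m * h) * (1 - h * m) < (1 + ‖x‖) * (1 - h * m) :=
      mul_lt_mul_of_pos_right hx (by linarith)
    nlinarith

/-- A family of functionals of order zero solving a linear transport equation in weak form. -/
structure IsTransported (δ : ℝ → (E → ℝ) → ℝ) (W : ℝ → E → E) (s T C Λ : ℝ) : Prop where
  sub : ∀ τ ∈ Set.Icc s T, ∀ φ ψ : E → ℝ, Continuous φ → HasCompactSupport φ →
    Continuous ψ → HasCompactSupport ψ → δ τ (fun x => φ x - ψ x) = δ τ φ - δ τ ψ
  smul : ∀ τ ∈ Set.Icc s T, ∀ (c : ℝ) (φ : E → ℝ), Continuous φ → HasCompactSupport φ →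
    δ τ (fun x => c * φ x) = c * δ τ φ
  bound : ∀ τ ∈ Set.Icc s T, ∀ φ : E → ℝ, Continuous φ → HasCompactSupport φ →
    ∀ M, (∀ x, |φ x| ≤ M) → |δ τ φ| ≤ C * M
  C_nonneg : 0 ≤ C
  Λ_nonneg : 0 ≤ Λ
  lip : ∀ τ ∈ Set.Icc s T, ∀ x y, ‖W τ x - W τ y‖ ≤ Λ * ‖x - y‖
  cont : ∀ x, ContinuousOn (fun τ => W τ x) (Set.Icc s T)
  deriv : ∀ φ, IsTest φ → ∀ τ ∈ Set.Icc s T,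
    HasDerivWithinAt (fun τ => δ τ φ) (δ τ (fun x => fderiv ℝ φ x (W τ x))) (Set.Icc s T) τ

theorem IsTransported.euler_step {δ : ℝ → (E → ℝ) → ℝ} {W : ℝ → E → E} {s T C Λ : ℝ}
    (H : IsTransported δ W s T C Λ) {σ h G B r r' R M e : ℝ} {g : E → ℝ} {v : E → E}
    (hσ : σ ∈ Set.Icc s T) (hσh : σ + h ∈ Set.Icc s T) (h0 : 0 ≤ h)
    (hg : TestClass G B r g) (hB : 0 ≤ B)
    (hv : ContDiff ℝ ∞ v) (hvΛ : ∀ x, ‖fderiv ℝ v x‖ ≤ Λ)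
    (hg' : ∀ x, r' < 1 + ‖x‖ → g (x + h • v x) = 0) (hr : r ≤ R) (hr' : r' ≤ R)
    (hvM : ∀ x, 1 + ‖x‖ ≤ R → ‖v x‖ ≤ M)
    (hWM : ∀ τ ∈ Set.Icc s T, ∀ x, 1 + ‖x‖ ≤ R → ‖W τ x‖ ≤ M) (hM : 0 ≤ M) (he : 0 ≤ e)
    (hWv : ∀ τ ∈ Set.Icc σ (σ + h), ∀ x, 1 + ‖x‖ ≤ R → ‖W τ x - v x‖ ≤ e) :
    |δ (σ + h) g - δ σ (fun x => g (x + h • v x))| ≤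
      h * (C * (G * e)) + h * (C * ((B * M + G * Λ) * M) * h) + C * (B * (h * M) * (h * M)) := by
  have hG : 0 ≤ G := (norm_nonneg _).trans (hg.grad 0)
  have hC := H.C_nonneg
  have hΛ := H.Λ_nonneg
  have hgsupp := fderiv_eq_zero_of_eq_zero hg.supp
  have hDs : ContDiff ℝ ∞ (fderiv ℝ g) := hg.smooth.fderiv_right (by simp)
  have hsub : Set.Icc σ (σ + h) ⊆ Set.Icc s T := Set.Icc_subset_Icc hσ.1 hσh.2
  set ζ : E → ℝ := fun x => fderiv ℝ g x (v x) with hζ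
  have hζ0 : ∀ x, r < 1 + ‖x‖ → ζ x = 0 := fun x hx => by simp [hζ, hgsupp x hx]
  have hζs : ContDiff ℝ ∞ ζ := hDs.clm_apply hv
  have hζt : IsTest ζ := ⟨hζs, hasCompactSupport_of_eq_zero hζ0⟩
  have hζD : ∀ x, ‖fderiv ℝ ζ x‖ ≤ B * M + G * Λ := by
    intro x
    rcases le_or_gt (1 + ‖x‖) r with hx | hx
    · have h1 : HasFDerivAt ζ _ x := (hDs.differentiable (by simp) x).hasFDerivAt.clm_apply
        (hv.differentiable (by simp) x).hasFDerivAt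
      rw [h1.fderiv]
      refine ContinuousLinearMap.opNorm_le_bound _ (by positivity) fun w => ?_
      simp only [_root_.add_apply, ContinuousLinearMap.comp_apply,
        ContinuousLinearMap.flip_apply]
      have h2 : ‖fderiv ℝ (fderiv ℝ g) x‖ ≤ B := norm_fderiv_le_of_norm_sub_le hB hg.lip x
      have a1 : ‖(fderiv ℝ g x) (fderiv ℝ v x w)‖ ≤ G * (Λ * ‖w‖) :=
        (ContinuousLinearMap.le_opNorm _ _).trans (mul_le_mul (hg.grad x)
          ((ContinuousLinearMap.le_opNorm _ _).trans (by gcongr; exact hvΛ x)) (norm_nonneg _) hG)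
      have a2 : ‖(fderiv ℝ (fderiv ℝ g) x w) (v x)‖ ≤ (B * ‖w‖) * M :=
        (ContinuousLinearMap.le_opNorm _ _).trans (mul_le_mul
          ((ContinuousLinearMap.le_opNorm _ _).trans (by gcongr)) (hvM x (hx.trans hr))
          (norm_nonneg _) (by positivity))
      refine (norm_add_le _ _).trans ?_
      linarith
    · rw [fderiv_eq_zero_of_eq_zero hζ0 x hx, norm_zero]; positivity
  have hdrift : ∀ (φ : E → ℝ), IsTest φ → ∀ A, 0 ≤ A → (∀ x, ‖fderiv ℝ φ x‖ ≤ A) →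
      (∀ x, r < 1 + ‖x‖ → φ x = 0) →
      ∀ τ ∈ Set.Icc s T, |δ τ (fun x => fderiv ℝ φ x (W τ x))| ≤ C * (A * M) := by
    intro φ hφ A hA hφA hφ0 τ hτ
    have hz := fderiv_eq_zero_of_eq_zero hφ0
    refine H.bound τ hτ _ ?_ ?_ _ ?_
    · exact (hφ.smooth.continuous_fderiv (by simp)).clm_apply
        (continuous_of_norm_sub_le (H.lip τ hτ))
    · exact hasCompactSupport_of_eq_zero (r := r) fun x hx => by simp [hz x hx]
    · intro x
      rcases le_or_gt (1 + ‖x‖) r with hx | hx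
      · rw [← Real.norm_eq_abs]
        exact (ContinuousLinearMap.le_opNorm _ _).trans
          (mul_le_mul (hφA x) (hWM τ hτ x (hx.trans hr)) (norm_nonneg _) hA)
      · rw [hz x hx]; simp; positivity
  have hζlip : ∀ τ ∈ Set.Icc σ (σ + h), |δ τ ζ - δ σ ζ| ≤ C * ((B * M + G * Λ) * M) * h := by
    intro τ hτ
    have := (convex_Icc s T).norm_image_sub_le_of_norm_hasDerivWithin_le (𝕜 := ℝ)
      (f := fun τ => δ τ ζ) (fun y hy => H.deriv ζ hζt y hy)
      (fun y hy => by
        rw [Real.norm_eq_abs]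
        exact hdrift ζ hζt _ (by positivity) hζD hζ0 y hy) hσ (hsub hτ)
    rw [Real.norm_eq_abs, Real.norm_of_nonneg (by linarith [hτ.1])] at this
    refine this.trans ?_
    gcongr
    linarith [hτ.2]
  have hWcont : ∀ τ ∈ Set.Icc s T, Continuous (W τ) := fun τ hτ =>
    continuous_of_norm_sub_le (H.lip τ hτ)
  have hDgc := hg.smooth.continuous_fderiv (n := ∞) (by simp)
  have hder : ∀ τ ∈ Set.Icc σ (σ + h),
      |δ τ (fun x => fderiv ℝ g x (W τ x)) - δ σ ζ| ≤
        C * (G * e) + C * ((B * M + G * Λ) * M) * h := by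
    intro τ hτ
    have hs := H.sub τ (hsub hτ) (fun x => fderiv ℝ g x (W τ x)) ζ
      (hDgc.clm_apply (hWcont τ (hsub hτ)))
      (hasCompactSupport_of_eq_zero (r := r) fun x hx => by simp [hgsupp x hx])
      hζs.continuous hζt.supp
    have hb := H.bound τ (hsub hτ) (fun x => fderiv ℝ g x (W τ x) - ζ x)
      ((hDgc.clm_apply (hWcont τ (hsub hτ))).sub hζs.continuous)
      (hasCompactSupport_of_eq_zero (r := r) fun x hx => by simp [hgsupp x hx, hζ0 x hx])
      (G * e) (fun x => by
        rcases le_or_gt (1 + ‖x‖) r with hx | hx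
        · rw [hζ, ← map_sub, ← Real.norm_eq_abs]
          exact (ContinuousLinearMap.le_opNorm _ _).trans
            (mul_le_mul (hg.grad x) (hWv τ hτ x (hx.trans hr)) (norm_nonneg _) hG)
        · simp only [hgsupp x hx, hζ0 x hx]; simp; positivity)
    rw [hs] at hb
    have := hζlip τ hτ
    have := abs_sub_le (δ τ (fun x => fderiv ℝ g x (W τ x))) (δ τ ζ) (δ σ ζ)
    linarith
  have hfirst : |δ (σ + h) g - δ σ g - h * δ σ ζ| ≤
      (C * (G * e) + C * ((B * M + G * Λ) * M) * h) * h := by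
    have := (convex_Icc σ (σ + h)).norm_image_sub_le_of_norm_hasDerivWithin_le (𝕜 := ℝ)
      (f := fun τ => δ τ g - τ * δ σ ζ)
      (f' := fun τ => δ τ (fun x => fderiv ℝ g x (W τ x)) - 1 * δ σ ζ)
      (fun y hy => ((H.deriv g hg.isTest y (hsub hy)).mono hsub).sub
        ((hasDerivWithinAt_id y _).mul_const _))
      (fun y hy => by
        rw [Real.norm_eq_abs, one_mul]
        exact hder y hy)
      (Set.left_mem_Icc.2 (by linarith)) (Set.right_mem_Icc.2 (by linarith))
    rw [Real.norm_eq_abs, add_sub_cancel_left, Real.norm_of_nonneg h0] at this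
    convert this using 2
    ring
  have hΦc : Continuous fun x => g (x + h • v x) :=
    hg.smooth.continuous.comp (continuous_id.add (continuous_const.smul hv.continuous))
  have hΦs : HasCompactSupport fun x => g (x + h • v x) := hasCompactSupport_of_eq_zero hg'
  have hs1 := H.sub σ hσ (fun x => g (x + h • v x)) g hΦc hΦs hg.smooth.continuous hg.isTest.supp
  have hs2 := H.smul σ hσ h ζ hζs.continuous hζt.supp
  have hζhc : HasCompactSupport fun x => h * ζ x :=
    hasCompactSupport_of_eq_zero (r := r) fun x hx => by simp [hζ0 x hx]
  have hdc : HasCompactSupport fun x => g (x + h • v x) - g x :=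
    hasCompactSupport_of_eq_zero (r := R) fun x hx => by
      simp [hg' x (hr'.trans_lt hx), hg.supp x (hr.trans_lt hx)]
  have hs3 := H.sub σ hσ (fun x => g (x + h • v x) - g x) (fun x => h * ζ x)
    (hΦc.sub hg.smooth.continuous) hdc
    (continuous_const.mul hζs.continuous) hζhc
  have hb := H.bound σ hσ (fun x => (g (x + h • v x) - g x) - h * ζ x)
    ((hΦc.sub hg.smooth.continuous).sub (continuous_const.mul hζs.continuous))
    (hasCompactSupport_of_eq_zero (r := R) fun x hx => by
      simp [hg' x (hr'.trans_lt hx), hg.supp x (hr.trans_lt hx), hζ0 x (hr.trans_lt hx)])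
    (B * (h * M) * (h * M)) (fun x => by
      rcases le_or_gt (1 + ‖x‖) R with hx | hx
      · have hu : ‖h • v x‖ ≤ h * M := by
          rw [norm_smul, Real.norm_of_nonneg h0]
          exact mul_le_mul_of_nonneg_left (hvM x hx) h0
        have := (convex_closedBall x ‖h • v x‖).norm_image_sub_le_of_norm_fderiv_le' (𝕜 := ℝ)
          (f := g) (φ := fderiv ℝ g x) (C := B * ‖h • v x‖) (x := x) (y := x + h • v x)
          (fun y _ => hg.smooth.differentiable (by simp) y)
          (fun y hy => (hg.lip y x).trans (by
            rw [mem_closedBall_iff_norm] at hy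
            gcongr))
          (Metric.mem_closedBall_self (norm_nonneg _)) (by simp)
        rw [add_sub_cancel_left, map_smul, smul_eq_mul, Real.norm_eq_abs] at this
        refine this.trans ?_
        gcongr
      · simp only [hg' x (hr'.trans_lt hx), hg.supp x (hr.trans_lt hx), hζ0 x (hr.trans_lt hx)]
        simp; positivity)
  rw [hs3, hs1, hs2] at hb
  rw [abs_le] at hb hfirst ⊢
  constructor <;> linarith [hb.1, hb.2, hfirst.1, hfirst.2]

theorem mul_le_of_le_div_add_one {h b c : ℝ} (hc : 0 ≤ c) (hh : 0 ≤ h) (hle : h ≤ b / (c + 1)) :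
    h * c ≤ b := by
  rw [le_div_iff₀ (by positivity)] at hle
  linarith

set_option maxHeartbeats 1600000 in
/-- Uniqueness for the weak transport equation, by an Euler scheme on mollified fields. -/
theorem IsTransported.eq_zero {δ : ℝ → (E → ℝ) → ℝ} {W : ℝ → E → E} {s T C Λ : ℝ}
    [MeasurableSpace E] [BorelSpace E]
    (H : IsTransported δ W s T C Λ) (hsT : s ≤ T) (h0 : ∀ φ, IsTest φ → δ s φ = 0) :
    ∀ φ, IsTest φ → δ T φ = 0 := by
  intro g hg
  have hC := H.C_nonneg
  have hΛ := H.Λ_nonneg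
  obtain ⟨G0, B0, r0, hG0, hB0, hr0, hgc⟩ := hg.exists_testClass
  obtain ⟨m0, hm0⟩ := isCompact_Icc.exists_bound_of_continuousOn (H.cont 0)
  have hm0' : 0 ≤ m0 := (norm_nonneg _).trans (hm0 s (Set.left_mem_Icc.2 hsT))
  set ℓ := T - s with hℓ
  have hℓ0 : 0 ≤ ℓ := sub_nonneg.2 hsT
  set m := m0 + Λ with hm
  have hmnn : 0 ≤ m := by positivity
  set Gm := G0 * exp (Λ * ℓ) with hGm
  set R := r0 * exp (2 * m * ℓ) with hR
  have hR0 : 0 ≤ R := by positivity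
  have hGm0 : 0 ≤ Gm := by positivity
  set M := m * R with hM
  have hM0 : 0 ≤ M := by positivity
  have hWcont : ContinuousOn (fun p : ℝ × E => W p.1 p.2) (Set.Icc s T ×ˢ Set.univ) := by
    have := continuousOn_prod_of_continuousOn_lipschitzOnWith (fun p : E × ℝ => W p.2 p.1)
      (s := Set.univ) (t := Set.Icc s T) (Real.toNNReal Λ) (fun a _ => H.cont a)
      (fun b hb => (LipschitzWith.of_dist_le_mul fun x y => by
        rw [dist_eq_norm, dist_eq_norm, Real.coe_toNNReal _ hΛ]
        exact H.lip b hb x y).lipschitzOnWith)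
    exact this.comp continuous_swap.continuousOn fun p hp => ⟨hp.2, hp.1⟩
  have hWlin : ∀ τ ∈ Set.Icc s T, ∀ x, ‖W τ x‖ ≤ m0 + Λ * ‖x‖ := fun τ hτ x => by
    have h1 := H.lip τ hτ x 0
    have h2 := hm0 τ hτ
    have h3 := norm_le_norm_add_norm_sub (W τ 0) (W τ x)
    rw [norm_sub_rev] at h3
    rw [sub_zero] at h1
    linarith
  have key : ∀ e > 0, |δ T g| ≤ ℓ * (C * (Gm * (2 * e))) + e := by
    intro e he
    have hε : 0 < min 1 (e / (Λ + 1)) := lt_min one_pos (by positivity)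
    have hΛε : Λ * min 1 (e / (Λ + 1)) ≤ e := by
      calc Λ * min 1 (e / (Λ + 1)) ≤ Λ * (e / (Λ + 1)) := by gcongr; exact min_le_right _ _
        _ = e * (Λ / (Λ + 1)) := by ring
        _ ≤ e * 1 := by gcongr; rw [div_le_one (by positivity)]; linarith
        _ = e := mul_one e
    have hΛε1 : Λ * min 1 (e / (Λ + 1)) ≤ Λ * 1 := by gcongr; exact min_le_left _ _
    obtain ⟨Bv, hBv, hmol⟩ := exists_mollification (E := E) Λ hΛ _ hε
    set κ := 3 * Λ + Gm * Bv with hκ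
    have hκ0 : 0 ≤ κ := by positivity
    set Bm := B0 * exp (κ * ℓ) with hBm
    have hBm0 : 0 ≤ Bm := by positivity
    set Q := C * ((Bm * M + Gm * Λ) * M) + C * (Bm * M * M) with hQ
    have hQ0 : 0 ≤ Q := by positivity
    have huc : ∃ η > 0, ∀ τ ∈ Set.Icc s T, ∀ σ ∈ Set.Icc s T, |τ - σ| < η →
        ∀ x, 1 + ‖x‖ ≤ R → ‖W τ x - W σ x‖ ≤ e := by
      have hcomp : IsCompact (Set.Icc s T ×ˢ Metric.closedBall (0 : E) R) :=
        isCompact_Icc.prod (isCompact_closedBall _ _)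
      have hu := hcomp.uniformContinuousOn_of_continuous
        (hWcont.mono (Set.prod_mono_right (Set.subset_univ _)))
      rw [Metric.uniformContinuousOn_iff] at hu
      obtain ⟨η, hη, hu⟩ := hu e he
      refine ⟨η, hη, fun τ hτ σ hσ hd x hx => ?_⟩
      have hxR : x ∈ Metric.closedBall (0 : E) R := by
        rw [mem_closedBall_zero_iff]; linarith
      have := hu (τ, x) ⟨hτ, hxR⟩ (σ, x) ⟨hσ, hxR⟩ (by simpa [Prod.dist_eq, Real.dist_eq, hη] using hd)
      rw [dist_eq_norm] at this
      exact this.le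
    obtain ⟨η, hη, huc⟩ := huc
    have hth : 0 < min (min (1 / (Λ + 1)) (1 / 2 / (m + 1))) (min (η / 2) (e / (Q * ℓ + 1))) := by
      positivity
    obtain ⟨n, hn⟩ := exists_nat_gt
      (ℓ / min (min (1 / (Λ + 1)) (1 / 2 / (m + 1))) (min (η / 2) (e / (Q * ℓ + 1))))
    have hn0 : (0 : ℝ) < n := lt_of_le_of_lt (by positivity) hn
    set h := ℓ / n with hh
    have hh0 : 0 ≤ h := by positivity
    have hhmin : h ≤ min (min (1 / (Λ + 1)) (1 / 2 / (m + 1))) (min (η / 2) (e / (Q * ℓ + 1))) := by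
      rw [div_lt_iff₀ hth] at hn
      rw [hh, div_le_iff₀ hn0]
      linarith
    have h1 : h * Λ ≤ 1 :=
      mul_le_of_le_div_add_one hΛ hh0 (hhmin.trans ((min_le_left _ _).trans (min_le_left _ _)))
    have h2 : h * m ≤ 1 / 2 :=
      mul_le_of_le_div_add_one hmnn hh0 (hhmin.trans ((min_le_left _ _).trans (min_le_right _ _)))
    have h3 : h < η := by
      have := hhmin.trans ((min_le_right _ _).trans (min_le_left _ _))
      linarith
    have h4 : h * (Q * ℓ) ≤ e :=
      mul_le_of_le_div_add_one (by positivity) hh0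
        (hhmin.trans ((min_le_right _ _).trans (min_le_right _ _)))
    have hnh : n * h = ℓ := by rw [hh]; field_simp
    have ind : ∀ k : ℕ, k ≤ n → ∀ g : E → ℝ,
        TestClass (G0 * exp (Λ * (ℓ - k * h))) (B0 * exp (κ * (ℓ - k * h)))
          (r0 * exp (2 * m * (ℓ - k * h))) g →
        |δ (s + k * h) g| ≤ k * (h * (C * (Gm * (2 * e))) + h * h * Q) := by
      intro k
      induction k with
      | zero => intro _ g hg; simp [h0 g hg.isTest]
      | succ k ih =>
        intro hk g hg
        have hkn : ((k : ℝ) + 1) * h ≤ ℓ := by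
          rw [← hnh]; gcongr; exact_mod_cast hk
        have hkh : 0 ≤ k * h := by positivity
        push_cast at hg ⊢
        have hσ : s + k * h ∈ Set.Icc s T := ⟨by linarith, by linarith⟩
        have hσh : s + k * h + h ∈ Set.Icc s T := ⟨by linarith, by linarith⟩
        obtain ⟨v, hvs, hvW, hvΛ, hvB⟩ := hmol (W (s + k * h)) (H.lip _ hσ)
        have hvm : ∀ x, ‖v x‖ ≤ m * (1 + ‖x‖) := fun x => by
          have a1 := hvW x
          have a2 := hWlin _ hσ x
          have a3 := norm_le_norm_add_norm_sub (W (s + k * h) x) (v x)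
          rw [norm_sub_rev] at a3
          have : 0 ≤ m0 * ‖x‖ := by positivity
          rw [hm, show (m0 + Λ) * (1 + ‖x‖) = m0 + Λ + m0 * ‖x‖ + Λ * ‖x‖ by ring]
          linarith
        have hl : ∀ c : ℝ, 0 ≤ c → c * (ℓ - (k + 1) * h) ≤ c * ℓ := fun c hc =>
          mul_le_mul_of_nonneg_left (by linarith) hc
        have hl' : ∀ c : ℝ, 0 ≤ c → c * (ℓ - k * h) ≤ c * ℓ := fun c hc =>
          mul_le_mul_of_nonneg_left (by linarith) hc
        have hGle : G0 * exp (Λ * (ℓ - (k + 1) * h)) ≤ Gm := by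
          rw [hGm]; gcongr G0 * exp ?_; exact hl _ hΛ
        have hBle : B0 * exp (κ * (ℓ - (k + 1) * h)) ≤ Bm := by
          rw [hBm]; gcongr B0 * exp ?_; exact hl _ hκ0
        have hrle : r0 * exp (2 * m * (ℓ - (k + 1) * h)) ≤ R := by
          rw [hR]; gcongr r0 * exp ?_; exact hl _ (by positivity)
        have hrle' : r0 * exp (2 * m * (ℓ - k * h)) ≤ R := by
          rw [hR]; gcongr r0 * exp ?_; exact hl' _ (by positivity)
        have hB1 : 1 ≤ B0 * exp (κ * (ℓ - (k + 1) * h)) := by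
          have : 1 ≤ exp (κ * (ℓ - (k + 1) * h)) :=
            one_le_exp (mul_nonneg hκ0 (by linarith))
          exact one_le_mul_of_one_le_of_one_le hB0 this
        have hg' := (hg.comp_euler hB1 (by positivity) hmnn hΛ hBv hvs hvΛ hvB hvm hh0 h1 h2).mono
          (G' := G0 * exp (Λ * (ℓ - k * h))) (B' := B0 * exp (κ * (ℓ - k * h)))
          (r' := r0 * exp (2 * m * (ℓ - k * h)))
          (by rw [mul_assoc, ← exp_add]; exact le_of_eq (by ring_nf))
          (by
            rw [mul_assoc, ← exp_add]
            gcongr B0 * exp ?_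
            have : (3 * Λ + G0 * exp (Λ * (ℓ - (k + 1) * h)) * Bv) * h ≤ κ * h := by
              rw [hκ]; gcongr
            linarith)
          (by rw [mul_assoc, ← exp_add]; exact le_of_eq (by ring_nf))
        have hstep := H.euler_step (M := M) (e := 2 * e) hσ hσh hh0
          (hg.mono hGle hBle hrle) hBm0 hvs hvΛ hg'.supp le_rfl hrle'
          (fun x hx => (hvm x).trans (by rw [hM]; gcongr))
          (fun τ hτ x hx => (hWlin τ hτ x).trans (by
            have : 0 ≤ m0 * ‖x‖ := by positivity
            have : m * (1 + ‖x‖) ≤ m * R := by gcongr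
            rw [hm, show (m0 + Λ) * (1 + ‖x‖) = m0 + Λ + m0 * ‖x‖ + Λ * ‖x‖ by ring] at this
            rw [hM, hm]
            linarith)) hM0 (by positivity)
          (fun τ hτ x hx => by
            have a1 := huc τ ⟨hσ.1.trans hτ.1, hτ.2.trans hσh.2⟩ (s + k * h) hσ
              (by rw [abs_of_nonneg (by linarith [hτ.1])]; linarith [hτ.2]) x hx
            have a2 := hvW x
            rw [norm_sub_rev] at a2
            have a3 := norm_sub_le_norm_sub_add_norm_sub (W τ x) (W (s + k * h) x) (v x)
            linarith)
        have hi := ih (by omega) _ hg'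
        rw [show s + ((k : ℝ) + 1) * h = s + k * h + h by ring]
        have := abs_sub_abs_le_abs_sub (δ (s + k * h + h) g)
          (δ (s + k * h) (fun x => g (x + h • v x)))
        have e1 : h * (C * (Gm * (2 * e))) + h * (C * ((Bm * M + Gm * Λ) * M) * h) +
          C * (Bm * (h * M) * (h * M)) = h * (C * (Gm * (2 * e))) + h * h * Q := by
          rw [hQ]; ring
        rw [e1] at hstep
        linarith
    have := ind n le_rfl g (by simpa [hnh] using hgc)
    rw [hnh, hℓ, add_sub_cancel] at this
    refine this.trans ?_
    have e2 : n * (h * (C * (Gm * (2 * e))) + h * h * Q) =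
        (n * h) * (C * (Gm * (2 * e))) + h * (Q * (n * h)) := by ring
    rw [e2, hnh]
    linarith
  by_contra hne
  have hpos : 0 < |δ T g| := abs_pos.2 hne
  have := key (|δ T g| / (2 * (ℓ * (C * (Gm * 2)) + 1))) (by positivity)
  have hP : 0 ≤ ℓ * (C * (Gm * 2)) := by positivity
  have e3 : ℓ * (C * (Gm * (2 * (|δ T g| / (2 * (ℓ * (C * (Gm * 2)) + 1)))))) +
      |δ T g| / (2 * (ℓ * (C * (Gm * 2)) + 1)) = |δ T g| / 2 := by
    field_simp
  rw [e3] at this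
  linarith

end EulerScheme

section Flow

set_option linter.unusedSectionVars false

variable {E : Type*} [NormedAddCommGroup E] [InnerProductSpace ℝ E] [FiniteDimensional ℝ E]

/-- A time dependent vector field on `[s, T]`, continuous in time and Lipschitz in space. -/
structure IsLipField (W : ℝ → E → E) (s T Λ : ℝ) : Prop where
  nonneg : 0 ≤ Λ
  lip : ∀ τ ∈ Set.Icc s T, ∀ x y, ‖W τ x - W τ y‖ ≤ Λ * ‖x - y‖
  cont : ∀ x, ContinuousOn (fun τ => W τ x) (Set.Icc s T)

variable {W : ℝ → E → E} {s T Λ : ℝ}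

theorem IsLipField.mono {s' T' : ℝ} (H : IsLipField W s T Λ) (hs : s ≤ s') (hT : T' ≤ T) :
    IsLipField W s' T' Λ :=
  ⟨H.nonneg, fun τ hτ => H.lip τ ⟨hs.trans hτ.1, hτ.2.trans hT⟩,
    fun x => (H.cont x).mono (Set.Icc_subset_Icc hs hT)⟩

theorem IsLipField.lipschitzWith (H : IsLipField W s T Λ) {τ : ℝ} (hτ : τ ∈ Set.Icc s T) :
    LipschitzWith (Real.toNNReal Λ) (W τ) :=
  LipschitzWith.of_dist_le_mul fun x y => by
    rw [dist_eq_norm, dist_eq_norm, Real.coe_toNNReal _ H.nonneg]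
    exact H.lip τ hτ x y

theorem IsLipField.exists_linear_bound (H : IsLipField W s T Λ) (hsT : s ≤ T) :
    ∃ m, 0 ≤ m ∧ ∀ τ ∈ Set.Icc s T, ∀ x, ‖W τ x‖ ≤ m + Λ * ‖x‖ := by
  obtain ⟨m, hm⟩ := isCompact_Icc.exists_bound_of_continuousOn (H.cont 0)
  refine ⟨m, (norm_nonneg _).trans (hm s (Set.left_mem_Icc.2 hsT)), fun τ hτ x => ?_⟩
  have h1 := H.lip τ hτ x 0
  have h2 := hm τ hτ
  have h3 := norm_le_norm_add_norm_sub (W τ 0) (W τ x)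
  rw [norm_sub_rev] at h3
  rw [sub_zero] at h1
  linarith

theorem IsLipField.exists_solution_short (H : IsLipField W s T Λ) (hsT : s ≤ T)
    (hshort : Λ * (T - s) ≤ 1 / 2) (x₀ : E) :
    ∃ α : ℝ → E, α s = x₀ ∧
      ∀ τ ∈ Set.Icc s T, HasDerivWithinAt α (W τ (α τ)) (Set.Icc s T) τ := by
  obtain ⟨m, hm0, hm⟩ := H.exists_linear_bound hsT
  have hd : 0 ≤ T - s := sub_nonneg.2 hsT
  have hΛ := H.nonneg
  set a : ℝ := 2 * (m + Λ * ‖x₀‖) * (T - s) with ha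
  have ha0 : 0 ≤ a := by positivity
  have hbd : ∀ t ∈ Set.Icc s T, ∀ x ∈ Metric.closedBall x₀ a,
      ‖W t x‖ ≤ m + Λ * (‖x₀‖ + a) := fun t ht x hx => by
    refine (hm t ht x).trans ?_
    rw [mem_closedBall_iff_norm] at hx
    have : ‖x‖ ≤ ‖x₀‖ + a := by
      have := norm_le_norm_add_norm_sub x₀ x
      rw [norm_sub_rev] at this
      linarith
    gcongr
  have hPL : IsPicardLindelof W (⟨s, Set.left_mem_Icc.2 hsT⟩ : Set.Icc s T) x₀ a.toNNReal 0
      (m + Λ * (‖x₀‖ + a)).toNNReal Λ.toNNReal := by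
    refine ⟨fun t ht => (H.lipschitzWith ht).lipschitzOnWith, fun x _ => H.cont x, ?_, ?_⟩
    · intro t ht x hx
      rw [Real.coe_toNNReal _ ha0] at hx
      exact (hbd t ht x hx).trans (Real.le_coe_toNNReal _)
    · rw [Real.coe_toNNReal _ (by positivity), Real.coe_toNNReal _ ha0]
      simp only [sub_self, NNReal.coe_zero, sub_zero]
      rw [max_eq_left hd]
      have h1 : Λ * (T - s) * a ≤ 1 / 2 * a := by gcongr
      have h2 : a = 2 * (m + Λ * ‖x₀‖) * (T - s) := ha
      calc (m + Λ * (‖x₀‖ + a)) * (T - s) = (m + Λ * ‖x₀‖) * (T - s) + Λ * (T - s) * a := by ring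
        _ ≤ a := by linarith
  exact hPL.exists_eq_forall_mem_Icc_hasDerivWithinAt₀

theorem IsLipField.exists_solution (H : IsLipField W s T Λ) (hsT : s ≤ T) (x₀ : E) :
    ∃ α : ℝ → E, α s = x₀ ∧
      ∀ τ ∈ Set.Icc s T, HasDerivWithinAt α (W τ (α τ)) (Set.Icc s T) τ := by
  have hΛ := H.nonneg
  have hd : 0 ≤ T - s := sub_nonneg.2 hsT
  obtain ⟨n, hn⟩ := exists_nat_gt (2 * Λ * (T - s))
  have hn0 : (0 : ℝ) < n := lt_of_le_of_lt (by positivity) hn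
  set h := (T - s) / n with hh
  have hh0 : 0 ≤ h := by positivity
  have hnh : n * h = T - s := by rw [hh]; field_simp
  have hshort : Λ * h ≤ 1 / 2 := by
    rw [hh, ← mul_div_assoc, div_le_iff₀ hn0]; linarith
  have ind : ∀ k : ℕ, k ≤ n → ∃ α : ℝ → E, α s = x₀ ∧
      ∀ τ ∈ Set.Icc s (s + k * h), HasDerivWithinAt α (W τ (α τ)) (Set.Icc s (s + k * h)) τ := by
    intro k
    induction k with
    | zero =>
      intro _
      refine ⟨fun _ => x₀, rfl, fun τ hτ => ?_⟩
      simp only [CharP.cast_eq_zero, zero_mul, add_zero, Set.Icc_self] at hτ ⊢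
      rw [Set.mem_singleton_iff] at hτ
      subst hτ
      exact HasFDerivWithinAt.of_finite (Set.finite_singleton _)
    | succ k ih =>
      intro hk
      obtain ⟨α, hα0, hα⟩ := ih (by omega)
      have hkn : ((k : ℝ) + 1) * h ≤ T - s := by
        rw [← hnh]; gcongr; exact_mod_cast hk
      have hkh : 0 ≤ k * h := by positivity
      set b := s + k * h with hb
      have hbe : s + ((k + 1 : ℕ) : ℝ) * h = b + h := by push_cast; rw [hb]; ring
      rw [hbe]
      obtain ⟨β, hβ0, hβ⟩ := (H.mono (s' := b) (T' := b + h) (by linarith) (by linarith)).exists_solution_short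
        (by linarith) (by rw [add_sub_cancel_left]; exact hshort) (α b)
      refine ⟨fun τ => if τ ≤ b then α τ else β τ, ?_, fun τ hτ => ?_⟩
      · have hsb : s ≤ b := by linarith
        simp [hsb, hα0]
      · have hun : Set.Icc s (b + h) = Set.Icc s b ∪ Set.Icc b (b + h) :=
          (Set.Icc_union_Icc_eq_Icc (by linarith) (by linarith)).symm
        have eα : ∀ τ ∈ Set.Icc s b, (fun τ => if τ ≤ b then α τ else β τ) τ = α τ :=
          fun τ hτ => if_pos hτ.2
        have eβ : ∀ τ ∈ Set.Icc b (b + h), (fun τ => if τ ≤ b then α τ else β τ) τ = β τ := by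
          intro τ hτ
          rcases hτ.1.eq_or_lt with rfl | hlt
          · simp [hβ0]
          · exact if_neg (not_le.2 hlt)
        have dα : ∀ τ ∈ Set.Icc s b, HasDerivWithinAt (fun τ => if τ ≤ b then α τ else β τ)
            (W τ ((fun τ => if τ ≤ b then α τ else β τ) τ)) (Set.Icc s b) τ := fun τ hτ => by
          rw [eα τ hτ]; exact (hα τ hτ).congr eα (eα τ hτ)
        have dβ : ∀ τ ∈ Set.Icc b (b + h), HasDerivWithinAt (fun τ => if τ ≤ b then α τ else β τ)
            (W τ ((fun τ => if τ ≤ b then α τ else β τ) τ)) (Set.Icc b (b + h)) τ := fun τ hτ => by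
          rw [eβ τ hτ]; exact (hβ τ hτ).congr eβ (eβ τ hτ)
        rcases lt_trichotomy τ b with hlt | rfl | hgt
        · refine (dα τ ⟨hτ.1, hlt.le⟩).mono_of_mem_nhdsWithin ?_
          rw [mem_nhdsWithin]
          exact ⟨Set.Iio b, isOpen_Iio, hlt, fun y hy => ⟨hy.2.1, le_of_lt hy.1⟩⟩
        · rw [hun]
          exact (dα _ ⟨hτ.1, le_rfl⟩).union (dβ _ ⟨le_rfl, hτ.2⟩)
        · refine (dβ τ ⟨hgt.le, hτ.2⟩).mono_of_mem_nhdsWithin ?_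
          rw [mem_nhdsWithin]
          exact ⟨Set.Ioi b, isOpen_Ioi, hgt, fun y hy => ⟨le_of_lt hy.1, hy.2.2⟩⟩
  obtain ⟨α, h1, h2⟩ := ind n le_rfl
  rw [hnh, add_sub_cancel] at h2
  exact ⟨α, h1, h2⟩

/-- `X` is the flow of the vector field `W` started at time `s`. -/
structure IsFlow (X W : ℝ → E → E) (s T Λ : ℝ) : Prop where
  init : ∀ z, X s z = z
  deriv : ∀ z, ∀ τ ∈ Set.Icc s T,
    HasDerivWithinAt (fun τ => X τ z) (W τ (X τ z)) (Set.Icc s T) τ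
  lip : ∀ τ ∈ Set.Icc s T, ∀ z z', ‖X τ z - X τ z'‖ ≤ exp (Λ * (τ - s)) * ‖z - z'‖

theorem HasDerivWithinAt.Ici_of_Icc {α : ℝ → E} {α' : E} {τ : ℝ}
    (h : HasDerivWithinAt α α' (Set.Icc s T) τ) (hτ : τ ∈ Set.Ico s T) :
    HasDerivWithinAt α α' (Set.Ici τ) τ := by
  refine h.mono_of_mem_nhdsWithin ?_
  exact mem_of_superset (Icc_mem_nhdsGE_of_mem ⟨le_rfl, hτ.2⟩)
    (Set.Icc_subset_Icc_left hτ.1)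

theorem IsLipField.exists_flow (H : IsLipField W s T Λ) (hsT : s ≤ T) :
    ∃ X : ℝ → E → E, IsFlow X W s T Λ := by
  choose α hα0 hα using H.exists_solution hsT
  refine ⟨fun τ z => α z τ, hα0, hα, fun τ hτ z z' => ?_⟩
  have hW : ∀ t ∈ Set.Ico s T, LipschitzOnWith Λ.toNNReal (W t) Set.univ := fun t ht =>
    (H.lipschitzWith ⟨ht.1, ht.2.le⟩).lipschitzOnWith
  have := dist_le_of_trajectories_ODE_of_mem (v := W) (s := fun _ => Set.univ)
    (K := Λ.toNNReal) (f := α z) (g := α z') (a := s) (b := T) (δ := ‖z - z'‖) hW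
    (fun t ht => (hα z t ht).continuousWithinAt)
    (fun t ht => (hα z t ⟨ht.1, ht.2.le⟩).Ici_of_Icc ht) (fun t ht => trivial)
    (fun t ht => (hα z' t ht).continuousWithinAt)
    (fun t ht => (hα z' t ⟨ht.1, ht.2.le⟩).Ici_of_Icc ht) (fun t ht => trivial)
    (by rw [hα0, hα0, dist_eq_norm]) τ hτ
  rw [Real.coe_toNNReal _ H.nonneg, dist_eq_norm] at this
  linarith

theorem IsFlow.continuous {X : ℝ → E → E} (h : IsFlow X W s T Λ) {τ : ℝ} (hτ : τ ∈ Set.Icc s T) :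
    Continuous (X τ) := continuous_of_norm_sub_le (h.lip τ hτ)

end Flow

section ParametricIntegral

theorem hasDerivWithinAt_integral_of_dominated_lipschitz {α : Type*} [MeasurableSpace α]
    {μ : Measure α} {F : ℝ → α → ℝ} {F' b : α → ℝ} {S : Set ℝ} {τ : ℝ}
    (hint : ∀ σ ∈ S, Integrable (F σ) μ) (hτ : τ ∈ S) (hb : Integrable b μ)
    (hlip : ∀ σ ∈ S, ∀ a, |F σ a - F τ a| ≤ b a * |σ - τ|)
    (hd : ∀ a, HasDerivWithinAt (fun σ => F σ a) (F' a) S τ) :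
    HasDerivWithinAt (fun σ => ∫ a, F σ a ∂μ) (∫ a, F' a ∂μ) S τ := by
  rw [hasDerivWithinAt_iff_tendsto_slope]
  have h1 : Tendsto (fun σ => ∫ a, slope (fun σ => F σ a) τ σ ∂μ) (𝓝[S \ {τ}] τ)
      (𝓝 (∫ a, F' a ∂μ)) := by
    refine tendsto_integral_filter_of_dominated_convergence b ?_ ?_ hb ?_
    · filter_upwards [self_mem_nhdsWithin] with σ hσ
      simp only [slope_def_field]
      exact (((hint σ hσ.1).sub (hint τ hτ)).div_const _).aestronglyMeasurable
    · filter_upwards [self_mem_nhdsWithin] with σ hσ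
      refine ae_of_all _ fun a => ?_
      have hne : 0 < |σ - τ| := abs_pos.2 (sub_ne_zero.2 hσ.2)
      rw [slope_def_field, Real.norm_eq_abs, abs_div, div_le_iff₀ hne]
      exact hlip σ hσ.1 a
    · exact ae_of_all _ fun a => hasDerivWithinAt_iff_tendsto_slope.1 (hd a)
  refine h1.congr' ?_
  filter_upwards [self_mem_nhdsWithin] with σ hσ
  simp only [slope_def_field]
  rw [integral_div, integral_sub (hint σ hσ.1) (hint τ hτ)]

end ParametricIntegral

section Transport

set_option linter.unusedSectionVars false

variable {E : Type*} [NormedAddCommGroup E] [InnerProductSpace ℝ E] [FiniteDimensional ℝ E]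
  [MeasurableSpace E] [BorelSpace E]

/-- `g` solves `∂ₜ g + div (g W) = 0` weakly on `[s, T]`, with total variation at most `C`. -/
structure IsTransportSol (g : ℝ → E → ℝ) (W : ℝ → E → E) (s T C : ℝ) : Prop where
  int : ∀ τ ∈ Set.Icc s T, Integrable (g τ)
  bound : ∀ τ ∈ Set.Icc s T, ∫ z, |g τ z| ≤ C
  deriv : ∀ φ, IsTest φ → ∀ τ ∈ Set.Icc s T,
    HasDerivWithinAt (fun τ => ∫ z, φ z * g τ z) (∫ z, fderiv ℝ φ z (W τ z) * g τ z)
      (Set.Icc s T) τ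

theorem Continuous.integrable_mul_of_bounded {μ : Measure E} {φ g : E → ℝ} (hφ : Continuous φ) {M : ℝ}
    (hM : ∀ x, |φ x| ≤ M) (hg : Integrable g μ) : Integrable (fun z => φ z * g z) μ :=
  hg.bdd_mul hφ.aestronglyMeasurable (ae_of_all _ hM)

theorem abs_integral_mul_le {μ : Measure E} {φ g : E → ℝ} {M : ℝ}
    (hM : ∀ x, |φ x| ≤ M) (hg : Integrable g μ) :
    |∫ z, φ z * g z ∂μ| ≤ M * ∫ z, |g z| ∂μ := by
  rw [← integral_const_mul, ← Real.norm_eq_abs]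
  refine norm_integral_le_of_norm_le (hg.abs.const_mul M) (ae_of_all _ fun z => ?_)
  rw [norm_mul]
  exact mul_le_mul_of_nonneg_right (hM z) (norm_nonneg _)

theorem IsTest.exists_abs_le {φ : E → ℝ} (h : IsTest φ) : ∃ M, ∀ x, |φ x| ≤ M :=
  HasCompactSupport.exists_norm_le h.supp h.smooth.continuous

variable {g : ℝ → E → ℝ} {W X : ℝ → E → E} {s T C Λ : ℝ}

theorem IsFlow.hasDerivWithinAt_integral (hX : IsFlow X W s T Λ) (hW : IsLipField W s T Λ)
    (hsT : s ≤ T) {g₀ : E → ℝ} (hg : Integrable g₀) {φ : E → ℝ} (hφ : IsTest φ) {τ : ℝ}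
    (hτ : τ ∈ Set.Icc s T) :
    HasDerivWithinAt (fun τ => ∫ z, φ (X τ z) * g₀ z)
      (∫ z, fderiv ℝ φ (X τ z) (W τ (X τ z)) * g₀ z) (Set.Icc s T) τ := by
  obtain ⟨G, B, r, hG, hB, hr, hc⟩ := hφ.exists_testClass
  obtain ⟨M, hM⟩ := hφ.exists_abs_le
  obtain ⟨m, hm0, hm⟩ := hW.exists_linear_bound hsT
  have hΛ := hW.nonneg
  have hz := fderiv_eq_zero_of_eq_zero hc.supp
  have hder : ∀ z, ∀ τ ∈ Set.Icc s T, HasDerivWithinAt (fun τ => φ (X τ z))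
      (fderiv ℝ φ (X τ z) (W τ (X τ z))) (Set.Icc s T) τ := fun z τ hτ =>
    ((hφ.smooth.differentiable (by simp) (X τ z)).hasFDerivAt).comp_hasDerivWithinAt τ
      (hX.deriv z τ hτ)
  have hbd : ∀ τ ∈ Set.Icc s T, ∀ x, ‖fderiv ℝ φ x (W τ x)‖ ≤ G * (m + Λ * r) := by
    intro τ hτ x
    rcases le_or_gt (1 + ‖x‖) r with hx | hx
    · refine (ContinuousLinearMap.le_opNorm _ _).trans (mul_le_mul (hc.grad x) ?_
        (norm_nonneg _) hG)
      refine (hm τ hτ x).trans ?_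
      gcongr; linarith
    · rw [hz x hx]; simp; positivity
  refine hasDerivWithinAt_integral_of_dominated_lipschitz
    (b := fun z => G * (m + Λ * r) * |g₀ z|) (fun σ hσ => ?_) hτ (hg.abs.const_mul _)
    (fun σ hσ z => ?_) (fun z => (hder z τ hτ).mul_const _)
  · exact (hφ.smooth.continuous.comp (hX.continuous hσ)).integrable_mul_of_bounded
      (fun x => hM _) hg
  · have := (convex_Icc s T).norm_image_sub_le_of_norm_hasDerivWithin_le (𝕜 := ℝ)
      (fun y hy => hder z y hy) (fun y hy => hbd y hy (X y z)) hτ hσ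
    rw [Real.norm_eq_abs, Real.norm_eq_abs] at this
    rw [← sub_mul, abs_mul, mul_right_comm]
    gcongr

theorem IsTransportSol.integral_eq (hg : IsTransportSol g W s T C) (hX : IsFlow X W s T Λ)
    (hW : IsLipField W s T Λ) (hsT : s ≤ T) {φ : E → ℝ} (hφ : IsTest φ) :
    ∫ z, φ z * g T z = ∫ z, φ (X T z) * g s z := by
  have hs : s ∈ Set.Icc s T := Set.left_mem_Icc.2 hsT
  have hCb : ∀ {φ : E → ℝ}, Continuous φ → HasCompactSupport φ → ∃ M, ∀ x, |φ x| ≤ M :=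
    fun h1 h2 => HasCompactSupport.exists_norm_le h2 h1
  have hi1 : ∀ τ ∈ Set.Icc s T, ∀ φ : E → ℝ, Continuous φ → HasCompactSupport φ →
      Integrable fun z => φ z * g τ z := fun τ hτ φ h1 h2 => by
    obtain ⟨M, hM⟩ := hCb h1 h2
    exact h1.integrable_mul_of_bounded hM (hg.int τ hτ)
  have hi2 : ∀ τ ∈ Set.Icc s T, ∀ φ : E → ℝ, Continuous φ → HasCompactSupport φ →
      Integrable fun z => φ (X τ z) * g s z := fun τ hτ φ h1 h2 => by
    obtain ⟨M, hM⟩ := hCb h1 h2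
    exact (h1.comp (hX.continuous hτ)).integrable_mul_of_bounded (fun x => hM _) (hg.int s hs)
  have H : IsTransported (fun τ φ => (∫ z, φ z * g τ z) - ∫ z, φ (X τ z) * g s z) W s T
      (2 * C) Λ := by
    refine ⟨?_, ?_, ?_, ?_, hW.nonneg, hW.lip, hW.cont, ?_⟩
    · intro τ hτ φ ψ h1 h2 h3 h4
      simp only [sub_mul]
      rw [integral_sub (hi1 τ hτ φ h1 h2) (hi1 τ hτ ψ h3 h4),
        integral_sub (hi2 τ hτ φ h1 h2) (hi2 τ hτ ψ h3 h4)]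
      ring
    · intro τ hτ c φ h1 h2
      simp only [mul_assoc, integral_const_mul]
      ring
    · intro τ hτ φ h1 h2 M hM
      have hM0 : 0 ≤ M := (abs_nonneg _).trans (hM 0)
      have a1 := (abs_integral_mul_le hM (hg.int τ hτ)).trans
        (mul_le_mul_of_nonneg_left (hg.bound τ hτ) hM0)
      have a2 := (abs_integral_mul_le (φ := fun z => φ (X τ z)) (fun x => hM _) (hg.int s hs)).trans
        (mul_le_mul_of_nonneg_left (hg.bound s hs) hM0)
      refine (abs_sub _ _).trans ?_
      linarith
    · exact mul_nonneg zero_le_two ((integral_nonneg fun _ => abs_nonneg _).trans (hg.bound s hs))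
    · intro φ hφ τ hτ
      exact (hg.deriv φ hφ τ hτ).sub (hX.hasDerivWithinAt_integral hW hsT (hg.int s hs) hφ hτ)
  have := H.eq_zero hsT (fun φ _ => by simp [hX.init]) φ hφ
  linarith

theorem IsTransportSol.mono {s' T' : ℝ} (hg : IsTransportSol g W s T C) (hs : s ≤ s')
    (hT : T' ≤ T) : IsTransportSol g W s' T' C :=
  have hsub := Set.Icc_subset_Icc hs hT
  ⟨fun τ hτ => hg.int τ (hsub hτ), fun τ hτ => hg.bound τ (hsub hτ),
    fun φ hφ τ hτ => (hg.deriv φ hφ τ (hsub hτ)).mono hsub⟩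

end Transport

section Duality

set_option linter.unusedSectionVars false

variable {E : Type*} [NormedAddCommGroup E] [InnerProductSpace ℝ E] [FiniteDimensional ℝ E]
  [MeasurableSpace E] [BorelSpace E]

/-- The integral of `|g|` is determined by testing against smooth functions. -/
theorem lintegral_enorm_le_of_integral_test_le {g : E → ℝ} (hg : LocallyIntegrable g)
    {B : ℝ}
    (h : ∀ φ, IsTest φ → (∀ x, |φ x| ≤ 1) → ∫ z, φ z * g z ≤ B) :
    ∫⁻ z, ‖g z‖ₑ ≤ ENNReal.ofReal B := by
  have key : ∀ n : ℕ, ∫⁻ z in Metric.ball (0 : E) n, ‖g z‖ₑ ≤ ENNReal.ofReal B := by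
    intro n
    obtain ⟨g', hg'm, hgg'⟩ := hg.aestronglyMeasurable
    let σ : E → ℝ := (Metric.ball (0 : E) n).indicator fun z => (SignType.sign (g' z) : ℝ)
    have hsm : Measurable fun z => (SignType.sign (g' z) : ℝ) := by
      have : (fun z => (SignType.sign (g' z) : ℝ)) =
          fun z => if 0 < g' z then 1 else if g' z < 0 then -1 else 0 := by
        ext z; simp only [sign_apply]; split_ifs <;> simp
      rw [this]
      exact Measurable.ite (measurableSet_lt measurable_const hg'm.measurable) measurable_const
        (Measurable.ite (measurableSet_lt hg'm.measurable measurable_const) measurable_const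
          measurable_const)
    have hσm : Measurable σ := hsm.indicator measurableSet_ball
    have hs1 : ∀ r : ℝ, |(SignType.sign r : ℝ)| ≤ 1 := fun r => by
      rcases lt_trichotomy r 0 with h | h | h <;> simp [h]
    have hσ1 : ∀ z, |σ z| ≤ 1 := fun z => by
      by_cases hz : z ∈ Metric.ball (0 : E) n
      · simpa only [σ, Set.indicator_of_mem hz] using hs1 _
      · simp [σ, Set.indicator_of_notMem hz]
    have hσi : Integrable σ := by
      have : IntegrableOn (fun z => (SignType.sign (g' z) : ℝ)) (Metric.ball (0 : E) n) :=
        Measure.integrableOn_of_bounded measure_ball_lt_top.ne hsm.aestronglyMeasurable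
          (M := 1) (ae_of_all _ fun z => hs1 _)
      exact this.integrable_indicator measurableSet_ball
    let ψ : ℕ → ContDiffBump (0 : E) := fun k =>
      ⟨1 / (k + 1) / 2, 1 / (k + 1), by positivity, half_lt_self (by positivity)⟩
    let φ : ℕ → E → ℝ := fun k => (ψ k).normed volume ⋆[ContinuousLinearMap.lsmul ℝ ℝ, volume] σ
    have hφ1 : ∀ k x, |φ k x| ≤ 1 := fun k x => by
      have h1 : ∀ t, ‖(ψ k).normed volume t • σ (x - t)‖ ≤ (ψ k).normed volume t := fun t => by
        rw [norm_smul, Real.norm_of_nonneg ((ψ k).nonneg_normed t)]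
        exact mul_le_of_le_one_right ((ψ k).nonneg_normed t) (hσ1 _)
      have h2 := norm_integral_le_of_norm_le (ψ k).integrable_normed (ae_of_all _ h1)
      rwa [(ψ k).integral_normed] at h2
    have hout : ∀ k, (ψ k).rOut ≤ 1 := fun k => by
      change 1 / ((k : ℝ) + 1) ≤ 1
      rw [div_le_one (by positivity)]; linarith [(Nat.cast_nonneg k : (0 : ℝ) ≤ k)]
    have hφ0 : ∀ k x, x ∉ Metric.closedBall (0 : E) (n + 1) → φ k x = 0 := fun k x hx => by
      by_contra hne
      have := support_convolution_subset (ContinuousLinearMap.lsmul ℝ ℝ) (μ := volume) hne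
      obtain ⟨p, hp, q, hq, rfl⟩ := Set.mem_add.1 this
      rw [(ψ k).support_normed_eq, mem_ball_zero_iff] at hp
      have hq' : q ∈ Metric.ball (0 : E) n := Set.mem_of_indicator_ne_zero hq
      rw [mem_ball_zero_iff] at hq'
      rw [mem_closedBall_zero_iff] at hx
      linarith [norm_add_le p q, hout k]
    have hφt : ∀ k, IsTest (φ k) := fun k =>
      ⟨(ψ k).hasCompactSupport_normed.contDiff_convolution_left (n := ⊤) _
        (ψ k).contDiff_normed hσi.locallyIntegrable,
        HasCompactSupport.intro (isCompact_closedBall _ _) (hφ0 k)⟩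
    have hlim : ∀ᵐ x, Tendsto (fun k => φ k x) atTop (𝓝 (σ x)) := by
      refine ContDiffBump.ae_convolution_tendsto_right_of_locallyIntegrable (K := 2) ?_
        (.of_forall fun k => ?_) hσi.locallyIntegrable
      · exact tendsto_one_div_add_atTop_nhds_zero_nat
      · change 1 / ((k : ℝ) + 1) ≤ 2 * (1 / ((k : ℝ) + 1) / 2)
        linarith
    have hT : Tendsto (fun k => ∫ z, φ k z * g z) atTop (𝓝 (∫ z, σ z * g z)) := by
      refine tendsto_integral_of_dominated_convergence
        ((Metric.closedBall (0 : E) (n + 1)).indicator fun z => ‖g z‖) (fun k => ?_) ?_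
        (fun k => ae_of_all _ fun z => ?_) ?_
      · exact (hφt k).smooth.continuous.aestronglyMeasurable.mul hg.aestronglyMeasurable
      · have : IntegrableOn (fun z => ‖g z‖) (Metric.closedBall (0 : E) (n + 1)) :=
          (hg.integrableOn_isCompact (isCompact_closedBall _ _)).norm
        exact this.integrable_indicator measurableSet_closedBall
      · by_cases hz : z ∈ Metric.closedBall (0 : E) (n + 1)
        · rw [Set.indicator_of_mem hz, norm_mul]
          exact mul_le_of_le_one_left (norm_nonneg _) (hφ1 k z)
        · rw [hφ0 k z hz, Set.indicator_of_notMem hz]; simp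
      · filter_upwards [hlim] with z hz using hz.mul_const _
    have hle : ∫ z, σ z * g z ≤ B := le_of_tendsto' hT fun k => h _ (hφt k) (hφ1 k)
    have heq : ∫ z, σ z * g z = ∫ z in Metric.ball (0 : E) n, ‖g z‖ := by
      rw [← integral_indicator measurableSet_ball]
      refine integral_congr_ae ?_
      filter_upwards [hgg'] with z hz
      by_cases hzb : z ∈ Metric.ball (0 : E) n
      · simp only [σ, Set.indicator_of_mem hzb]
        rw [hz, mul_comm, Real.norm_eq_abs, self_mul_sign]
      · simp only [σ, Set.indicator_of_notMem hzb, zero_mul]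
    have hio : IntegrableOn g (Metric.ball (0 : E) n) :=
      (hg.integrableOn_isCompact (isCompact_closedBall _ _)).mono_set Metric.ball_subset_closedBall
    rw [← ofReal_integral_norm_eq_lintegral_enorm hio]
    exact ENNReal.ofReal_le_ofReal (heq ▸ hle)
  have hU : (⋃ n : ℕ, Metric.ball (0 : E) n) = Set.univ := Metric.iUnion_ball_nat 0
  rw [← setLIntegral_univ, ← hU, setLIntegral_iUnion_of_directed]
  · exact iSup_le key
  · exact Monotone.directed_le fun m n hmn => Metric.ball_subset_ball (by exact_mod_cast hmn)

end Duality

section Weighted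

set_option linter.unusedSectionVars false

variable {E : Type*} [NormedAddCommGroup E] [InnerProductSpace ℝ E] [FiniteDimensional ℝ E]
  [MeasurableSpace E] [BorelSpace E]

theorem IsTest.mul_smooth {φ q : E → ℝ} (hφ : IsTest φ) (hq : ContDiff ℝ ∞ q) :
    IsTest fun z => φ z * q z :=
  ⟨hφ.smooth.mul hq, hφ.supp.mul_right⟩

variable {g : ℝ → E → ℝ} {W X : ℝ → E → E} {s T C Λ : ℝ}

/-- Weighted masses are propagated by the flow. -/
theorem IsTransportSol.lintegral_weight_le (hg : IsTransportSol g W s T C) (hX : IsFlow X W s T Λ)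
    (hW : IsLipField W s T Λ) (hsT : s ≤ T) {q : E → ℝ} (hq : ContDiff ℝ ∞ q) {c : ℝ} (hc : 0 < c)
    (hq0 : ∀ z, 0 ≤ q z) (hqX : ∀ z, q (X T z) ≤ c * q z) :
    ∫⁻ z, ‖q z * g T z‖ₑ ≤ ENNReal.ofReal c * ∫⁻ z, ‖q z * g s z‖ₑ := by
  by_cases hfin : ∫⁻ z, ‖q z * g s z‖ₑ = ⊤
  · rw [hfin, ENNReal.mul_top (ENNReal.ofReal_pos.2 hc).ne']; exact le_top
  have hi : Integrable fun z => q z * g s z :=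
    ⟨hq.continuous.aestronglyMeasurable.mul (hg.int s ⟨le_rfl, hsT⟩).aestronglyMeasurable,
      lt_top_iff_ne_top.2 hfin⟩
  rw [← ofReal_integral_norm_eq_lintegral_enorm hi, ← ENNReal.ofReal_mul hc.le]
  refine lintegral_enorm_le_of_integral_test_le ?_ fun φ hφ hφ1 => ?_
  · exact (hg.int T ⟨hsT, le_rfl⟩).locallyIntegrable.continuous_mul hq.continuous
  · have h1 := hg.integral_eq hX hW hsT (hφ.mul_smooth hq)
    simp only [mul_assoc] at h1 ⊢
    rw [h1, ← integral_const_mul]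
    refine (le_abs_self _).trans ?_
    rw [← Real.norm_eq_abs]
    refine norm_integral_le_of_norm_le (hi.norm.const_mul c) (ae_of_all _ fun z => ?_)
    simp only [norm_mul, Real.norm_eq_abs, abs_of_nonneg (hq0 _)]
    have h2 := hφ1 (X T z)
    have h3 := hqX z
    calc |φ (X T z)| * (q (X T z) * |g s z|) ≤ 1 * (q (X T z) * |g s z|) := by
          gcongr
          exact mul_nonneg (hq0 _) (abs_nonneg _)
      _ ≤ c * (q z * |g s z|) := by
          rw [one_mul, ← mul_assoc]; gcongr

theorem IsTransportSol.lintegral_le (hg : IsTransportSol g W s T C)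
    (hW : IsLipField W s T Λ) (hsT : s ≤ T) :
    ∫⁻ z, ‖g T z‖ₑ ≤ ∫⁻ z, ‖g s z‖ₑ := by
  obtain ⟨X, hX⟩ := hW.exists_flow hsT
  simpa using hg.lintegral_weight_le hX hW hsT (q := fun _ => 1) contDiff_const one_pos
    (fun _ => zero_le_one) (fun _ => by simp)

/-- A smooth weight comparable to `1 + ‖z‖`. -/
def japanese (z : E) : ℝ := √(1 + ‖z‖ ^ 2)

theorem japanese_smooth : ContDiff ℝ ∞ (japanese : E → ℝ) := by
  refine ContDiff.sqrt (contDiff_const.add (contDiff_norm_sq ℝ)) fun z => ?_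
  positivity

theorem japanese_nonneg (z : E) : 0 ≤ japanese z := Real.sqrt_nonneg _

theorem japanese_le (z : E) : japanese z ≤ 1 + ‖z‖ := by
  unfold japanese
  rw [Real.sqrt_le_left (by positivity)]
  nlinarith [norm_nonneg z]

theorem le_japanese (z : E) : 1 + ‖z‖ ≤ 2 * japanese z := by
  have : (1 + ‖z‖) / 2 ≤ japanese z := by
    refine Real.le_sqrt_of_sq_le ?_
    nlinarith [sq_nonneg (1 - ‖z‖), sq_nonneg ‖z‖]
  linarith

theorem IsFlow.one_add_norm_le (hX : IsFlow X W s T Λ) {m : ℝ} (hm : 0 < m)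
    (hW : ∀ τ ∈ Set.Icc s T, ∀ x, ‖W τ x‖ ≤ m * (1 + ‖x‖)) {τ : ℝ} (hτ : τ ∈ Set.Icc s T) (z : E) :
    1 + ‖X τ z‖ ≤ (1 + ‖z‖) * exp (m * (τ - s)) := by
  have := norm_le_gronwallBound_of_norm_deriv_right_le (f := fun τ => X τ z)
    (f' := fun τ => W τ (X τ z)) (δ := ‖z‖) (K := m) (ε := m) (a := s) (b := T)
    (fun τ hτ => (hX.deriv z τ hτ).continuousWithinAt)
    (fun τ hτ => (hX.deriv z τ ⟨hτ.1, hτ.2.le⟩).Ici_of_Icc hτ) (by simp [hX.init])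
    (fun τ hτ => by have := hW τ ⟨hτ.1, hτ.2.le⟩ (X τ z); linarith) τ hτ
  rw [gronwallBound_of_K_ne_0 hm.ne', div_self hm.ne'] at this
  linarith

theorem IsTransportSol.lintegral_japanese_le (hg : IsTransportSol g W s T C)
    (hW : IsLipField W s T Λ) (hsT : s ≤ T) {m : ℝ} (hm : 0 < m)
    (hWm : ∀ τ ∈ Set.Icc s T, ∀ x, ‖W τ x‖ ≤ m * (1 + ‖x‖)) :
    ∫⁻ z, ‖japanese z * g T z‖ₑ ≤
      ENNReal.ofReal (2 * exp (m * (T - s))) * ∫⁻ z, ‖japanese z * g s z‖ₑ := by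
  obtain ⟨X, hX⟩ := hW.exists_flow hsT
  refine hg.lintegral_weight_le hX hW hsT japanese_smooth (by positivity) japanese_nonneg
    fun z => ?_
  have h1 := hX.one_add_norm_le hm hWm ⟨hsT, le_rfl⟩ z
  have h2 := le_japanese z
  have h3 := japanese_le (X T z)
  calc japanese (X T z) ≤ (1 + ‖z‖) * exp (m * (T - s)) := h3.trans h1
    _ ≤ (2 * japanese z) * exp (m * (T - s)) := by gcongr
    _ = _ := by ring

end Weighted

section MeanField

set_option linter.unusedSectionVars false

variable {E : Type*} [NormedAddCommGroup E] [InnerProductSpace ℝ E] [FiniteDimensional ℝ E]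
  [MeasurableSpace E] [BorelSpace E]

/-- The velocity field of the mean field equation (with value `0` if the integral diverges). -/
def meanVel (K : E × E → E) (g : E → ℝ) (z : E) : E := ∫ z', g z' • K (z, z')

/-- Weak solutions of the mean field equation on the whole time axis. -/
structure IsMeanField (K : E × E → E) (L : ℝ) (f : ℝ → E → ℝ) : Prop where
  nonneg : 0 ≤ L
  smooth : ContDiff ℝ 1 K
  antisymm : ∀ z z', K (z, z') = -K (z', z)
  lip_left : ∀ x y z, ‖K (x, z) - K (y, z)‖ ≤ L * ‖x - y‖
  int : ∀ t, Integrable (f t)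
  weak : ∀ φ : E → ℝ, ContDiff ℝ 1 φ → (∃ C : ℝ, ∀ z, |φ z| ≤ C) →
    (∃ C : ℝ, ∀ z, ‖fderiv ℝ φ z‖ ≤ C) → ∀ t, HasDerivAt (fun s => ∫ z, φ z * f s z)
      (∫ z, fderiv ℝ φ z (meanVel K (f t) z) * f t z) t

variable {K : E × E → E} {L : ℝ} {f : ℝ → E → ℝ}

theorem IsMeanField.lip_right (H : IsMeanField K L f) (x y z : E) :
    ‖K (z, x) - K (z, y)‖ ≤ L * ‖x - y‖ := by
  rw [H.antisymm z x, H.antisymm z y, neg_sub_neg, norm_sub_rev]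
  exact H.lip_left x y z

theorem meanVel_neg (g : E → ℝ) (z : E) : meanVel (fun p => -K p) g z = -meanVel K g z := by
  simp only [meanVel, smul_neg, integral_neg]

theorem IsMeanField.reverse (H : IsMeanField K L f) :
    IsMeanField (fun p => -K p) L (fun t => f (-t)) where
  nonneg := H.nonneg
  smooth := H.smooth.neg
  antisymm z z' := by rw [H.antisymm z z']
  lip_left x y z := by rw [neg_sub_neg, norm_sub_rev]; exact H.lip_left x y z
  int t := H.int (-t)
  weak φ h1 h2 h3 t := by
    have := (H.weak φ h1 h2 h3 (-t)).scomp t (hasDerivAt_neg t)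
    simp only [meanVel_neg, map_neg, neg_mul, integral_neg]
    simp only [smul_eq_mul, neg_one_mul] at this
    exact this

theorem IsTest.exists_fderiv_le {φ : E → ℝ} (h : IsTest φ) : ∃ M, ∀ x, ‖fderiv ℝ φ x‖ ≤ M := by
  obtain ⟨G, _, _, _, _, _, hc⟩ := h.exists_testClass
  exact ⟨G, hc.grad⟩

theorem IsMeanField.hasDerivAt (H : IsMeanField K L f) {φ : E → ℝ} (hφ : IsTest φ) (t : ℝ) :
    HasDerivAt (fun s => ∫ z, φ z * f s z) (∫ z, fderiv ℝ φ z (meanVel K (f t) z) * f t z) t :=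
  H.weak φ (hφ.smooth.of_le (by simp)) hφ.exists_abs_le hφ.exists_fderiv_le t

theorem IsMeanField.continuous (H : IsMeanField K L f) {φ : E → ℝ} (hφ : IsTest φ) :
    Continuous fun s => ∫ z, φ z * f s z :=
  continuous_iff_continuousAt.2 fun t => (H.hasDerivAt hφ t).continuousAt

theorem IsMeanField.isClosed_weight_le (H : IsMeanField K L f) {q : E → ℝ} (hq : ContDiff ℝ ∞ q)
    {B : ℝ} (hB : 0 ≤ B) : IsClosed {t | ∫⁻ z, ‖q z * f t z‖ₑ ≤ ENNReal.ofReal B} := by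
  have : {t | ∫⁻ z, ‖q z * f t z‖ₑ ≤ ENNReal.ofReal B} =
      ⋂ φ ∈ {φ : E → ℝ | IsTest φ ∧ ∀ x, |φ x| ≤ 1},
        {t | ∫ z, φ z * q z * f t z ≤ B} := by
    ext t
    simp only [Set.mem_iInter, Set.mem_ofPred_eq]
    constructor
    · rintro h φ ⟨hφ, hφ1⟩
      have hi : Integrable fun z => q z * f t z :=
        ⟨hq.continuous.aestronglyMeasurable.mul (H.int t).aestronglyMeasurable,
          h.trans_lt ENNReal.ofReal_lt_top⟩
      rw [← ofReal_integral_norm_eq_lintegral_enorm hi, ENNReal.ofReal_le_ofReal_iff hB] at h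
      have := abs_integral_mul_le hφ1 hi
      simp only [Real.norm_eq_abs] at h
      simp only [mul_assoc]
      linarith [le_abs_self (∫ z, φ z * (q z * f t z))]
    · intro h
      refine lintegral_enorm_le_of_integral_test_le ?_ fun φ hφ hφ1 => ?_
      · exact (H.int t).locallyIntegrable.continuous_mul hq.continuous
      · simpa only [mul_assoc] using h φ ⟨hφ, hφ1⟩
  rw [this]
  exact isClosed_biInter fun φ hφ =>
    isClosed_le (H.continuous (hφ.1.mul_smooth hq)) continuous_const

theorem exists_isTest_close {ζ : E → ℝ} (hζ : Continuous ζ) (hs : HasCompactSupport ζ) {ε : ℝ}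
    (hε : 0 < ε) : ∃ ψ, IsTest ψ ∧ ∀ z, |ψ z - ζ z| ≤ ε := by
  obtain ⟨δ, hδ, hζδ⟩ := Metric.uniformContinuous_iff.1 (hs.uniformContinuous_of_continuous hζ)
    ε hε
  obtain ⟨ψ, hψ, h⟩ := hζ.exists_contDiff_dist_le_of_forall_mem_ball_dist_le hδ
  obtain ⟨R, hR⟩ := hs.isBounded.subset_closedBall (0 : E)
  have h0 : ∀ x, x ∉ Metric.closedBall (0 : E) R → ζ x = 0 := fun x hx =>
    image_eq_zero_of_notMem_tsupport fun h => hx (hR h)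
  refine ⟨ψ, ⟨hψ, HasCompactSupport.intro (isCompact_closedBall (0 : E) (R + δ)) fun x hx => ?_⟩,
    fun z => h z ε fun x hx => (hζδ hx).le⟩
  have hx' : ∀ y ∈ Metric.ball x δ, ζ y = 0 := fun y hy => h0 y fun hyR => hx <| by
    rw [Metric.mem_closedBall] at hyR ⊢
    rw [Metric.mem_ball, dist_comm] at hy
    linarith [dist_triangle x y 0]
  have h1 := hx' x (Metric.mem_ball_self hδ)
  have h2 := h x 0 fun y hy => by rw [hx' y hy, h1, dist_self]
  rw [h1] at h2
  exact dist_le_zero.1 h2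

theorem IsMeanField.continuousOn_integral (H : IsMeanField K L f) {P : Type*} [TopologicalSpace P]
    {J : Set P} {τ : P → ℝ} (hτ : ContinuousOn τ J) {C R : ℝ}
    (hC : ∀ t ∈ J, ∫ z, |f (τ t) z| ≤ C) {ζ : P → E → ℝ}
    (hζ : ContinuousOn (Function.uncurry ζ) (J ×ˢ Set.univ))
    (hs : ∀ t ∈ J, ∀ z, R < ‖z‖ → ζ t z = 0) :
    ContinuousOn (fun t => ∫ z, ζ t z * f (τ t) z) J := by
  intro t ht
  have hcont : ∀ s ∈ J, Continuous (ζ s) := fun s hs => by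
    rw [← continuousOn_univ]
    exact hζ.comp (f := fun z => (s, z)) (by fun_prop) fun z _ => ⟨hs, trivial⟩
  have hsupp : ∀ s ∈ J, HasCompactSupport (ζ s) := fun s hsJ =>
    HasCompactSupport.intro (isCompact_closedBall (0 : E) R) fun x hx =>
      hs s hsJ x (by simpa using hx)
  have hint : ∀ s ∈ J, ∀ ψ : E → ℝ, Continuous ψ → HasCompactSupport ψ →
      Integrable fun z => ψ z * f (τ s) z := fun s _ ψ h1 h2 => by
    obtain ⟨M, hM⟩ := HasCompactSupport.exists_norm_le h2 h1
    exact h1.integrable_mul_of_bounded hM (H.int (τ s))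
  have hC0 : 0 ≤ C := (integral_nonneg fun _ => abs_nonneg _).trans (hC t ht)
  refine Metric.continuousWithinAt_iff'.2 ?_
  intro ε hε
  set η := ε / (4 * (C + 1)) with hη
  have hη0 : 0 < η := by positivity
  have hηC : η * C ≤ ε / 4 := by
    rw [hη, div_mul_eq_mul_div, div_le_div_iff₀ (by positivity) (by norm_num)]
    nlinarith
  obtain ⟨ψ, hψ, hψζ⟩ := exists_isTest_close (hcont t ht) (hsupp t ht) hη0
  obtain ⟨v, hv, hvζ⟩ := (isCompact_closedBall (0 : E) R).mem_uniformity_of_prod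
    (hζ.mono (Set.prod_mono_right (Set.subset_univ _))) ht (Metric.dist_mem_uniformity hη0)
  have hclose : ∀ s ∈ J, s ∈ v → ∀ z, |ζ s z - ζ t z| ≤ η := fun s hsJ hsv z => by
    by_cases hz : z ∈ Metric.closedBall (0 : E) R
    · have : dist (ζ s z) (ζ t z) < η := hvζ s hsv z hz
      rw [Real.dist_eq] at this
      exact this.le
    · have hz' : R < ‖z‖ := by simpa using hz
      rw [hs s hsJ z hz', hs t ht z hz']; simpa using hη0.le
  have h3 := Metric.continuousWithinAt_iff'.1 ((H.continuous hψ).comp_continuousOn hτ t ht) (ε / 4)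
    (by positivity)
  filter_upwards [hv, self_mem_nhdsWithin, h3] with s hsv hsJ h3
  have e1 : |∫ z, (ζ s z - ζ t z) * f (τ s) z| ≤ η * C :=
    (abs_integral_mul_le (hclose s hsJ hsv) (H.int (τ s))).trans
      (mul_le_mul_of_nonneg_left (hC s hsJ) hη0.le)
  have e2 : |∫ z, (ψ z - ζ t z) * f (τ s) z| ≤ η * C :=
    (abs_integral_mul_le hψζ (H.int (τ s))).trans (mul_le_mul_of_nonneg_left (hC s hsJ) hη0.le)
  have e3 : |∫ z, (ψ z - ζ t z) * f (τ t) z| ≤ η * C :=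
    (abs_integral_mul_le hψζ (H.int (τ t))).trans (mul_le_mul_of_nonneg_left (hC t ht) hη0.le)
  simp only [sub_mul] at e1 e2 e3
  have i1 := hint s hsJ _ (hcont s hsJ) (hsupp s hsJ)
  have i2 := hint s hsJ _ (hcont t ht) (hsupp t ht)
  have i3 := hint s hsJ _ hψ.smooth.continuous hψ.supp
  have i4 := hint t ht _ (hcont t ht) (hsupp t ht)
  have i5 := hint t ht _ hψ.smooth.continuous hψ.supp
  rw [integral_sub i1 i2, abs_le] at e1
  rw [integral_sub i3 i2, abs_le] at e2
  rw [integral_sub i5 i4, abs_le] at e3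
  simp only [Function.comp_apply, Real.dist_eq, abs_lt] at h3 ⊢
  constructor <;> linarith [e1.1, e1.2, e2.1, e2.2, e3.1, e3.2, h3.1, h3.2]

end MeanField

section FiniteDim

variable {F : Type*} [NormedAddCommGroup F] [NormedSpace ℝ F] [FiniteDimensional ℝ F]

theorem continuousOn_of_forall_clm {P : Type*} [TopologicalSpace P] {S : Set P} {g : P → F}
    (h : ∀ l : F →L[ℝ] ℝ, ContinuousOn (fun p => l (g p)) S) : ContinuousOn g S := by
  let e := (Module.finBasis ℝ F).equivFunL
  have : ContinuousOn (fun p => e (g p)) S := continuousOn_pi.2 fun i =>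
    h ((ContinuousLinearMap.proj i).comp e.toContinuousLinearMap)
  simpa [Function.comp_def] using e.symm.continuous.comp_continuousOn this

theorem hasDerivWithinAt_of_forall_clm {S : Set ℝ} {g : ℝ → F} {g' : F} {t : ℝ}
    (h : ∀ l : F →L[ℝ] ℝ, HasDerivWithinAt (fun s => l (g s)) (l g') S t) :
    HasDerivWithinAt g g' S t := by
  let e := (Module.finBasis ℝ F).equivFunL
  have : HasDerivWithinAt (fun s => e (g s)) (e g') S t := hasDerivWithinAt_pi.2 fun i =>
    h ((ContinuousLinearMap.proj i).comp e.toContinuousLinearMap)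
  simpa [Function.comp_def] using e.symm.hasFDerivAt.comp_hasDerivWithinAt t this

end FiniteDim

section Implicit

variable {E : Type*} [NormedAddCommGroup E] [NormedSpace ℝ E] [CompleteSpace E]

theorem isUnit_of_norm_sub_one_le {A : E →L[ℝ] E} (hA : ‖A - 1‖ ≤ 1 / 4) :
    IsUnit A := by
  have h : ‖1 - A‖ < 1 := by rw [norm_sub_rev]; linarith
  simpa using (Units.oneSub (1 - A) h).isUnit

/-- An implicit function theorem assuming only pointwise differentiability in time. -/
theorem exists_implicit {q : E → ℝ → E} {q' : E → ℝ → E} {A : E → ℝ → E →L[ℝ] E} {J : Set ℝ}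
    {r : ℝ} (hr : 0 < r) {q₀ : E}
    (hq : ∀ t ∈ J, ∀ y ∈ Metric.closedBall (0 : E) r, HasFDerivAt (fun y => q y t) (-A y t) y)
    (hA : ContinuousOn (Function.uncurry A) (Metric.closedBall (0 : E) r ×ˢ J))
    (hA1 : ∀ t ∈ J, ∀ y ∈ Metric.closedBall (0 : E) r, ‖A y t - 1‖ ≤ 1 / 4)
    (hq0 : ∀ t ∈ J, ‖q 0 t - q₀‖ ≤ r / 2)
    (hqt : ∀ y ∈ Metric.closedBall (0 : E) r, ∀ t ∈ J, HasDerivWithinAt (q y) (q' y t) J t) :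
    ∃ y : ℝ → E, (∀ t ∈ J, y t ∈ Metric.closedBall (0 : E) r) ∧
      ∀ t ∈ J, HasDerivWithinAt y (Ring.inverse (A (y t) t) (q' (y t) t)) J t := by
  have hconv := convex_closedBall (0 : E) r
  have hlip : ∀ t ∈ J, ∀ y ∈ Metric.closedBall (0 : E) r, ∀ z ∈ Metric.closedBall (0 : E) r,
      ‖(y + q y t) - (z + q z t)‖ ≤ 1 / 4 * ‖y - z‖ := fun t ht y hy z hz =>
    hconv.norm_image_sub_le_of_norm_hasFDerivWithin_le (𝕜 := ℝ) (f := fun y => y + q y t)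
      (f' := fun y => 1 + -A y t)
      (fun x hx => ((hasFDerivAt_id x).add (hq t ht x hx)).hasFDerivWithinAt)
      (fun x hx => by rw [← sub_eq_add_neg, norm_sub_rev]; exact hA1 t ht x hx) hz hy
  have hex : ∀ t, ∃ y, t ∈ J → y ∈ Metric.closedBall (0 : E) r ∧ q y t = q₀ := by
    intro t
    by_cases ht : t ∈ J
    swap; · exact ⟨0, fun h => absurd h ht⟩
    have h0 : (0 : E) ∈ Metric.closedBall (0 : E) r := Metric.mem_closedBall_self hr.le
    let g : E → E := fun y => y + q y t - q₀
    have hg : ∀ y ∈ Metric.closedBall (0 : E) r, ∀ z ∈ Metric.closedBall (0 : E) r,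
        ‖g y - g z‖ ≤ 1 / 4 * ‖y - z‖ := fun y hy z hz => by
      simpa only [g, sub_sub_sub_cancel_right] using hlip t ht y hy z hz
    have hmaps : Set.MapsTo g (Metric.closedBall (0 : E) r) (Metric.closedBall (0 : E) r) := by
      intro y hy
      have h1 := hg y hy 0 h0
      have h2 := hq0 t ht
      rw [mem_closedBall_zero_iff] at hy ⊢
      have h3 : ‖g 0‖ ≤ r / 2 := by simpa [g] using h2
      have h4 := norm_le_norm_add_norm_sub (g 0) (g y)
      rw [norm_sub_rev (g 0) (g y)] at h4
      rw [sub_zero] at h1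
      linarith
    have hK : ContractingWith (1 / 4 : ℝ≥0) (hmaps.restrict g _ _) := by
      refine ⟨by rw [div_lt_one] <;> norm_num, LipschitzWith.of_dist_le_mul fun y z => ?_⟩
      rw [Subtype.dist_eq, Subtype.dist_eq, dist_eq_norm, dist_eq_norm]
      simpa using hg y y.2 z z.2
    obtain ⟨y, hy, hfix, -⟩ := hK.exists_fixedPoint' Metric.isClosed_closedBall.isComplete hmaps h0
      (edist_ne_top _ _)
    refine ⟨y, fun _ => ⟨hy, ?_⟩⟩
    have : y + q y t - q₀ = y := hfix
    rwa [add_sub_assoc, add_eq_left, sub_eq_zero] at this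
  choose y hy using hex
  refine ⟨y, fun t ht => (hy t ht).1, fun t ht => ?_⟩
  have hyt := (hy t ht).1
  have hunit := isUnit_of_norm_sub_one_le (hA1 t ht _ hyt)
  have hd := hqt _ hyt t ht
  have hbd : ∀ s ∈ J, ‖y s - y t‖ ≤ 4 / 3 * ‖q (y t) s - q (y t) t‖ := fun s hs => by
    have h1 := hlip s hs _ (hy s hs).1 _ hyt
    rw [(hy s hs).2] at h1
    rw [(hy t ht).2]
    have h2 : y s - y t = (y s + q₀ - (y t + q (y t) s)) + (q (y t) s - q₀) := by abel
    have h3 := norm_add_le (y s + q₀ - (y t + q (y t) s)) (q (y t) s - q₀)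
    rw [← h2] at h3
    linarith
  have hO : (fun s => y s - y t) =O[𝓝[J] t] fun s => s - t := by
    refine Asymptotics.IsBigO.trans ?_ hd.hasFDerivWithinAt.isBigO_sub
    refine Asymptotics.IsBigO.of_bound (4 / 3) ?_
    filter_upwards [self_mem_nhdsWithin] with s hs using hbd s hs
  have hycont : ContinuousWithinAt y J t := by
    have h1 : Tendsto (fun s => y s - y t) (𝓝[J] t) (𝓝 0) := hO.trans_tendsto <| by
      have : Tendsto (fun s => s - t) (𝓝 t) (𝓝 (t - t)) := (continuous_id.sub continuous_const).tendsto t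
      rw [sub_self] at this
      exact this.mono_left nhdsWithin_le_nhds
    have h2 := h1.add_const (y t)
    simp only [sub_add_cancel, zero_add] at h2
    exact h2
  have ho : (fun s => q (y s) s - q (y t) s + A (y t) t (y s - y t)) =o[𝓝[J] t] fun s => s - t := by
    refine Asymptotics.IsLittleO.trans_isBigO ?_ hO
    rw [Asymptotics.isLittleO_iff]
    intro ε hε
    obtain ⟨δ, hδ, hAδ⟩ := Metric.continuousWithinAt_iff.1 (hA (y t, t) ⟨hyt, ht⟩) ε hε
    have h1 : ∀ᶠ s in 𝓝[J] t, dist (y s) (y t) < δ := Metric.tendsto_nhds.1 hycont δ hδ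
    have h2 : ∀ᶠ s in 𝓝[J] t, dist s t < δ :=
      nhdsWithin_le_nhds (Metric.ball_mem_nhds t hδ)
    filter_upwards [h1, h2, self_mem_nhdsWithin] with s h1 h2 hs
    have hc := hconv.inter (convex_ball (y t) δ)
    have := hc.norm_image_sub_le_of_norm_hasFDerivWithin_le (𝕜 := ℝ)
      (f := fun x => q x s + A (y t) t x) (f' := fun x => -A x s + A (y t) t) (C := ε)
      (fun x hx => ((hq s hs x hx.1).add (A (y t) t).hasFDerivAt).hasFDerivWithinAt)
      (fun x hx => by
        have h3 := (@hAδ (x, s) ⟨hx.1, hs⟩ (max_lt hx.2 h2)).le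
        rw [dist_eq_norm] at h3
        rw [neg_add_eq_sub, norm_sub_rev]
        exact h3) ⟨hyt, Metric.mem_ball_self hδ⟩ ⟨(hy s hs).1, h1⟩
    convert! this using 2
    rw [map_sub]; abel
  have ho2 : (fun s => A (y t) t (y s - y t) - (s - t) • q' (y t) t) =o[𝓝[J] t]
      fun s => s - t := by
    refine (ho.add (hasDerivWithinAt_iff_isLittleO.1 hd)).congr' ?_ EventuallyEq.rfl
    filter_upwards [self_mem_nhdsWithin] with s hs
    rw [(hy s hs).2, (hy t ht).2]; abel
  rw [hasDerivWithinAt_iff_isLittleO]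
  have hinv : Ring.inverse (A (y t) t) * A (y t) t = 1 := Ring.inverse_mul_cancel _ hunit
  refine (((Ring.inverse (A (y t) t)).isBigO_comp _ _).trans_isLittleO ho2).congr_left fun s => ?_
  rw [map_sub, map_smul, ← mul_apply_eq_comp, hinv, one_apply_eq_self]

end Implicit

section RelVel

set_option linter.unusedSectionVars false

variable {E : Type*} [NormedAddCommGroup E] [InnerProductSpace ℝ E] [FiniteDimensional ℝ E]
  [MeasurableSpace E] [BorelSpace E] {F : Type*} [NormedAddCommGroup F] [NormedSpace ℝ F]

theorem MeasureTheory.Integrable.smul_continuous_bounded {μ : Measure E} {g : E → ℝ}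
    (hg : Integrable g μ) {Ψ : E → F} (hΨ : Continuous Ψ) {M : ℝ} (hM : ∀ z, ‖Ψ z‖ ≤ M) :
    Integrable (fun z => g z • Ψ z) μ := by
  borelize F
  refine (hg.norm.mul_const M).mono' (hg.aestronglyMeasurable.smul hΨ.aestronglyMeasurable)
    (ae_of_all _ fun z => ?_)
  rw [norm_smul]
  gcongr
  exact hM z

theorem MeasureTheory.Integrable.smul_compactSupport {μ : Measure E} {g : E → ℝ}
    (hg : Integrable g μ) {Ψ : E → F} (hΨ : Continuous Ψ) (hs : HasCompactSupport Ψ) :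
    Integrable (fun z => g z • Ψ z) μ := by
  obtain ⟨M, hM⟩ := HasCompactSupport.exists_norm_le hs hΨ
  exact hg.smul_continuous_bounded hΨ hM

/-- The mean velocity relative to the mean velocity at the origin. -/
def relVel (K : E × E → E) (g : E → ℝ) (x : E) : E := ∫ z', g z' • (K (x, z') - K (0, z'))

open Classical in
/-- Equal to `1` if the integral defining the mean velocity converges and `0` otherwise. -/
def activity (K : E × E → E) (g : E → ℝ) : ℝ :=
  if Integrable (fun z' => g z' • K (0, z')) then 1 else 0

variable {K : E × E → E} {L : ℝ} {f : ℝ → E → ℝ}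

theorem IsMeanField.continuous_kernel (H : IsMeanField K L f) : Continuous K := H.smooth.continuous

theorem IsMeanField.integrable_relVel (H : IsMeanField K L f) {g : E → ℝ} (hg : Integrable g)
    (x y : E) : Integrable fun z' => g z' • (K (x, z') - K (y, z')) := by
  have := H.continuous_kernel
  exact hg.smul_continuous_bounded (by fun_prop) (H.lip_left x y)

theorem IsMeanField.relVel_lip (H : IsMeanField K L f) {g : E → ℝ} (hg : Integrable g) (x y : E) :
    ‖relVel K g x - relVel K g y‖ ≤ (L * ∫ z, |g z|) * ‖x - y‖ := by
  rw [relVel, relVel, ← integral_sub (H.integrable_relVel hg x 0) (H.integrable_relVel hg y 0)]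
  have h1 : ∀ z, ‖g z • (K (x, z) - K (0, z)) - g z • (K (y, z) - K (0, z))‖ ≤
      |g z| * (L * ‖x - y‖) := fun z => by
    rw [← smul_sub, sub_sub_sub_cancel_right, norm_smul, Real.norm_eq_abs]
    exact mul_le_mul_of_nonneg_left (H.lip_left x y z) (abs_nonneg _)
  refine (norm_integral_le_of_norm_le (hg.abs.mul_const _) (ae_of_all _ h1)).trans_eq ?_
  rw [integral_mul_const]; ring

theorem relVel_congr {g g' : E → ℝ} (h : g =ᵐ[volume] g') : relVel K g = relVel K g' := by
  ext1 x
  exact integral_congr_ae (by filter_upwards [h] with z hz; rw [hz])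

theorem activity_congr {g g' : E → ℝ} (h : g =ᵐ[volume] g') : activity K g = activity K g' := by
  unfold activity
  have : Integrable (fun z' => g z' • K (0, z')) ↔ Integrable fun z' => g' z' • K (0, z') :=
    integrable_congr (by filter_upwards [h] with z hz; rw [hz])
  by_cases h1 : Integrable fun z' => g z' • K (0, z')
  · rw [if_pos h1, if_pos (this.1 h1)]
  · rw [if_neg h1, if_neg (mt this.2 h1)]

theorem activity_eq (K : E × E → E) (g : E → ℝ) : activity K g = 0 ∨ activity K g = 1 := by
  unfold activity; split_ifs <;> simp

theorem IsMeanField.meanVel_eq (H : IsMeanField K L f) {g : E → ℝ} (hg : Integrable g) (x : E) :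
    meanVel K g x = activity K g • relVel K g x + meanVel K g 0 := by
  have h1 := H.integrable_relVel hg x 0
  by_cases h : Integrable (fun z' => g z' • K (0, z'))
  · rw [activity, if_pos h, one_smul, relVel, meanVel, meanVel, ← integral_add h1 h]
    congr 1; ext1 z; rw [← smul_add, sub_add_cancel]
  · have h2 : ¬ Integrable fun z' => g z' • K (x, z') := fun h3 => h <| by
      refine (h3.sub h1).congr (ae_of_all _ fun z => ?_)
      simp only [Pi.sub_apply]
      rw [← smul_sub, sub_sub_cancel]
    rw [activity, if_neg h, zero_smul, meanVel, meanVel, integral_undef h, integral_undef h2,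
      zero_add]

theorem meanVel_eq_zero {g : E → ℝ} (h : activity K g = 0) : meanVel K g 0 = 0 := by
  rw [meanVel, integral_undef]
  intro h2
  rw [activity, if_pos h2] at h
  exact one_ne_zero h

theorem IsMeanField.continuous_relVel (H : IsMeanField K L f) {g : E → ℝ} (hg : Integrable g) :
    Continuous (relVel K g) := continuous_of_norm_sub_le (H.relVel_lip hg)

theorem IsMeanField.continuous_meanVel (H : IsMeanField K L f) {g : E → ℝ} (hg : Integrable g) :
    Continuous (meanVel K g) := by
  rw [funext (H.meanVel_eq hg)]
  exact ((H.continuous_relVel hg).const_smul _).add continuous_const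

theorem IsMeanField.continuous_relVel_time (H : IsMeanField K L f) (x : E) :
    Continuous fun t => relVel K (f t) x := by
  rw [← continuousOn_univ]
  refine continuousOn_of_forall_clm fun l => ?_
  have hK := H.smooth
  let φ : E → ℝ := fun z => l (K (x, z) - K (0, z))
  have hφ : ContDiff ℝ 1 φ := by
    have h1 : ContDiff ℝ 1 fun z : E => K (x, z) := hK.comp (contDiff_const.prodMk contDiff_id)
    have h2 : ContDiff ℝ 1 fun z : E => K (0, z) := hK.comp (contDiff_const.prodMk contDiff_id)
    exact l.contDiff.comp (h1.sub h2)
  have hL := H.nonneg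
  have hlip : ∀ z z', ‖φ z - φ z'‖ ≤ ‖l‖ * (2 * L) * ‖z - z'‖ := fun z z' => by
    have h1 := H.lip_right z z' x
    have h2 := H.lip_right z z' 0
    have h3 : φ z - φ z' = l ((K (x, z) - K (x, z')) - (K (0, z) - K (0, z'))) := by
      simp only [φ, map_sub]; ring
    rw [h3, mul_assoc]
    refine (l.le_opNorm _).trans (mul_le_mul_of_nonneg_left ?_ (norm_nonneg _))
    refine (norm_sub_le _ _).trans ?_
    linarith
  have hb : ∀ z, |φ z| ≤ ‖l‖ * (L * ‖x‖) := fun z => by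
    refine (l.le_opNorm _).trans (mul_le_mul_of_nonneg_left ?_ (norm_nonneg _))
    simpa using H.lip_left x 0 z
  have h := fun t => (H.weak φ hφ ⟨_, hb⟩
    ⟨_, norm_fderiv_le_of_norm_sub_le (by positivity) hlip⟩ t).continuousAt
  have h2 : Continuous fun s => ∫ z, φ z * f s z := continuous_iff_continuousAt.2 h
  refine (h2.congr fun s => ?_).continuousOn
  rw [relVel, ← l.integral_comp_comm (H.integrable_relVel (H.int s) x 0)]
  congr 1; ext1 z; rw [map_smul, smul_eq_mul, mul_comm]

end RelVel

section VectorTest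

set_option linter.unusedSectionVars false

variable {E : Type*} [NormedAddCommGroup E] [InnerProductSpace ℝ E] [FiniteDimensional ℝ E]
  [MeasurableSpace E] [BorelSpace E] {F : Type*} [NormedAddCommGroup F] [NormedSpace ℝ F]
  [FiniteDimensional ℝ F] {K : E × E → E} {L : ℝ} {f : ℝ → E → ℝ}

theorem HasCompactSupport.fderiv_apply_field {Ψ : E → F} (hs : HasCompactSupport Ψ) (V : E → E) :
    HasCompactSupport fun z => fderiv ℝ Ψ z (V z) := by
  refine (hs.fderiv ℝ).mono' fun z hz => ?_
  refine subset_tsupport _ fun h => hz ?_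
  simp [h]

theorem IsMeanField.hasDerivAt_vector (H : IsMeanField K L f) {Ψ : E → F} (hΨ : ContDiff ℝ ∞ Ψ)
    (hs : HasCompactSupport Ψ) (t : ℝ) :
    HasDerivAt (fun s => ∫ z, f s z • Ψ z) (∫ z, f t z • fderiv ℝ Ψ z (meanVel K (f t) z)) t := by
  have := FiniteDimensional.complete ℝ F
  rw [← hasDerivWithinAt_univ]
  refine hasDerivWithinAt_of_forall_clm fun l => ?_
  rw [hasDerivWithinAt_univ]
  have hV := H.continuous_meanVel (H.int t)
  have hD : Continuous (fderiv ℝ Ψ) := hΨ.continuous_fderiv (by simp)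
  have h := H.hasDerivAt (φ := fun z => l (Ψ z)) ⟨l.contDiff.comp hΨ, hs.comp_left (map_zero l)⟩ t
  have h1 : ∀ s, ∫ z, l (Ψ z) * f s z = l (∫ z, f s z • Ψ z) := fun s => by
    rw [← l.integral_comp_comm ((H.int s).smul_compactSupport hΨ.continuous hs)]
    congr 1; ext1 z; rw [map_smul, smul_eq_mul, mul_comm]
  simp only [h1] at h
  convert! h using 1
  rw [← l.integral_comp_comm ((H.int t).smul_compactSupport (by fun_prop)
    (hs.fderiv_apply_field _))]
  congr 1; ext1 z
  have h2 : fderiv ℝ (fun z => l (Ψ z)) z = l.comp (fderiv ℝ Ψ z) :=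
    (l.hasFDerivAt.comp z (hΨ.differentiable (by simp) z).hasFDerivAt).fderiv
  rw [h2, map_smul, smul_eq_mul, mul_comm]; rfl

theorem IsMeanField.continuousOn_integral_vector (H : IsMeanField K L f) {P : Type*}
    [TopologicalSpace P] {J : Set P} {τ : P → ℝ} (hτ : ContinuousOn τ J) {C R : ℝ}
    (hC : ∀ p ∈ J, ∫ z, |f (τ p) z| ≤ C) {ζ : P → E → F}
    (hζ : ContinuousOn (Function.uncurry ζ) (J ×ˢ Set.univ))
    (hs : ∀ p ∈ J, ∀ z, R < ‖z‖ → ζ p z = 0) :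
    ContinuousOn (fun p => ∫ z, f (τ p) z • ζ p z) J := by
  have := FiniteDimensional.complete ℝ F
  refine continuousOn_of_forall_clm fun l => ?_
  refine (H.continuousOn_integral hτ hC (ζ := fun p z => l (ζ p z)) (R := R)
    (l.continuous.comp_continuousOn hζ) fun p hp z hz => by rw [hs p hp z hz, map_zero]).congr
    fun p hp => ?_
  have hc : Continuous (ζ p) := by
    rw [← continuousOn_univ]
    exact hζ.comp (f := fun z => (p, z)) (by fun_prop) fun z _ => ⟨hp, trivial⟩
  have hsupp : HasCompactSupport (ζ p) :=
    HasCompactSupport.intro (isCompact_closedBall (0 : E) R) fun x hx =>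
      hs p hp x (by simpa using hx)
  rw [← l.integral_comp_comm ((H.int _).smul_compactSupport hc hsupp)]
  congr 1; ext1 z; rw [map_smul, smul_eq_mul, mul_comm]

theorem hasFDerivAt_integral_translate {g : E → ℝ} (hg : Integrable g) {Ψ : E → F}
    (hΨ : ContDiff ℝ ∞ Ψ) (hs : HasCompactSupport Ψ) (y : E) :
    HasFDerivAt (fun y => ∫ z, g z • Ψ (z - y)) (-∫ z, g z • fderiv ℝ Ψ (z - y)) y := by
  have hD : Continuous (fderiv ℝ Ψ) := hΨ.continuous_fderiv (by simp)
  obtain ⟨M, hM⟩ := HasCompactSupport.exists_norm_le hs hΨ.continuous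
  obtain ⟨G, hG⟩ := HasCompactSupport.exists_norm_le (hs.fderiv ℝ) hD
  have h := hasFDerivAt_integral_of_dominated_of_fderiv_le (𝕜 := ℝ) (μ := volume)
    (F := fun y z => g z • Ψ (z - y)) (F' := fun y z => g z • -fderiv ℝ Ψ (z - y)) (x₀ := y)
    (bound := fun z => ‖g z‖ * G) (s := Set.univ) Filter.univ_mem
    (.of_forall fun y => (hg.smul_continuous_bounded (Ψ := fun z => Ψ (z - y))
      (hΨ.continuous.comp (by fun_prop)) fun z => hM _).aestronglyMeasurable)
    (hg.smul_continuous_bounded (Ψ := fun z => Ψ (z - y))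
      (hΨ.continuous.comp (by fun_prop)) fun z => hM _)
    (hg.smul_continuous_bounded (Ψ := fun z => -fderiv ℝ Ψ (z - y)) (by fun_prop)
      (M := G) fun z => by rw [norm_neg]; exact hG _).aestronglyMeasurable
    (ae_of_all _ fun z y _ => by
      rw [norm_smul, norm_neg]; gcongr; exact hG _)
    (hg.norm.mul_const G)
    (ae_of_all _ fun z y _ => by
      refine HasFDerivAt.const_smul ?_ _
      have h1 : HasFDerivAt (fun y => z - y) (-ContinuousLinearMap.id ℝ E) y :=
        (hasFDerivAt_id y).const_sub z
      have h2 := ((hΨ.differentiable (by simp)) (z - y)).hasFDerivAt.comp y h1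
      convert! h2 using 1
      ext v; simp)
  simpa only [smul_neg, integral_neg] using h

/-- Smooth compactly supported maps whose mean derivative is close to the identity. -/
theorem exists_smooth_fderiv_close_one {g : E → ℝ} (hg : Integrable g) (h1 : ∫ z, g z = 1) :
    ∃ Φ : E → E, ContDiff ℝ ∞ Φ ∧ HasCompactSupport Φ ∧
      ‖(∫ z, g z • fderiv ℝ Φ z) - (1 : E →L[ℝ] E)‖ ≤ 1 / 8 := by
  let χ : ContDiffBump (0 : E) := ⟨1, 2, one_pos, one_lt_two⟩
  let Φ : E → E := fun z => χ z • z
  have hΦ : ContDiff ℝ ∞ Φ := χ.contDiff.smul contDiff_id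
  have hΦs : HasCompactSupport Φ := χ.hasCompactSupport.smul_right
  have hD : Continuous (fderiv ℝ Φ) := hΦ.continuous_fderiv (by simp)
  have hD0 : fderiv ℝ Φ 0 = 1 := by
    have : Φ =ᶠ[𝓝 0] id := by
      filter_upwards [χ.eventuallyEq_one] with z hz
      simp only [Φ, hz, Pi.one_apply, one_smul, id]
    rw [this.fderiv_eq, fderiv_id]; rfl
  obtain ⟨G, hG⟩ := HasCompactSupport.exists_norm_le (hΦs.fderiv ℝ) hD
  have hlim : Tendsto (fun n : ℕ => ∫ z, g z • fderiv ℝ Φ ((n + 1 : ℝ)⁻¹ • z)) atTop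
      (𝓝 (∫ z, g z • (1 : E →L[ℝ] E))) := by
    refine tendsto_integral_of_dominated_convergence (fun z => ‖g z‖ * G) (fun n => ?_)
      (hg.norm.mul_const G) (fun n => ae_of_all _ fun z => ?_) (ae_of_all _ fun z => ?_)
    · exact (hg.smul_continuous_bounded (Ψ := fun z => fderiv ℝ Φ ((n + 1 : ℝ)⁻¹ • z))
        (by fun_prop) fun z => hG _).aestronglyMeasurable
    · rw [norm_smul]; gcongr; exact hG _
    · refine Tendsto.const_smul ?_ _
      rw [← hD0]
      refine (hD.tendsto 0).comp ?_
      have : Tendsto (fun n : ℕ => ((n : ℝ) + 1)⁻¹ • z) atTop (𝓝 ((0 : ℝ) • z)) := by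
        refine Tendsto.smul_const ?_ z
        simpa only [one_div] using tendsto_one_div_add_atTop_nhds_zero_nat (𝕜 := ℝ)
      rwa [zero_smul] at this
  rw [integral_smul_const, h1, one_smul] at hlim
  obtain ⟨n, hn⟩ := ((Metric.tendsto_nhds.1 hlim) (1 / 8) (by norm_num)).exists
  rw [dist_eq_norm] at hn
  have hn0 : (n + 1 : ℝ) ≠ 0 := by positivity
  refine ⟨fun z => (n + 1 : ℝ) • Φ ((n + 1 : ℝ)⁻¹ • z), ?_, ?_, ?_⟩
  · exact (hΦ.comp (contDiff_id.const_smul _)).const_smul _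
  · have : HasCompactSupport fun z => Φ ((n + 1 : ℝ)⁻¹ • z) :=
      hΦs.comp_homeomorph (Homeomorph.smulOfNeZero _ (inv_ne_zero hn0))
    exact this.smul_left (f := fun _ => (n + 1 : ℝ))
  · have h4 : ∀ z : E, fderiv ℝ (fun z => (n + 1 : ℝ) • Φ ((n + 1 : ℝ)⁻¹ • z)) z =
        fderiv ℝ Φ ((n + 1 : ℝ)⁻¹ • z) := fun z => by
      have h2 : HasFDerivAt (fun z : E => (n + 1 : ℝ)⁻¹ • z)
          ((n + 1 : ℝ)⁻¹ • ContinuousLinearMap.id ℝ E) z := (hasFDerivAt_id z).const_smul _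
      have h3 := (((hΦ.differentiable (by simp)) ((n + 1 : ℝ)⁻¹ • z)).hasFDerivAt.comp z
        h2).const_smul (n + 1 : ℝ)
      refine h3.fderiv.trans ?_
      ext v
      simp [smul_smul, hn0]
    simp only [h4]
    exact hn.le

end VectorTest

section Moving

variable {E F : Type*} [NormedAddCommGroup E] [NormedSpace ℝ E] [NormedAddCommGroup F]
  [NormedSpace ℝ F]

theorem hasDerivWithinAt_comp_partial {q : E → ℝ → F} {A : E → ℝ → E →L[ℝ] F} {J : Set ℝ}
    {r t : ℝ} {y : ℝ → E} {y' : E} {q' : F}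
    (hq : ∀ s ∈ J, ∀ y ∈ Metric.closedBall (0 : E) r, HasFDerivAt (fun y => q y s) (-A y s) y)
    (hA : ContinuousOn (Function.uncurry A) (Metric.closedBall (0 : E) r ×ˢ J)) (ht : t ∈ J)
    (hyr : ∀ s ∈ J, y s ∈ Metric.closedBall (0 : E) r) (hy : HasDerivWithinAt y y' J t)
    (hqt : HasDerivWithinAt (q (y t)) q' J t) :
    HasDerivWithinAt (fun s => q (y s) s) (q' - A (y t) t y') J t := by
  have hO : (fun s => y s - y t) =O[𝓝[J] t] fun s => s - t := hy.hasFDerivWithinAt.isBigO_sub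
  have hyt := hyr t ht
  have ho : (fun s => q (y s) s - q (y t) s + A (y t) t (y s - y t)) =o[𝓝[J] t] fun s => s - t := by
    refine Asymptotics.IsLittleO.trans_isBigO ?_ hO
    rw [Asymptotics.isLittleO_iff]
    intro ε hε
    obtain ⟨δ, hδ, hAδ⟩ := Metric.continuousWithinAt_iff.1 (hA (y t, t) ⟨hyt, ht⟩) ε hε
    have h1 : ∀ᶠ s in 𝓝[J] t, dist (y s) (y t) < δ :=
      Metric.tendsto_nhds.1 hy.continuousWithinAt δ hδ
    have h2 : ∀ᶠ s in 𝓝[J] t, dist s t < δ :=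
      nhdsWithin_le_nhds (Metric.ball_mem_nhds t hδ)
    filter_upwards [h1, h2, self_mem_nhdsWithin] with s h1 h2 hs
    have hc := (convex_closedBall (0 : E) r).inter (convex_ball (y t) δ)
    have := hc.norm_image_sub_le_of_norm_hasFDerivWithin_le (𝕜 := ℝ)
      (f := fun x => q x s + A (y t) t x) (f' := fun x => -A x s + A (y t) t) (C := ε)
      (fun x hx => ((hq s hs x hx.1).add (A (y t) t).hasFDerivAt).hasFDerivWithinAt)
      (fun x hx => by
        have h3 := (@hAδ (x, s) ⟨hx.1, hs⟩ (max_lt hx.2 h2)).le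
        rw [dist_eq_norm] at h3
        rw [neg_add_eq_sub, norm_sub_rev]
        exact h3) ⟨hyt, Metric.mem_ball_self hδ⟩ ⟨hyr s hs, h1⟩
    convert! this using 2
    rw [map_sub]; abel
  have h3 := ((A (y t) t).hasFDerivAt.comp_hasDerivWithinAt t hy)
  rw [hasDerivWithinAt_iff_isLittleO] at h3 hqt ⊢
  refine ((ho.add hqt).sub h3).congr_left fun s => ?_
  simp only [Function.comp_apply, map_sub, smul_sub]
  abel

end Moving

section Frame

set_option linter.unusedSectionVars false

variable {E : Type*} [NormedAddCommGroup E] [InnerProductSpace ℝ E] [FiniteDimensional ℝ E]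
  [MeasurableSpace E] [BorelSpace E] {F : Type*} [NormedAddCommGroup F] [NormedSpace ℝ F]
  [FiniteDimensional ℝ F] {K : E × E → E} {L : ℝ} {f : ℝ → E → ℝ} {a b C : ℝ}

theorem IsLipField.continuousOn_uncurry {W : ℝ → E → E} {s T Λ : ℝ} (H : IsLipField W s T Λ) :
    ContinuousOn (Function.uncurry W) (Set.Icc s T ×ˢ Set.univ) :=
  continuousOn_prod_of_continuousOn_lipschitzOnWith' _ (Real.toNNReal Λ)
    (fun _ hτ => (H.lipschitzWith hτ).lipschitzOnWith) fun x _ => H.cont x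

theorem IsMeanField.isLipField_relVel (H : IsMeanField K L f) (hC0 : 0 ≤ C)
    (hC : ∀ t ∈ Set.Icc a b, ∫ z, |f t z| ≤ C) :
    IsLipField (fun t => relVel K (f t)) a b (L * C) where
  nonneg := mul_nonneg H.nonneg hC0
  lip τ hτ x y := (H.relVel_lip (H.int τ) x y).trans <| by
    have := H.nonneg
    have := hC τ hτ
    gcongr
  cont x := (H.continuous_relVel_time x).continuousOn

theorem IsMeanField.integral_eq (H : IsMeanField K L f) (s t : ℝ) : ∫ z, f s z = ∫ z, f t z := by
  have h : ∀ t, HasDerivAt (fun s => ∫ z, f s z) 0 t := fun t => by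
    simpa using H.weak (fun _ => 1) contDiff_const ⟨1, fun _ => by simp⟩ ⟨0, fun _ => by simp⟩ t
  exact is_const_of_deriv_eq_zero (fun t => (h t).differentiableAt) (fun t => (h t).deriv) s t

theorem IsMeanField.continuousOn_integral_translate (H : IsMeanField K L f) {J : Set ℝ}
    (hC : ∀ t ∈ J, ∫ z, |f t z| ≤ C) {Ψ : E → F} (hΨ : ContDiff ℝ ∞ Ψ)
    (hs : HasCompactSupport Ψ) (r : ℝ) :
    ContinuousOn (Function.uncurry fun y t => ∫ z, f t z • Ψ (z - y))
      (Metric.closedBall (0 : E) r ×ˢ J) := by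
  obtain ⟨R, hR⟩ := hs.isCompact.isBounded.exists_norm_le
  refine H.continuousOn_integral_vector (P := E × ℝ) (τ := Prod.snd) continuous_snd.continuousOn
    (C := C) (R := R + r) (fun p hp => hC _ hp.2) (ζ := fun p z => Ψ (z - p.1)) ?_ ?_
  · have := hΨ.continuous
    exact Continuous.continuousOn (by simp only [Function.uncurry_def]; fun_prop)
  · rintro ⟨y, t⟩ ⟨hy, -⟩ z hz
    refine image_eq_zero_of_notMem_tsupport fun h => ?_
    have h1 := hR _ h
    have h2 := norm_sub_norm_le z y
    simp only [mem_closedBall_zero_iff] at hy h1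
    linarith

theorem fderiv_comp_sub_const (Ψ : E → F) (y z : E) :
    fderiv ℝ (fun z => Ψ (z - y)) z = fderiv ℝ Ψ (z - y) := by
  simpa only [sub_eq_add_neg] using fderiv_comp_add_right (𝕜 := ℝ) (f := Ψ) (x := z) (-y)

theorem HasCompactSupport.comp_sub_const {Ψ : E → F} (hs : HasCompactSupport Ψ) (y : E) :
    HasCompactSupport fun z => Ψ (z - y) :=
  hs.comp_homeomorph (Homeomorph.subRight y)

theorem IsMeanField.hasDerivAt_translate (H : IsMeanField K L f) {Ψ : E → F} (hΨ : ContDiff ℝ ∞ Ψ)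
    (hs : HasCompactSupport Ψ) (y : E) (t : ℝ) :
    HasDerivAt (fun s => ∫ z, f s z • Ψ (z - y))
      (∫ z, f t z • fderiv ℝ Ψ (z - y) (meanVel K (f t) z)) t := by
  simpa only [fderiv_comp_sub_const] using
    H.hasDerivAt_vector (Ψ := fun z => Ψ (z - y)) (hΨ.comp (contDiff_id.sub contDiff_const))
      (hs.comp_sub_const y) t

theorem IsMeanField.integrable_translate_apply (H : IsMeanField K L f) {Ψ : E → F}
    (hΨ : ContDiff ℝ ∞ Ψ) (hs : HasCompactSupport Ψ) (y : E) (t : ℝ) {V : E → E}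
    (hV : Continuous V) : Integrable fun z => f t z • fderiv ℝ Ψ (z - y) (V z) := by
  have hD : Continuous (fderiv ℝ Ψ) := hΨ.continuous_fderiv (by simp)
  refine (H.int t).smul_compactSupport (by fun_prop) ?_
  simpa only [fderiv_comp_sub_const] using (hs.comp_sub_const y).fderiv_apply_field V

theorem integral_translate_apply_const {g : E → ℝ} (hg : Integrable g) {Ψ : E → F}
    (hΨ : ContDiff ℝ ∞ Ψ) (hs : HasCompactSupport Ψ) (y v : E) :
    ∫ z, g z • fderiv ℝ Ψ (z - y) v = (∫ z, g z • fderiv ℝ Ψ (z - y)) v := by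
  have hD : Continuous (fderiv ℝ Ψ) := hΨ.continuous_fderiv (by simp)
  rw [ContinuousLinearMap.integral_apply]
  · rfl
  · exact hg.smul_compactSupport (Ψ := fun z => fderiv ℝ Ψ (z - y)) (by fun_prop)
      ((hs.fderiv ℝ).comp_sub_const y)

theorem IsMeanField.integral_translate_meanVel (H : IsMeanField K L f) {Ψ : E → F}
    (hΨ : ContDiff ℝ ∞ Ψ) (hs : HasCompactSupport Ψ) (y : E) (t : ℝ) :
    ∫ z, f t z • fderiv ℝ Ψ (z - y) (meanVel K (f t) z) =
      activity K (f t) • (∫ z, f t z • fderiv ℝ Ψ (z - y) (relVel K (f t) z)) +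
        (∫ z, f t z • fderiv ℝ Ψ (z - y)) (meanVel K (f t) 0) := by
  rw [← integral_translate_apply_const (H.int t) hΨ hs, ← integral_smul, ← integral_add]
  · congr 1; ext1 z
    rw [H.meanVel_eq (H.int t), map_add, map_smul, smul_add, smul_comm]
  · exact (H.integrable_translate_apply hΨ hs y t (H.continuous_relVel (H.int t))).smul _
  · exact H.integrable_translate_apply hΨ hs y t continuous_const

/-- The velocity of a moving frame which follows a localized center of mass. -/
def frameVel (K : E × E → E) (Φ : E → E) (g : E → ℝ) (y : E) : E :=
  Ring.inverse (∫ z, g z • fderiv ℝ Φ (z - y)) (∫ z, g z • fderiv ℝ Φ (z - y) (relVel K g z))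

/-- A moving frame `y` compensating the common part of the mean velocity. -/
structure IsFrame (K : E × E → E) (f : ℝ → E → ℝ) (y c : ℝ → E) (J : Set ℝ) (r : ℝ) : Prop where
  bound : ∀ t ∈ J, ‖y t‖ ≤ r
  deriv : ∀ t ∈ J, HasDerivWithinAt y (activity K (f t) • c t + meanVel K (f t) 0) J t
  cont : ContinuousOn c J
  congr : ∀ s ∈ J, ∀ t ∈ J, f s =ᵐ[volume] f t → y s = y t → c s = c t

theorem IsMeanField.exists_frame (H : IsMeanField K L f) (hC : ∀ t ∈ Set.Icc a b, ∫ z, |f t z| ≤ C)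
    (h1 : ∀ t, ∫ z, f t z = 1) {t₀ : ℝ} (ht₀ : t₀ ∈ Set.Icc a b) :
    ∃ δ > 0, ∃ y c, ∃ r, IsFrame K f y c (Set.Icc (max a (t₀ - δ)) (min b (t₀ + δ))) r := by
  obtain ⟨Φ, hΦ, hs, hΦ1⟩ := exists_smooth_fderiv_close_one (H.int t₀) (h1 t₀)
  have hD : ContDiff ℝ ∞ (fderiv ℝ Φ) := hΦ.fderiv_right (by simp)
  have hsD := hs.fderiv ℝ
  have hA := H.continuousOn_integral_translate hC hD hsD 1
  set A : E → ℝ → E →L[ℝ] E := fun y t => ∫ z, f t z • fderiv ℝ Φ (z - y) with hAdef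
  have hcw := hA (0, t₀) ⟨Metric.mem_closedBall_self zero_le_one, ht₀⟩
  obtain ⟨δ₁, hδ₁, hA1⟩ := Metric.continuousWithinAt_iff.1 hcw (1 / 8) (by norm_num)
  obtain ⟨r, hr, hr1, hrδ⟩ : ∃ r > 0, r ≤ 1 ∧ r < δ₁ :=
    ⟨min 1 (δ₁ / 2), by positivity, min_le_left _ _, (min_le_right _ _).trans_lt (by linarith)⟩
  have hq := H.hasDerivAt_translate hΦ hs
  set q : E → ℝ → E := fun y t => ∫ z, f t z • Φ (z - y) with hqdef
  obtain ⟨δ₂, hδ₂, hq1⟩ := Metric.continuousAt_iff.1 (hq 0 t₀).continuousAt (r / 2) (by positivity)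
  obtain ⟨δ, hδ, hδδ₁, hδδ₂⟩ : ∃ δ > 0, δ < δ₁ ∧ δ < δ₂ :=
    ⟨min (δ₁ / 2) (δ₂ / 2), by positivity, (min_le_left _ _).trans_lt (by linarith),
      (min_le_right _ _).trans_lt (by linarith)⟩
  set J := Set.Icc (max a (t₀ - δ)) (min b (t₀ + δ)) with hJ
  have hJI : J ⊆ Set.Icc a b := Set.Icc_subset_Icc (le_max_left _ _) (min_le_left _ _)
  have hJδ : ∀ t ∈ J, |t - t₀| ≤ δ := fun t ht => by
    have h1 := (le_max_right _ _).trans ht.1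
    have h2 := ht.2.trans (min_le_right _ _)
    rw [abs_le]; constructor <;> linarith
  have hball := Metric.closedBall_subset_closedBall (x := (0 : E)) hr1
  have hA14 : ∀ t ∈ J, ∀ y ∈ Metric.closedBall (0 : E) r, ‖A y t - 1‖ ≤ 1 / 4 := fun t ht y hy => by
    have h2 := @hA1 (y, t) ⟨hball hy, hJI ht⟩
      (max_lt (hy.trans_lt hrδ) ((hJδ t ht).trans_lt hδδ₁))
    rw [dist_eq_norm] at h2
    have h3 : ‖A 0 t₀ - 1‖ ≤ 1 / 8 := by simpa [hAdef] using hΦ1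
    have h4 : A y t - 1 = (A y t - A 0 t₀) + (A 0 t₀ - 1) := by abel
    rw [h4]
    refine (norm_add_le _ _).trans ?_
    have h2' : ‖A y t - A 0 t₀‖ < 1 / 8 := h2
    linarith
  have hAJ : ContinuousOn (Function.uncurry A) (Metric.closedBall (0 : E) r ×ˢ J) :=
    hA.mono (Set.prod_mono hball hJI)
  obtain ⟨y, hyr, hy⟩ := exists_implicit hr (q := q) (A := A) (J := J) (q₀ := q 0 t₀)
    (fun t _ y _ => hasFDerivAt_integral_translate (H.int t) hΦ hs y) hAJ hA14
    (fun t ht => by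
      have := (@hq1 t ((hJδ t ht).trans_lt hδδ₂)).le
      rwa [dist_eq_norm] at this)
    (fun y _ t _ => (hq y t).hasDerivWithinAt)
  have hunit : ∀ t ∈ J, IsUnit (A (y t) t) := fun t ht =>
    isUnit_of_norm_sub_one_le (hA14 t ht _ (hyr t ht))
  have hyc : ContinuousOn y J := fun t ht => (hy t ht).continuousWithinAt
  refine ⟨δ, hδ, y, fun t => frameVel K Φ (f t) (y t), r,
    fun t ht => mem_closedBall_zero_iff.1 (hyr t ht), fun t ht => ?_, ?_, ?_⟩
  · refine (hy t ht).congr_deriv ?_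
    rw [H.integral_translate_meanVel hΦ hs, map_add, map_smul, frameVel]
    congr 1
    have hinv : Ring.inverse (A (y t) t) * A (y t) t = 1 := Ring.inverse_mul_cancel _ (hunit t ht)
    rw [← mul_apply_eq_comp, hinv, one_apply_eq_self]
  · have hAc : ContinuousOn (fun t => A (y t) t) J :=
      hAJ.comp (f := fun t => (y t, t)) (hyc.prodMk continuousOn_id) fun t ht => ⟨hyr t ht, ht⟩
    have hinv : ContinuousOn (fun t => Ring.inverse (A (y t) t)) J := fun t ht => by
      obtain ⟨u, hu⟩ := hunit t ht
      have : ContinuousAt Ring.inverse (A (y t) t) := hu ▸ NormedRing.inverse_continuousAt u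
      exact this.comp_continuousWithinAt (f := fun t => A (y t) t) (hAc t ht)
    refine hinv.clm_apply ?_
    obtain ⟨R, hR⟩ := hsD.isCompact.isBounded.exists_norm_le
    refine H.continuousOn_integral_vector (P := ℝ) (τ := id) continuousOn_id
      (C := C) (R := R + r) (fun t ht => hC t (hJI ht))
      (ζ := fun t z => fderiv ℝ Φ (z - y t) (relVel K (f t) z)) ?_ ?_
    · have hC0 : 0 ≤ C := (integral_nonneg fun z => abs_nonneg _).trans (hC t₀ ht₀)
      have h2 := (H.isLipField_relVel hC0 hC).continuousOn_uncurry.mono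
        (Set.prod_mono hJI subset_rfl)
      refine ContinuousOn.clm_apply ?_ h2
      refine hD.continuous.comp_continuousOn ?_
      exact continuousOn_snd.sub (hyc.comp continuousOn_fst fun p hp => hp.1)
    · intro t ht z hz
      rw [image_eq_zero_of_notMem_tsupport (f := fderiv ℝ Φ), zero_apply]
      intro h
      have h1 := hR _ h
      have h2 := norm_sub_norm_le z (y t)
      have h3 := mem_closedBall_zero_iff.1 (hyr t ht)
      linarith
  · intro s _ t _ hst hy
    simp only [frameVel, hy, relVel_congr hst]
    congr 1
    · congr 1
      exact integral_congr_ae (by filter_upwards [hst] with z hz; rw [hz])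
    · exact integral_congr_ae (by filter_upwards [hst] with z hz; rw [hz])

end Frame

theorem eventually_eq_zero_of_hasDerivWithinAt {J : Set ℝ} (hJ : Convex ℝ J) {G θ h : ℝ → ℝ}
    (hG : ∀ t ∈ J, HasDerivWithinAt G (θ t * h t) J t) (hθ : ∀ t, θ t = 0 ∨ θ t = 1) {s : ℝ}
    (hs : s ∈ J) (hc : ContinuousWithinAt h J s) (h0 : h s ≠ 0) (hθs : θ s = 0) :
    ∀ᶠ t in 𝓝[J] s, θ t = 0 := by
  obtain ⟨δ, hδ, hhδ⟩ := Metric.continuousWithinAt_iff.1 hc (|h s| / 2) (by positivity)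
  have hball : Metric.ball s δ ∈ 𝓝[J] s := nhdsWithin_le_nhds (Metric.ball_mem_nhds s hδ)
  filter_upwards [hball, self_mem_nhdsWithin] with t ht htJ
  by_contra hne
  have hθt : θ t = 1 := (hθ t).resolve_left hne
  have hI : (J ∩ Metric.ball s δ).OrdConnected := (hJ.inter (convex_ball s δ)).ordConnected
  have himg := hI.image_hasDerivWithinAt (f := G) (f' := fun t => θ t * h t)
    fun x hx => (hG x hx.1).mono Set.inter_subset_left
  have hclose : ∀ x ∈ J ∩ Metric.ball s δ, |h x - h s| < |h s| / 2 := fun x hx => hhδ hx.1 hx.2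
  have hm : h s / 4 ∈ Set.uIcc (θ s * h s) (θ t * h t) := by
    have h1 := hclose t ⟨htJ, ht⟩
    rw [hθs, hθt, zero_mul, one_mul, Set.mem_uIcc]
    rcases h0.lt_or_gt with h2 | h2
    · rw [abs_of_neg h2, abs_lt] at h1
      right; constructor <;> linarith
    · rw [abs_of_pos h2, abs_lt] at h1
      left; constructor <;> linarith
  obtain ⟨x, hx, hxm⟩ := himg.uIcc_subset
    (Set.mem_image_of_mem (fun t => θ t * h t) ⟨hs, Metric.mem_ball_self hδ⟩)
    (Set.mem_image_of_mem (fun t => θ t * h t) ⟨htJ, ht⟩) hm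
  have h1 := hclose x hx
  simp only at hxm
  rcases hθ x with h2 | h2
  · rw [h2, zero_mul] at hxm
    exact h0 (by linarith)
  · rw [h2, one_mul] at hxm
    rw [hxm] at h1
    have h3 : h s / 4 - h s = -(3 / 4 * h s) := by ring
    rw [h3, abs_neg, abs_mul, abs_of_pos (by norm_num : (0 : ℝ) < 3 / 4)] at h1
    have := abs_nonneg (h s)
    linarith

section Dichotomy

set_option linter.unusedSectionVars false

variable {E : Type*} [NormedAddCommGroup E] [InnerProductSpace ℝ E] [FiniteDimensional ℝ E]
  [MeasurableSpace E] [BorelSpace E]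
  {K : E × E → E} {L : ℝ} {f : ℝ → E → ℝ} {a b C r : ℝ} {y c : ℝ → E}

/-- The velocity field seen in a moving frame. -/
def frameField (K : E × E → E) (f : ℝ → E → ℝ) (y c : ℝ → E) (t : ℝ) (x : E) : E :=
  relVel K (f t) (x + y t) - c t

theorem IsFrame.continuousOn {J : Set ℝ} (hF : IsFrame K f y c J r) : ContinuousOn y J :=
  fun t ht => (hF.deriv t ht).continuousWithinAt

theorem IsFrame.isLipField (hF : IsFrame K f y c (Set.Icc a b) r) (H : IsMeanField K L f)
    (hC0 : 0 ≤ C) (hC : ∀ t ∈ Set.Icc a b, ∫ z, |f t z| ≤ C) :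
    IsLipField (frameField K f y c) a b (L * C) := by
  have h := H.isLipField_relVel hC0 hC
  refine ⟨h.nonneg, fun τ hτ x z => ?_, fun x => ?_⟩
  · simpa [frameField] using h.lip τ hτ (x + y τ) (z + y τ)
  · refine ContinuousOn.sub ?_ hF.cont
    exact h.continuousOn_uncurry.comp (f := fun t => (t, x + y t))
      (continuousOn_id.prodMk (continuousOn_const.add hF.continuousOn)) fun t ht => ⟨ht, trivial⟩

theorem integral_comp_add_frame (φ : E → ℝ) (V : E → E) (g : E → ℝ) (y : E) :
    ∫ z, fderiv ℝ φ z (V (z + y)) * g (z + y) = ∫ z, fderiv ℝ φ (z - y) (V z) * g z := by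
  rw [← integral_add_right_eq_self (fun z => fderiv ℝ φ (z - y) (V z) * g z) y]
  simp only [add_sub_cancel_right]

theorem IsFrame.hasDerivWithinAt (hF : IsFrame K f y c (Set.Icc a b) r) (H : IsMeanField K L f)
    (hC : ∀ t ∈ Set.Icc a b, ∫ z, |f t z| ≤ C) {φ : E → ℝ} (hφ : IsTest φ) {t : ℝ}
    (ht : t ∈ Set.Icc a b) :
    HasDerivWithinAt (fun s => ∫ z, φ z * f s (z + y s))
      (activity K (f t) * ∫ z, fderiv ℝ φ z (frameField K f y c t z) * f t (z + y t))
      (Set.Icc a b) t := by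
  have h := hasDerivWithinAt_comp_partial (q := fun y s => ∫ z, f s z • φ (z - y)) (r := r)
    (A := fun y s => ∫ z, f s z • fderiv ℝ φ (z - y)) (J := Set.Icc a b) (t := t) (y := y)
    (fun s _ y _ => hasFDerivAt_integral_translate (H.int s) hφ.smooth hφ.supp y)
    (H.continuousOn_integral_translate hC (hφ.smooth.fderiv_right (by simp))
      (hφ.supp.fderiv ℝ) r) ht (fun s hs => mem_closedBall_zero_iff.2 (hF.bound s hs))
    (hF.deriv t ht) (H.hasDerivAt_translate hφ.smooth hφ.supp (y t) t).hasDerivWithinAt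
  have h1 : ∀ s, ∫ z, f s z • φ (z - y s) = ∫ z, φ z * f s (z + y s) := fun s => by
    rw [← integral_add_right_eq_self (fun z => f s z • φ (z - y s)) (y s)]
    simp only [add_sub_cancel_right, smul_eq_mul, mul_comm]
  simp only [h1] at h
  refine h.congr_deriv ?_
  rw [H.integral_translate_meanVel hφ.smooth hφ.supp, map_add, map_smul, add_sub_add_right_eq_sub,
    ← smul_sub, smul_eq_mul, ← integral_translate_apply_const (H.int t) hφ.smooth hφ.supp,
    ← integral_sub]
  · congr 1
    refine Eq.trans ?_ (integral_comp_add_frame φ (fun z => relVel K (f t) z - c t) _ _).symm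
    congr 1; ext1 z
    rw [← smul_sub, ← map_sub, smul_eq_mul, mul_comm]
  · exact H.integrable_translate_apply hφ.smooth hφ.supp _ _ (H.continuous_relVel (H.int t))
  · exact H.integrable_translate_apply hφ.smooth hφ.supp _ _ continuous_const

theorem IsFrame.continuousOn_integral (hF : IsFrame K f y c (Set.Icc a b) r)
    (H : IsMeanField K L f) (hC0 : 0 ≤ C)
    (hC : ∀ t ∈ Set.Icc a b, ∫ z, |f t z| ≤ C) {φ : E → ℝ} (hφ : IsTest φ) :
    ContinuousOn (fun t => ∫ z, fderiv ℝ φ z (frameField K f y c t z) * f t (z + y t))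
      (Set.Icc a b) := by
  obtain ⟨R, hR⟩ := (hφ.supp.fderiv ℝ).isCompact.isBounded.exists_norm_le
  have hD : Continuous (fderiv ℝ φ) := hφ.smooth.continuous_fderiv (by simp)
  have h := H.continuousOn_integral (P := ℝ) (τ := id) (J := Set.Icc a b) continuousOn_id hC
    (ζ := fun t z => fderiv ℝ φ (z - y t) (relVel K (f t) z - c t)) (R := R + r) ?_ ?_
  · refine h.congr fun t _ => ?_
    exact integral_comp_add_frame φ (fun z => relVel K (f t) z - c t) _ _
  · refine ContinuousOn.clm_apply ?_ ((H.isLipField_relVel hC0 hC).continuousOn_uncurry.sub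
      (hF.cont.comp continuousOn_fst fun p hp => hp.1))
    exact hD.comp_continuousOn
      (continuousOn_snd.sub (hF.continuousOn.comp continuousOn_fst fun p hp => hp.1))
  · intro t ht z hz
    rw [image_eq_zero_of_notMem_tsupport (f := fderiv ℝ φ), zero_apply]
    intro h
    have h1 := hR _ h
    have h2 := norm_sub_norm_le z (y t)
    have h3 := hF.bound t ht
    linarith

theorem IsMeanField.ae_eq_of_forall_integral_eq (H : IsMeanField K L f) {s t : ℝ}
    (h : ∀ φ, IsTest φ → ∫ z, φ z * f s z = ∫ z, φ z * f t z) : f s =ᵐ[volume] f t :=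
  ae_eq_of_integral_contDiff_smul_eq (H.int s).locallyIntegrable (H.int t).locallyIntegrable
    fun φ h1 h2 => h φ ⟨h1, h2⟩

theorem meanVel_eq_zero_of_activity (H : IsMeanField K L f) {t : ℝ} (h : activity K (f t) = 0)
    (z : E) : meanVel K (f t) z = 0 := by
  rw [H.meanVel_eq (H.int t), h, zero_smul, zero_add, meanVel_eq_zero h]

theorem IsFrame.eventually_frozen (hF : IsFrame K f y c (Set.Icc a b) r)
    (H : IsMeanField K L f) (hC0 : 0 ≤ C) (hC : ∀ t ∈ Set.Icc a b, ∫ z, |f t z| ≤ C)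
    {φ : E → ℝ} (hφ : IsTest φ) {s : ℝ} (hs : s ∈ Set.Icc a b) (hθ : activity K (f s) = 0)
    (hne : ∫ z, fderiv ℝ φ z (frameField K f y c s z) * f s (z + y s) ≠ 0) :
    ∀ᶠ t in 𝓝[Set.Icc a b] s, f t =ᵐ[volume] f s ∧ y t = y s := by
  have hev := eventually_eq_zero_of_hasDerivWithinAt (convex_Icc a b)
    (fun t ht => hF.hasDerivWithinAt H hC hφ ht) (fun t => activity_eq K (f t)) hs
    (hF.continuousOn_integral H hC0 hC hφ s hs) hne hθ
  obtain ⟨δ, hδ, hball⟩ := Metric.mem_nhdsWithin_iff.1 hev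
  have hI : Convex ℝ (Metric.ball s δ ∩ Set.Icc a b) := (convex_ball s δ).inter (convex_Icc a b)
  have hsI : s ∈ Metric.ball s δ ∩ Set.Icc a b := ⟨Metric.mem_ball_self hδ, hs⟩
  have hb : Metric.ball s δ ∈ 𝓝[Set.Icc a b] s := nhdsWithin_le_nhds (Metric.ball_mem_nhds s hδ)
  filter_upwards [hb, self_mem_nhdsWithin] with t htb htI
  have htI' : t ∈ Metric.ball s δ ∩ Set.Icc a b := ⟨htb, htI⟩
  constructor
  · refine H.ae_eq_of_forall_integral_eq fun ψ hψ => ?_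
    have hd : ∀ τ ∈ Metric.ball s δ ∩ Set.Icc a b, HasDerivWithinAt (fun s => ∫ z, ψ z * f s z) 0
        (Metric.ball s δ ∩ Set.Icc a b) τ := fun τ hτ => by
      refine (H.hasDerivAt hψ τ).hasDerivWithinAt.congr_deriv ?_
      simp [meanVel_eq_zero_of_activity H (hball hτ)]
    have := hI.norm_image_sub_le_of_norm_hasDerivWithin_le hd (C := 0) (fun _ _ => by simp) hsI htI'
    rw [zero_mul, norm_le_zero_iff, sub_eq_zero] at this
    exact this
  · have hd : ∀ τ ∈ Metric.ball s δ ∩ Set.Icc a b, HasDerivWithinAt y 0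
        (Metric.ball s δ ∩ Set.Icc a b) τ := fun τ hτ => by
      refine ((hF.deriv τ hτ.2).mono Set.inter_subset_right).congr_deriv ?_
      have h0 : activity K (f τ) = 0 := hball hτ
      rw [h0, zero_smul, meanVel_eq_zero h0, add_zero]
    have := hI.norm_image_sub_le_of_norm_hasDerivWithin_le hd (C := 0) (fun _ _ => by simp) hsI htI'
    rw [zero_mul, norm_le_zero_iff, sub_eq_zero] at this
    exact this

/-- In a moving frame, the solution is either transported by a Lipschitz field or constant. -/
theorem IsFrame.isTransportSol_or_constant (hF : IsFrame K f y c (Set.Icc a b) r)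
    (H : IsMeanField K L f) (hC0 : 0 ≤ C) (hC : ∀ t ∈ Set.Icc a b, ∫ z, |f t z| ≤ C) :
    IsTransportSol (fun t z => f t (z + y t)) (frameField K f y c) a b C ∨
      ∀ s ∈ Set.Icc a b, ∀ t ∈ Set.Icc a b, f s =ᵐ[volume] f t := by
  by_cases hA : ∀ φ, IsTest φ → ∀ t ∈ Set.Icc a b, activity K (f t) = 0 →
      ∫ z, fderiv ℝ φ z (frameField K f y c t z) * f t (z + y t) = 0
  · left
    refine ⟨fun t _ => (H.int t).comp_add_right (y t), fun t ht => ?_, fun φ hφ t ht => ?_⟩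
    · rw [integral_add_right_eq_self fun z => |f t z|]
      exact hC t ht
    · refine (hF.hasDerivWithinAt H hC hφ ht).congr_deriv ?_
      rcases activity_eq K (f t) with h | h
      · rw [hA φ hφ t ht h, mul_zero]
      · rw [h, one_mul]
  · right
    push Not at hA
    obtain ⟨φ, hφ, t₁, ht₁, hθ, hne⟩ := hA
    let P : ℝ → Prop := fun t => f t =ᵐ[volume] f t₁ ∧ y t = y t₁
    have hopen : ∀ s ∈ Set.Icc a b, P s → ∀ᶠ t in 𝓝[Set.Icc a b] s, P t := by
      rintro s hs ⟨h1, h2⟩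
      have hcs := hF.congr s hs t₁ ht₁ h1 h2
      have hθs : activity K (f s) = 0 := by rw [activity_congr h1, hθ]
      have hne' : ∫ z, fderiv ℝ φ z (frameField K f y c s z) * f s (z + y s) ≠ 0 := by
        convert! hne using 1
        have h3 : (fun z => f s (z + y s)) =ᵐ[volume] fun z => f t₁ (z + y t₁) := by
          rw [← h2]
          exact (measurePreserving_add_right volume (y s)).quasiMeasurePreserving.ae_eq h1
        refine integral_congr_ae ?_
        filter_upwards [h3] with z hz
        rw [hz, frameField, frameField, relVel_congr h1, h2, hcs]
      filter_upwards [hF.eventually_frozen H hC0 hC hφ hs hθs hne'] with t ht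
      exact ⟨ht.1.trans h1, ht.2.trans h2⟩
    have hclosed : ∀ s ∈ Set.Icc a b, ¬P s → ∀ᶠ t in 𝓝[Set.Icc a b] s, ¬P t := by
      intro s hs hP
      by_cases h2 : y s = y t₁
      · have h1 : ¬∀ ψ, IsTest ψ → ∫ z, ψ z * f s z = ∫ z, ψ z * f t₁ z := fun h =>
          hP ⟨H.ae_eq_of_forall_integral_eq h, h2⟩
        push Not at h1
        obtain ⟨ψ, hψ, h3⟩ := h1
        filter_upwards [nhdsWithin_le_nhds ((H.continuous hψ).continuousAt.eventually_ne h3)]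
          with t ht hPt
        exact ht (integral_congr_ae (by filter_upwards [hPt.1] with z hz; rw [hz]))
      · filter_upwards [(hF.continuousOn s hs).eventually_ne h2] with t ht hPt
        exact ht hPt.2
    have hall : ∀ s ∈ Set.Icc a b, P s := fun s hs => by
      refine (isPreconnected_Icc.induction₂' (fun s t => P s ↔ P t) (fun x hx => ?_)
        (fun _ _ _ _ _ _ h1 h2 => h1.trans h2) hs ht₁).2 ⟨.rfl, rfl⟩
      by_cases h : P x
      · filter_upwards [hopen x hx h] with t ht
        exact ⟨⟨fun _ => ht, fun _ => h⟩, ⟨fun _ => h, fun _ => ht⟩⟩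
      · filter_upwards [hclosed x hx h] with t ht
        exact ⟨⟨fun h' => absurd h' h, fun h' => absurd h' ht⟩,
          ⟨fun h' => absurd h' ht, fun h' => absurd h' h⟩⟩
    exact fun s hs t ht => (hall s hs).1.trans (hall t ht).1.symm

end Dichotomy

section LocalBounds

set_option linter.unusedSectionVars false

variable {E : Type*} [NormedAddCommGroup E] [InnerProductSpace ℝ E] [FiniteDimensional ℝ E]
  [MeasurableSpace E] [BorelSpace E]
  {K : E × E → E} {L : ℝ} {f : ℝ → E → ℝ} {a b C r : ℝ} {y c : ℝ → E}

theorem japanese_add_le {y : E} (hy : ‖y‖ ≤ r) (z : E) :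
    japanese (z + y) ≤ 2 * (1 + r) * japanese z := by
  have h1 := japanese_le (z + y)
  have h2 := le_japanese z
  have h3 := norm_add_le z y
  have h4 : 0 ≤ r := (norm_nonneg y).trans hy
  have h5 : 1 + ‖z + y‖ ≤ (1 + r) * (1 + ‖z‖) := by
    have := mul_nonneg h4 (norm_nonneg z)
    linarith
  calc japanese (z + y) ≤ (1 + r) * (1 + ‖z‖) := h1.trans h5
    _ ≤ (1 + r) * (2 * japanese z) := by gcongr
    _ = _ := by ring

theorem lintegral_japanese_shift_le {y : E} (hy : ‖y‖ ≤ r) (g : E → ℝ) :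
    ∫⁻ z, ‖japanese z * g z‖ₑ ≤
      ENNReal.ofReal (2 * (1 + r)) * ∫⁻ z, ‖japanese z * g (z + y)‖ₑ := by
  rw [← lintegral_add_right_eq_self _ y, ← lintegral_const_mul' _ _ ENNReal.ofReal_ne_top]
  refine lintegral_mono fun z => ?_
  have h4 : 0 ≤ r := (norm_nonneg y).trans hy
  rw [enorm_mul, enorm_mul, ← mul_assoc]
  gcongr
  rw [Real.enorm_eq_ofReal (japanese_nonneg _), Real.enorm_eq_ofReal (japanese_nonneg _),
    ← ENNReal.ofReal_mul (by positivity)]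
  exact ENNReal.ofReal_le_ofReal (japanese_add_le hy z)

theorem IsFrame.lintegral_le (hF : IsFrame K f y c (Set.Icc a b) r)
    (H : IsMeanField K L f) (hC0 : 0 ≤ C) (hC : ∀ t ∈ Set.Icc a b, ∫ z, |f t z| ≤ C) :
    ∃ κ : ℝ, 1 ≤ κ ∧ ∀ s ∈ Set.Icc a b, ∀ t ∈ Set.Icc a b, s ≤ t →
      ∫⁻ z, ‖f t z‖ₑ ≤ ∫⁻ z, ‖f s z‖ₑ ∧
      ∫⁻ z, ‖japanese z * f t z‖ₑ ≤ ENNReal.ofReal κ * ∫⁻ z, ‖japanese z * f s z‖ₑ := by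
  rcases hF.isTransportSol_or_constant H hC0 hC with hT | hconst
  swap
  · refine ⟨1, le_rfl, fun s hs t ht _ => ⟨?_, ?_⟩⟩
    · refine (lintegral_congr_ae ?_).le
      filter_upwards [hconst s hs t ht] with z hz; rw [hz]
    · rw [ENNReal.ofReal_one, one_mul]
      refine (lintegral_congr_ae ?_).le
      filter_upwards [hconst s hs t ht] with z hz; rw [hz]
  rcases lt_or_ge b a with hab | hab
  · refine ⟨1, le_rfl, fun s hs => ?_⟩
    rw [Set.Icc_eq_empty hab.not_ge] at hs
    exact hs.elim
  have hW := hF.isLipField H hC0 hC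
  obtain ⟨m, hm, hWm⟩ := hW.exists_linear_bound hab
  have hr : 0 ≤ r := (norm_nonneg _).trans (hF.bound a (Set.left_mem_Icc.2 hab))
  set M := m + L * C + 1 with hM
  have hM0 : 0 < M := by have := hW.nonneg; positivity
  have hWM : ∀ τ ∈ Set.Icc a b, ∀ x, ‖frameField K f y c τ x‖ ≤ M * (1 + ‖x‖) := fun τ hτ x => by
    refine (hWm τ hτ x).trans ?_
    have h1 := mul_nonneg (add_nonneg hm zero_le_one) (norm_nonneg x)
    have h2 := hW.nonneg
    rw [hM]
    linarith
  set κ := 2 * (1 + r) * (2 * exp (M * (b - a)) * (2 * (1 + r))) with hκ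
  have hexp : 1 ≤ exp (M * (b - a)) :=
    one_le_exp (mul_nonneg hM0.le (sub_nonneg.2 hab))
  refine ⟨κ, ?_, fun s hs t ht hst => ?_⟩
  · have h1 : 1 ≤ 2 * (1 + r) := by linarith
    have h2 : 1 ≤ 2 * exp (M * (b - a)) := by linarith
    exact one_le_mul_of_one_le_of_one_le h1 (one_le_mul_of_one_le_of_one_le h2 h1)
  have hTst := hT.mono hs.1 ht.2
  have hWst := hW.mono hs.1 ht.2
  constructor
  · have := hTst.lintegral_le hWst hst
    rwa [lintegral_add_right_eq_self fun z => ‖f t z‖ₑ,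
      lintegral_add_right_eq_self fun z => ‖f s z‖ₑ] at this
  · have h1 := hTst.lintegral_japanese_le hWst hst hM0
      fun τ hτ => hWM τ ⟨hs.1.trans hτ.1, hτ.2.trans ht.2⟩
    have h2 := lintegral_japanese_shift_le (hF.bound t ht) (f t)
    have h3 := lintegral_japanese_shift_le (r := r) (y := -y s)
      (by rw [norm_neg]; exact hF.bound s hs) fun z => f s (z + y s)
    simp only [neg_add_cancel_right] at h3
    calc ∫⁻ z, ‖japanese z * f t z‖ₑ
        ≤ ENNReal.ofReal (2 * (1 + r)) * (ENNReal.ofReal (2 * exp (M * (t - s))) *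
          (ENNReal.ofReal (2 * (1 + r)) * ∫⁻ z, ‖japanese z * f s z‖ₑ)) := by
            refine h2.trans ?_
            gcongr
            exact h1.trans (by gcongr)
      _ ≤ ENNReal.ofReal (2 * (1 + r)) * (ENNReal.ofReal (2 * exp (M * (b - a))) *
          (ENNReal.ofReal (2 * (1 + r)) * ∫⁻ z, ‖japanese z * f s z‖ₑ)) := by
            have := hs.1
            have := ht.2
            gcongr
      _ = _ := by
        rw [hκ, ENNReal.ofReal_mul (p := 2 * (1 + r)) (by positivity),
          ENNReal.ofReal_mul (p := 2 * exp (M * (b - a))) (by positivity)]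
        simp only [mul_assoc]

theorem IsMeanField.exists_local_lintegral_le_of_le (H : IsMeanField K L f)
    (hC : ∀ t ∈ Set.Icc a b, ∫ z, |f t z| ≤ C) (h1 : ∀ t, ∫ z, f t z = 1) {t₀ : ℝ}
    (ht₀ : t₀ ∈ Set.Icc a b) :
    ∃ δ > 0, ∃ κ : ℝ, 1 ≤ κ ∧ ∀ s ∈ Set.Icc a b, ∀ t ∈ Set.Icc a b, |s - t₀| ≤ δ → |t - t₀| ≤ δ →
      s ≤ t → ∫⁻ z, ‖f t z‖ₑ ≤ ∫⁻ z, ‖f s z‖ₑ ∧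
      ∫⁻ z, ‖japanese z * f t z‖ₑ ≤ ENNReal.ofReal κ * ∫⁻ z, ‖japanese z * f s z‖ₑ := by
  have hC0 : 0 ≤ C := (integral_nonneg fun z => abs_nonneg _).trans (hC t₀ ht₀)
  obtain ⟨δ, hδ, y, c, r, hF⟩ := H.exists_frame hC h1 ht₀
  obtain ⟨κ, hκ, h⟩ := hF.lintegral_le H hC0 fun t ht =>
    hC t (Set.Icc_subset_Icc (le_max_left _ _) (min_le_left _ _) ht)
  have hmem : ∀ s ∈ Set.Icc a b, |s - t₀| ≤ δ →
      s ∈ Set.Icc (max a (t₀ - δ)) (min b (t₀ + δ)) := fun s hs hsδ => by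
    rw [abs_le] at hsδ
    exact ⟨max_le hs.1 (by linarith), le_min hs.2 (by linarith)⟩
  exact ⟨δ, hδ, κ, hκ, fun s hs t ht hsδ htδ => h s (hmem s hs hsδ) t (hmem t ht htδ)⟩

theorem IsMeanField.exists_local_lintegral_le (H : IsMeanField K L f)
    (hC : ∀ t ∈ Set.Icc a b, ∫ z, |f t z| ≤ C) (h1 : ∀ t, ∫ z, f t z = 1) {t₀ : ℝ}
    (ht₀ : t₀ ∈ Set.Icc a b) :
    ∃ κ : ℝ, ∀ᶠ t in 𝓝[Set.Icc a b] t₀, ∫⁻ z, ‖f t z‖ₑ = ∫⁻ z, ‖f t₀ z‖ₑ ∧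
      ∫⁻ z, ‖japanese z * f t z‖ₑ ≤ ENNReal.ofReal κ * ∫⁻ z, ‖japanese z * f t₀ z‖ₑ ∧
      ∫⁻ z, ‖japanese z * f t₀ z‖ₑ ≤ ENNReal.ofReal κ * ∫⁻ z, ‖japanese z * f t z‖ₑ := by
  obtain ⟨δ₁, hδ₁, κ₁, hκ₁, hA⟩ := H.exists_local_lintegral_le_of_le hC h1 ht₀
  have hneg : ∀ t : ℝ, t ∈ Set.Icc (-b) (-a) ↔ -t ∈ Set.Icc a b := fun t => by
    rw [Set.mem_Icc, Set.mem_Icc, neg_le, le_neg, and_comm]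
  obtain ⟨δ₂, hδ₂, κ₂, hκ₂, hB⟩ := H.reverse.exists_local_lintegral_le_of_le (a := -b) (b := -a)
    (t₀ := -t₀) (fun t ht => hC _ ((hneg t).1 ht)) (fun t => h1 _) ((hneg _).2 (by rwa [neg_neg]))
  have hB' : ∀ s ∈ Set.Icc a b, ∀ t ∈ Set.Icc a b, |s - t₀| ≤ δ₂ → |t - t₀| ≤ δ₂ →
      t ≤ s → ∫⁻ z, ‖f t z‖ₑ ≤ ∫⁻ z, ‖f s z‖ₑ ∧
      ∫⁻ z, ‖japanese z * f t z‖ₑ ≤ ENNReal.ofReal κ₂ * ∫⁻ z, ‖japanese z * f s z‖ₑ := by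
    intro s hs t ht hsδ htδ hts
    have := hB (-s) ((hneg _).2 (by rwa [neg_neg])) (-t) ((hneg _).2 (by rwa [neg_neg]))
      (by rwa [neg_sub_neg, abs_sub_comm]) (by rwa [neg_sub_neg, abs_sub_comm]) (by linarith)
    simpa only [neg_neg] using this
  have hle : ∀ {κ : ℝ} (p q : ℝ≥0∞), κ ≤ max κ₁ κ₂ → p ≤ ENNReal.ofReal κ * q →
      p ≤ ENNReal.ofReal (max κ₁ κ₂) * q := fun p q h h' => h'.trans (by gcongr)
  refine ⟨max κ₁ κ₂, ?_⟩
  filter_upwards [self_mem_nhdsWithin,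
    nhdsWithin_le_nhds (Metric.closedBall_mem_nhds t₀ (lt_min hδ₁ hδ₂))] with t ht htδ
  have ht1 : |t - t₀| ≤ δ₁ := htδ.out.trans (min_le_left _ _)
  have ht2 : |t - t₀| ≤ δ₂ := htδ.out.trans (min_le_right _ _)
  have h01 : |t₀ - t₀| ≤ δ₁ := by simpa using hδ₁.le
  have h02 : |t₀ - t₀| ≤ δ₂ := by simpa using hδ₂.le
  rcases le_total t t₀ with h | h
  · have hp := hA t ht t₀ ht₀ ht1 h01 h
    have hq := hB' t₀ ht₀ t ht h02 ht2 h
    exact ⟨le_antisymm hq.1 hp.1, hle _ _ (le_max_right _ _) hq.2, hle _ _ (le_max_left _ _) hp.2⟩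
  · have hp := hA t₀ ht₀ t ht h01 ht1 h
    have hq := hB' t ht t₀ ht₀ ht2 h02 h
    exact ⟨le_antisymm hp.1 hq.1, hle _ _ (le_max_left _ _) hp.2, hle _ _ (le_max_right _ _) hq.2⟩

theorem IsMeanField.lintegral_eq_of_bounded (H : IsMeanField K L f)
    (hC : ∀ t ∈ Set.Icc a b, ∫ z, |f t z| ≤ C) (h1 : ∀ t, ∫ z, f t z = 1) {s t : ℝ}
    (hs : s ∈ Set.Icc a b) (ht : t ∈ Set.Icc a b) : ∫⁻ z, ‖f s z‖ₑ = ∫⁻ z, ‖f t z‖ₑ := by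
  refine isPreconnected_Icc.induction₂' (fun s t => ∫⁻ z, ‖f s z‖ₑ = ∫⁻ z, ‖f t z‖ₑ)
    (fun x hx => ?_) (fun _ _ _ _ _ _ h1 h2 => h1.trans h2) hs ht
  obtain ⟨κ, hκ⟩ := H.exists_local_lintegral_le hC h1 hx
  filter_upwards [hκ] with y hy using ⟨hy.1.symm, hy.1⟩

theorem IsMeanField.exists_lintegral_japanese_le (H : IsMeanField K L f)
    (hC : ∀ t ∈ Set.Icc a b, ∫ z, |f t z| ≤ C) (h1 : ∀ t, ∫ z, f t z = 1) {s : ℝ}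
    (hs : s ∈ Set.Icc a b) (hfin : ∫⁻ z, ‖japanese z * f s z‖ₑ < ⊤) :
    ∃ B : ℝ≥0∞, B < ⊤ ∧ ∀ t ∈ Set.Icc a b, ∫⁻ z, ‖japanese z * f t z‖ₑ ≤ B := by
  have hall : ∀ t ∈ Set.Icc a b, ∫⁻ z, ‖japanese z * f t z‖ₑ < ⊤ := fun t ht => by
    refine (isPreconnected_Icc.induction₂' (fun s t => ∫⁻ z, ‖japanese z * f s z‖ₑ < ⊤ →
      ∫⁻ z, ‖japanese z * f t z‖ₑ < ⊤) (fun x hx => ?_) (fun _ _ _ _ _ _ h1 h2 => h2 ∘ h1)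
      hs ht) hfin
    obtain ⟨κ, hκ⟩ := H.exists_local_lintegral_le hC h1 hx
    filter_upwards [hκ] with y hy
    exact ⟨fun h => hy.2.1.trans_lt (ENNReal.mul_lt_top ENNReal.ofReal_lt_top h),
      fun h => hy.2.2.trans_lt (ENNReal.mul_lt_top ENNReal.ofReal_lt_top h)⟩
  refine isCompact_Icc.induction_on (p := fun S => ∃ B : ℝ≥0∞, B < ⊤ ∧ ∀ t ∈ S,
    ∫⁻ z, ‖japanese z * f t z‖ₑ ≤ B) ⟨0, ENNReal.zero_lt_top, by simp⟩
    (fun S S' hSS' ⟨B, hB, h⟩ => ⟨B, hB, fun t ht => h t (hSS' ht)⟩)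
    (fun S S' ⟨B, hB, h⟩ ⟨B', hB', h'⟩ => ⟨max B B', max_lt hB hB', fun t ht => ht.elim
      (fun ht => (h t ht).trans (le_max_left _ _)) fun ht => (h' t ht).trans (le_max_right _ _)⟩)
    fun x hx => ?_
  obtain ⟨κ, hκ⟩ := H.exists_local_lintegral_le hC h1 hx
  exact ⟨_, hκ, _, ENNReal.mul_lt_top ENNReal.ofReal_lt_top (hall x hx), fun t ht => ht.2.1⟩

end LocalBounds

section Baire

variable {V : ℝ → ℝ≥0∞}

theorem exists_bound_of_subset_locally_bounded {S : Set ℝ} (hS : IsCompact S)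
    (hU : ∀ t ∈ S, ∃ n : ℕ, t ∈ interior {t | V t ≤ n}) : ∃ n : ℕ, ∀ t ∈ S, V t ≤ n := by
  refine hS.induction_on (p := fun S => ∃ n : ℕ, ∀ t ∈ S, V t ≤ n) ⟨0, by simp⟩
    (fun S S' hSS' ⟨n, h⟩ => ⟨n, fun t ht => h t (hSS' ht)⟩)
    (fun S S' ⟨n, h⟩ ⟨n', h'⟩ => ⟨max n n', fun t ht => ht.elim
      (fun ht => (h t ht).trans (by simp)) fun ht => (h' t ht).trans (by simp)⟩)
    fun x hx => ?_
  obtain ⟨n, hn⟩ := hU x hx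
  exact ⟨_, nhdsWithin_le_nhds (mem_interior_iff_mem_nhds.1 hn), n, fun t ht => ht⟩

/-- A lower semicontinuous function which is constant wherever it is bounded is locally bounded. -/
theorem exists_bound_of_const_of_bounded (hfin : ∀ t, V t < ⊤)
    (hcl : ∀ n : ℕ, IsClosed {t | V t ≤ n})
    (hconst : ∀ a b, (∃ n : ℕ, ∀ t ∈ Set.Icc a b, V t ≤ n) →
      ∀ s ∈ Set.Icc a b, ∀ t ∈ Set.Icc a b, V s = V t) (a b : ℝ) :
    ∃ n : ℕ, ∀ t ∈ Set.Icc a b, V t ≤ n := by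
  have hconst' : ∀ p t, (∃ n : ℕ, ∀ s ∈ Set.uIcc p t, V s ≤ n) → V p = V t := fun p t h =>
    hconst _ _ h _ Set.left_mem_uIcc _ Set.right_mem_uIcc
  have hex : ∀ t, ∃ n : ℕ, V t ≤ n := fun t => by
    obtain ⟨n, hn⟩ := ENNReal.exists_nat_gt (hfin t).ne
    exact ⟨n, hn.le⟩
  let U : Set ℝ := ⋃ n : ℕ, interior {t | V t ≤ n}
  have hUo : IsOpen U := isOpen_iUnion fun n => isOpen_interior
  have hcompact : ∀ S ⊆ U, IsCompact S → ∃ n : ℕ, ∀ t ∈ S, V t ≤ n := fun S hS hc =>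
    exists_bound_of_subset_locally_bounded hc fun t ht => Set.mem_iUnion.1 (hS ht)
  by_cases hW : Uᶜ = ∅
  · exact hcompact _ (fun t _ => by
      by_contra h
      exact Set.notMem_empty t (hW ▸ h)) isCompact_Icc
  exfalso
  have hWc : IsClosed Uᶜ := hUo.isClosed_compl
  have : Nonempty ↥Uᶜ := (Set.nonempty_iff_ne_empty.2 hW).to_subtype
  have : CompleteSpace ↥Uᶜ := hWc.completeSpace_coe
  obtain ⟨n, ⟨⟨w, hw⟩, hint⟩⟩ := nonempty_interior_of_iUnion_of_closed
    (f := fun n : ℕ => ((↑) : ↥Uᶜ → ℝ) ⁻¹' {t | V t ≤ n})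
    (fun n => (hcl n).preimage continuous_subtype_val) (by
      ext t
      simpa using hex t)
  rw [mem_interior_iff_mem_nhds, Metric.mem_nhds_iff] at hint
  obtain ⟨ε, hε, hball⟩ := hint
  have hWn : ∀ x ∈ Uᶜ, dist x w < ε → V x ≤ n := fun x hx hxw => @hball ⟨x, hx⟩ hxw
  refine hw (Set.mem_iUnion.2 ⟨n, ?_⟩)
  rw [mem_interior_iff_mem_nhds, Metric.mem_nhds_iff]
  refine ⟨ε, hε, fun t ht => ?_⟩
  change V t ≤ n
  obtain ⟨p, ⟨hpW, hpt⟩, hmin⟩ := (isCompact_uIcc.inter_left hWc).exists_isMinOn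
    (f := fun x => dist x t) ⟨w, hw, (Set.left_mem_uIcc : w ∈ Set.uIcc w t)⟩ (by fun_prop)
  have hsub : ∀ q ∈ Set.uIcc p t, q ≠ p → q ∈ U := fun q hq hqp => by
    by_contra hqU
    have hqw : q ∈ Set.uIcc w t := Set.uIcc_subset_uIcc_right hpt hq
    have h1 := isMinOn_iff.1 hmin q ⟨hqU, hqw⟩
    rw [Real.dist_eq, Real.dist_eq] at h1
    rcases Set.mem_uIcc.1 hq with ⟨h2, h3⟩ | ⟨h2, h3⟩
    · rw [abs_of_nonpos (by linarith), abs_of_nonpos (by linarith)] at h1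
      exact hqp (by linarith)
    · rw [abs_of_nonneg (by linarith), abs_of_nonneg (by linarith)] at h1
      exact hqp (by linarith)
  have heq : ∀ q ∈ Set.uIcc p t, q ≠ p → V q = V t := fun q hq hqp => by
    refine hconst' q t (hcompact _ (fun x hx => ?_) isCompact_uIcc)
    refine hsub x (Set.uIcc_subset_uIcc_right hq hx) ?_
    rintro rfl
    refine hqp ?_
    rcases Set.mem_uIcc.1 hq with ⟨h2, h3⟩ | ⟨h2, h3⟩ <;>
      rcases Set.mem_uIcc.1 hx with ⟨h4, h5⟩ | ⟨h4, h5⟩ <;> linarith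
  have hpeq : V p = V t := by
    refine hconst' p t ?_
    obtain ⟨n₁, h1⟩ := hex p
    obtain ⟨n₂, h2⟩ := hex t
    refine ⟨max n₁ n₂, fun s hs => ?_⟩
    by_cases hsp : s = p
    · rw [hsp]; exact h1.trans (by simp)
    · rw [heq s hs hsp]; exact h2.trans (by simp)
  rw [← hpeq]
  refine hWn p hpW ?_
  have h1 : dist w t < ε := by rw [dist_comm]; exact ht
  refine lt_of_le_of_lt ?_ h1
  rw [Real.dist_eq, Real.dist_eq]
  exact Set.abs_sub_left_of_mem_uIcc hpt |>.trans_eq (abs_sub_comm _ _)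

end Baire

section Bounds

set_option linter.unusedSectionVars false

variable {E : Type*} [NormedAddCommGroup E] [InnerProductSpace ℝ E] [FiniteDimensional ℝ E]
  [MeasurableSpace E] [BorelSpace E]
  {K : E × E → E} {L : ℝ} {f : ℝ → E → ℝ}

theorem IsMeanField.exists_tv_bound (H : IsMeanField K L f) (h1 : ∀ t, ∫ z, f t z = 1) (a b : ℝ) :
    ∃ C, ∀ t ∈ Set.Icc a b, ∫ z, |f t z| ≤ C := by
  have hint : ∀ t, ∫⁻ z, ‖f t z‖ₑ = ENNReal.ofReal (∫ z, |f t z|) := fun t => by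
    rw [← ofReal_integral_norm_eq_lintegral_enorm (H.int t)]; rfl
  have hle : ∀ t (n : ℕ), ∫⁻ z, ‖f t z‖ₑ ≤ n ↔ ∫ z, |f t z| ≤ n := fun t n => by
    rw [hint, ENNReal.ofReal_le_natCast]
  obtain ⟨n, hn⟩ := exists_bound_of_const_of_bounded (V := fun t => ∫⁻ z, ‖f t z‖ₑ)
    (fun t => (H.int t).2) (fun n => by
      simpa using H.isClosed_weight_le (q := fun _ => 1) contDiff_const (B := n) (by positivity))
    (fun a b ⟨n, hn⟩ s hs t ht =>
      H.lintegral_eq_of_bounded (C := n) (fun t ht => (hle t n).1 (hn t ht)) h1 hs ht) a b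
  exact ⟨n, fun t ht => (hle t n).1 (hn t ht)⟩

end Bounds

section Moment

set_option linter.unusedSectionVars false

variable {E : Type*} [NormedAddCommGroup E] [InnerProductSpace ℝ E] [FiniteDimensional ℝ E]
  [MeasurableSpace E] [BorelSpace E]

variable {K : E × E → E} {L : ℝ} {f : ℝ → E → ℝ} {a b C M : ℝ}

theorem IsMeanField.norm_kernel_le (H : IsMeanField K L f) (x z : E) :
    ‖K (x, z)‖ ≤ L * ‖x - z‖ := by
  have h0 : K (z, z) = 0 := by
    have : (2 : ℝ) • K (z, z) = 0 := by rw [two_smul]; nth_rw 1 [H.antisymm z z]; simp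
    simpa using this
  simpa [h0] using H.lip_left x z z

/-- On the set `J` of times the absolute first moments of `f` are bounded by `M`. -/
structure HasMoment (f : ℝ → E → ℝ) (J : Set ℝ) (M : ℝ) : Prop where
  int : ∀ t ∈ J, Integrable fun z => (1 + ‖z‖) * |f t z|
  le : ∀ t ∈ J, ∫ z, (1 + ‖z‖) * |f t z| ≤ M

theorem IsMeanField.exists_hasMoment (H : IsMeanField K L f)
    (hC : ∀ t ∈ Set.Icc a b, ∫ z, |f t z| ≤ C) (h1 : ∀ t, ∫ z, f t z = 1) {s : ℝ}
    (hs : s ∈ Set.Icc a b) (hm : Integrable fun z => ‖z‖ * f s z) :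
    ∃ M, HasMoment f (Set.Icc a b) M := by
  have hj : Integrable fun z => japanese z * f s z := by
    refine ((hm.norm.add (H.int s).norm)).mono'
      (japanese_smooth.continuous.aestronglyMeasurable.mul (H.int s).1) (ae_of_all _ fun z => ?_)
    rw [norm_mul, Real.norm_of_nonneg (japanese_nonneg z)]
    refine (mul_le_mul_of_nonneg_right (japanese_le z) (norm_nonneg _)).trans (le_of_eq ?_)
    simp only [Pi.add_apply, norm_mul, norm_norm]; ring
  obtain ⟨B, hB, hle⟩ := H.exists_lintegral_japanese_le hC h1 hs hj.2
  have hi : ∀ t ∈ Set.Icc a b, Integrable fun z => japanese z * f t z := fun t ht =>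
    ⟨japanese_smooth.continuous.aestronglyMeasurable.mul (H.int t).1, (hle t ht).trans_lt hB⟩
  have hpt : ∀ t z, (1 + ‖z‖) * |f t z| ≤ 2 * ‖japanese z * f t z‖ := fun t z => by
    rw [norm_mul, Real.norm_of_nonneg (japanese_nonneg z), ← mul_assoc]
    exact mul_le_mul_of_nonneg_right (le_japanese z) (abs_nonneg _)
  have hint : ∀ t ∈ Set.Icc a b, Integrable fun z => (1 + ‖z‖) * |f t z| := fun t ht => by
    refine ((hi t ht).norm.const_mul 2).mono' ?_ (ae_of_all _ fun z => ?_)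
    · exact (continuous_const.add continuous_norm).aestronglyMeasurable.mul (H.int t).norm.1
    · rw [Real.norm_of_nonneg (by positivity)]; exact hpt t z
  refine ⟨2 * B.toReal, hint, fun t ht => ?_⟩
  refine (integral_mono (hint t ht) ((hi t ht).norm.const_mul 2) (hpt t)).trans ?_
  rw [integral_const_mul, integral_norm_eq_lintegral_enorm (hi t ht).1]
  exact mul_le_mul_of_nonneg_left (ENNReal.toReal_mono hB.ne (hle t ht)) zero_le_two

theorem IsMeanField.norm_smul_kernel_le (H : IsMeanField K L f) (c : ℝ) (x z : E) :
    ‖c • K (x, z)‖ ≤ L * (1 + ‖x‖) * ((1 + ‖z‖) * |c|) := by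
  have hL := H.nonneg
  rw [norm_smul, Real.norm_eq_abs]
  have h1 := H.norm_kernel_le x z
  have h2 : ‖x - z‖ ≤ (1 + ‖x‖) * (1 + ‖z‖) := by
    have := mul_nonneg (norm_nonneg x) (norm_nonneg z)
    have := norm_sub_le x z
    linarith
  calc |c| * ‖K (x, z)‖ ≤ |c| * (L * ((1 + ‖x‖) * (1 + ‖z‖))) := by gcongr; exact h1.trans (by gcongr)
    _ = _ := by ring

theorem IsMeanField.integrable_kernel (H : IsMeanField K L f) {J : Set ℝ} (hM : HasMoment f J M) {t : ℝ}
    (ht : t ∈ J) (x : E) : Integrable fun z => f t z • K (x, z) := by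
  have := H.continuous_kernel
  exact ((hM.int t ht).const_mul _).mono' ((H.int t).1.smul (by fun_prop))
    (ae_of_all _ fun z => H.norm_smul_kernel_le _ x z)

theorem IsMeanField.norm_meanVel_le (H : IsMeanField K L f) {J : Set ℝ} (hM : HasMoment f J M) {t : ℝ}
    (ht : t ∈ J) (x : E) : ‖meanVel K (f t) x‖ ≤ L * (1 + ‖x‖) * M := by
  have hL := H.nonneg
  refine (norm_integral_le_of_norm_le ((hM.int t ht).const_mul _)
    (ae_of_all _ fun z => H.norm_smul_kernel_le _ x z)).trans ?_
  rw [integral_const_mul]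
  exact mul_le_mul_of_nonneg_left (hM.le t ht) (by positivity)

theorem IsMeanField.activity_eq_one (H : IsMeanField K L f) {J : Set ℝ} (hM : HasMoment f J M) {t : ℝ}
    (ht : t ∈ J) : activity K (f t) = 1 := by
  rw [activity, if_pos (H.integrable_kernel hM ht 0)]

theorem IsMeanField.meanVel_lip (H : IsMeanField K L f) {g : E → ℝ} (hg : Integrable g) (x y : E) :
    ‖meanVel K g x - meanVel K g y‖ ≤ (L * ∫ z, |g z|) * ‖x - y‖ := by
  have hL := H.nonneg
  rw [H.meanVel_eq hg x, H.meanVel_eq hg y, add_sub_add_right_eq_sub, ← smul_sub, norm_smul]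
  rcases activity_eq K g with h | h <;> rw [h]
  · simp only [norm_zero, zero_mul]
    have : 0 ≤ ∫ z, |g z| := integral_nonneg fun z => abs_nonneg _
    positivity
  · simpa using H.relVel_lip hg x y

theorem abs_mul_sin_div_le {n : ℝ} (hn : 0 < n) (x : ℝ) : |n * sin (x / n)| ≤ |x| := by
  rw [abs_mul, abs_of_pos hn]
  calc n * |sin (x / n)| ≤ n * |x / n| := by exact mul_le_mul_of_nonneg_left Real.abs_sin_le_abs hn.le
    _ = |x| := by rw [abs_div, abs_of_pos hn]; field_simp

theorem tendsto_mul_sin_div (x : ℝ) :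
    Tendsto (fun n : ℕ => ((n : ℝ) + 1) * sin (x / (n + 1))) atTop (𝓝 x) := by
  have h : Tendsto (fun n : ℕ => x / ((n : ℝ) + 1)) atTop (𝓝 0) := by
    simpa [div_eq_mul_inv] using (tendsto_one_div_add_atTop_nhds_zero_nat (𝕜 := ℝ)).const_mul x
  have h2 := ((continuous_sinc.tendsto 0).comp h).const_mul x
  rw [sinc_zero, mul_one] at h2
  refine h2.congr fun n => ?_
  have hn : (n : ℝ) + 1 ≠ 0 := by positivity
  by_cases hx : x = 0
  · simp [hx]
  · rw [Function.comp, sinc_of_ne_zero (div_ne_zero hx hn)]; field_simp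

theorem IsMeanField.abs_clm_meanVel_sub_le (H : IsMeanField K L f) (hM : HasMoment f (Set.Icc a b) M)
    (l : E →L[ℝ] ℝ) {s t : ℝ} (hs : s ∈ Set.Icc a b) (ht : t ∈ Set.Icc a b) :
    |l (meanVel K (f t) 0) - l (meanVel K (f s) 0)| ≤ ‖l‖ * L * (L * M * M) * |t - s| := by
  have hL := H.nonneg
  have hK := H.smooth
  have hM0 : 0 ≤ M := (integral_nonneg fun z => by positivity).trans (hM.le s hs)
  let φ : ℕ → E → ℝ := fun n z => ((n : ℝ) + 1) * sin (l (K (0, z)) / (n + 1))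
  have hn : ∀ n : ℕ, 0 < (n : ℝ) + 1 := fun n => by positivity
  have hφ : ∀ n, ContDiff ℝ 1 (φ n) := fun n => by fun_prop
  have hlip : ∀ n x y, ‖φ n x - φ n y‖ ≤ ‖l‖ * L * ‖x - y‖ := fun n x y => by
    have h1 : ‖φ n x - φ n y‖ = (n + 1) * |sin (l (K (0, x)) / (n + 1)) - sin (l (K (0, y)) / (n + 1))| := by
      rw [← mul_sub, norm_mul, Real.norm_of_nonneg (hn n).le, Real.norm_eq_abs]
    have h2 : ((n : ℝ) + 1) * |l (K (0, x)) / (n + 1) - l (K (0, y)) / (n + 1)| =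
        |l (K (0, x) - K (0, y))| := by
      rw [← sub_div, abs_div, abs_of_pos (hn n), map_sub, mul_div_cancel₀ _ (hn n).ne']
    rw [h1, mul_assoc]
    refine (mul_le_mul_of_nonneg_left (abs_sin_sub_sin_le _ _) (hn n).le).trans ?_
    rw [h2]
    exact (l.le_opNorm _).trans (mul_le_mul_of_nonneg_left (H.lip_right x y 0) (norm_nonneg l))
  have hfd : ∀ n x, ‖fderiv ℝ (φ n) x‖ ≤ ‖l‖ * L := fun n =>
    norm_fderiv_le_of_norm_sub_le (by positivity) (hlip n)
  have hd := fun n t => H.weak (φ n) (hφ n) ⟨n + 1, fun z => by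
    rw [abs_mul, abs_of_pos (hn n)]
    exact mul_le_of_le_one_right (hn n).le (abs_sin_le_one _)⟩ ⟨_, hfd n⟩ t
  have hder : ∀ n, ∀ t ∈ Set.Icc a b,
      ‖∫ z, fderiv ℝ (φ n) z (meanVel K (f t) z) * f t z‖ ≤ ‖l‖ * L * (L * M * M) := fun n t ht => by
    refine (norm_integral_le_of_norm_le ((hM.int t ht).const_mul (‖l‖ * L * (L * M)))
      (ae_of_all _ fun z => ?_)).trans ?_
    · rw [norm_mul, Real.norm_eq_abs (f t z)]
      have h1 := (fderiv ℝ (φ n) z).le_of_opNorm_le (hfd n z) (meanVel K (f t) z)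
      have h2 := H.norm_meanVel_le hM ht z
      calc _ ≤ (‖l‖ * L * (L * (1 + ‖z‖) * M)) * |f t z| := by
            gcongr; exact h1.trans (by gcongr)
        _ = _ := by ring
    · rw [integral_const_mul]
      calc _ ≤ ‖l‖ * L * (L * M) * M := by gcongr; exact hM.le t ht
        _ = _ := by ring
  have hlim : ∀ t ∈ Set.Icc a b, Tendsto (fun n => ∫ z, φ n z * f t z) atTop
      (𝓝 (l (meanVel K (f t) 0))) := fun t ht => by
    have hi := H.integrable_kernel hM ht 0
    rw [meanVel, ← l.integral_comp_comm hi]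
    refine tendsto_integral_of_dominated_convergence (fun z => ‖l (f t z • K (0, z))‖)
      (fun n => (hφ n).continuous.aestronglyMeasurable.mul (H.int t).1) (l.integrable_comp hi).norm
      (fun n => ae_of_all _ fun z => ?_) (ae_of_all _ fun z => ?_)
    · rw [map_smul, smul_eq_mul, norm_mul (f t z), mul_comm, norm_mul (f t z)]
      exact mul_le_mul_of_nonneg_left (abs_mul_sin_div_le (hn n) _) (abs_nonneg (f t z))
    · rw [map_smul, smul_eq_mul, mul_comm]
      exact (tendsto_mul_sin_div _).mul_const _
  refine le_of_tendsto ((hlim t ht).sub (hlim s hs)).abs (.of_forall fun n => ?_)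
  exact (convex_Icc a b).norm_image_sub_le_of_norm_hasDerivWithin_le
    (fun x _ => (hd n x).hasDerivWithinAt) (hder n) hs ht

theorem IsMeanField.isLipField_meanVel (H : IsMeanField K L f) (hC0 : 0 ≤ C)
    (hC : ∀ t ∈ Set.Icc a b, ∫ z, |f t z| ≤ C) (hM : HasMoment f (Set.Icc a b) M) :
    IsLipField (fun t => meanVel K (f t)) a b (L * C) where
  nonneg := mul_nonneg H.nonneg hC0
  lip t ht x y := (H.meanVel_lip (H.int t) x y).trans <| by
    have := H.nonneg
    have := hC t ht
    gcongr
  cont x := by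
    have h0 : ContinuousOn (fun t => meanVel K (f t) 0) (Set.Icc a b) := by
      refine continuousOn_of_forall_clm fun l => ?_
      refine LipschitzOnWith.continuousOn (K := (‖l‖ * L * (L * M * M)).toNNReal)
        (LipschitzOnWith.of_dist_le_mul fun t ht s hs => ?_)
      rw [Real.dist_eq, Real.dist_eq]
      exact (H.abs_clm_meanVel_sub_le hM l hs ht).trans
        (mul_le_mul_of_nonneg_right (Real.le_coe_toNNReal _) (abs_nonneg _))
    refine ((H.continuous_relVel_time x).continuousOn.add h0).congr fun t ht => ?_
    simp only [H.meanVel_eq (H.int t) x, H.activity_eq_one hM ht, one_smul, Pi.add_apply]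

theorem IsMeanField.isTransportSol (H : IsMeanField K L f)
    (hC : ∀ t ∈ Set.Icc a b, ∫ z, |f t z| ≤ C) :
    IsTransportSol f (fun t => meanVel K (f t)) a b C :=
  ⟨fun t _ => H.int t, hC, fun _ hφ t _ => (H.hasDerivAt hφ t).hasDerivWithinAt⟩

end Moment

section Duality

set_option linter.unusedSectionVars false

variable {E : Type*} [NormedAddCommGroup E] [InnerProductSpace ℝ E] [FiniteDimensional ℝ E]
  [MeasurableSpace E] [BorelSpace E]

theorem ext_of_forall_isTest {μ ν : Measure E} [IsFiniteMeasure μ] [IsFiniteMeasure ν]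
    (h : ∀ φ : E → ℝ, IsTest φ → ∫ z, φ z ∂μ = ∫ z, φ z ∂ν) : μ = ν := by
  refine Measure.ext_of_integral_eq_on_compactlySupported fun ζ => ?_
  have key : ∀ (ρ : Measure E) [IsFiniteMeasure ρ] (ε : ℝ) (ψ : E → ℝ), IsTest ψ →
      (∀ z, |ψ z - ζ z| ≤ ε) → |∫ z, ψ z ∂ρ - ∫ z, ζ z ∂ρ| ≤ ε * ρ.real Set.univ := by
    intro ρ _ ε ψ hψ hε
    have hi : Integrable (fun z => ζ z) ρ :=
      ζ.continuous.integrable_of_hasCompactSupport ζ.hasCompactSupport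
    rw [← integral_sub (hψ.smooth.continuous.integrable_of_hasCompactSupport hψ.supp) hi]
    exact norm_integral_le_of_norm_le_const (f := fun z => ψ z - ζ z) (ae_of_all _ hε)
  set m := μ.real Set.univ + ν.real Set.univ
  have hm : 0 ≤ m := by positivity
  refine eq_of_abs_sub_le_all fun ε hε => ?_
  obtain ⟨ψ, hψ, hz⟩ := exists_isTest_close ζ.continuous ζ.hasCompactSupport
    (ε := ε / (m + 1)) (by positivity)
  have h1 := key μ _ ψ hψ hz
  have h2 := key ν _ ψ hψ hz
  rw [h ψ hψ] at h1
  have h3 : ε / (m + 1) * m ≤ ε := by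
    rw [div_mul_eq_mul_div, div_le_iff₀ (by positivity)]
    linarith
  have h4 := abs_sub_le_iff.1 h1
  have h5 := abs_sub_le_iff.1 h2
  have h6 : ε / (m + 1) * m = ε / (m + 1) * μ.real Set.univ + ε / (m + 1) * ν.real Set.univ := by
    ring
  exact abs_sub_le_iff.2 ⟨by linarith, by linarith⟩

theorem integral_withDensity_ofReal {φ g : E → ℝ} (hg : Integrable g) :
    ∫ z, φ z ∂(volume.withDensity fun z => ENNReal.ofReal (g z)) = ∫ z, φ z * max (g z) 0 := by
  rw [integral_withDensity_eq_integral_toReal_smul₀ hg.1.aemeasurable.ennreal_ofReal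
    (ae_of_all _ fun _ => ENNReal.ofReal_lt_top)]
  simp only [ENNReal.toReal_ofReal', smul_eq_mul, mul_comm]

/-- A signed density representing a pushforward of a positive measure is nonnegative, and it is
the density of this pushforward. -/
theorem withDensity_eq_map {g : E → ℝ} (hg : Integrable g) {μ : Measure E} [IsFiniteMeasure μ]
    {Y : E → E} (hY : Measurable Y)
    (h : ∀ φ : E → ℝ, IsTest φ → ∫ z, φ z * g z = ∫ z, φ (Y z) ∂μ) :
    0 ≤ᵐ[volume] g ∧ volume.withDensity (fun z => ENNReal.ofReal (g z)) = μ.map Y := by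
  have hp : IsFiniteMeasure (volume.withDensity fun z => ENNReal.ofReal (g z)) :=
    isFiniteMeasure_withDensity_ofReal hg.2
  have hn : IsFiniteMeasure (volume.withDensity fun z => ENNReal.ofReal (-g z)) :=
    isFiniteMeasure_withDensity_ofReal hg.neg.2
  have hg' : Integrable fun z => -g z := hg.neg
  have hsum : volume.withDensity (fun z => ENNReal.ofReal (g z)) =
      μ.map Y + volume.withDensity fun z => ENNReal.ofReal (-g z) := by
    refine ext_of_forall_isTest fun φ hφ => ?_
    have hc := hφ.smooth.continuous
    obtain ⟨B, hB⟩ := hφ.exists_abs_le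
    rw [integral_add_measure (hc.integrable_of_hasCompactSupport hφ.supp)
      (hc.integrable_of_hasCompactSupport hφ.supp),
      integral_map hY.aemeasurable hc.aestronglyMeasurable, ← h φ hφ,
      integral_withDensity_ofReal hg, integral_withDensity_ofReal (g := fun z => -g z) hg.neg,
      ← integral_add (hc.integrable_mul_of_bounded hB hg)
        (hc.integrable_mul_of_bounded hB hg'.pos_part)]
    congr 1; ext1 z
    rw [← mul_add]
    congr 1
    rcases le_total (g z) 0 with h0 | h0
    · rw [max_eq_right h0]; simp [h0]
    · rw [max_eq_left h0]; simp [h0]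
  have hz : (fun z => ENNReal.ofReal (-g z)) =ᵐ[volume] 0 := by
    obtain ⟨q, hq, hgq⟩ := hg.1
    have hS : MeasurableSet {z | q z < 0} := measurableSet_lt hq.measurable measurable_const
    have h0 : volume.withDensity (fun z => ENNReal.ofReal (g z)) {z | q z < 0} = 0 := by
      rw [withDensity_apply _ hS, lintegral_eq_zero_iff' hg.1.aemeasurable.ennreal_ofReal.restrict]
      filter_upwards [ae_restrict_mem hS, ae_restrict_of_ae hgq] with z hz hz'
      rw [hz']
      exact ENNReal.ofReal_of_nonpos (le_of_lt hz)
    have h1 : volume.withDensity (fun z => ENNReal.ofReal (-g z)) {z | q z < 0} = 0 := by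
      rw [hsum, Measure.add_apply] at h0
      exact (add_eq_zero.1 h0).2
    rw [withDensity_apply _ hS,
      lintegral_eq_zero_iff' hg'.1.aemeasurable.ennreal_ofReal.restrict,
      EventuallyEq, ae_restrict_iff' hS] at h1
    filter_upwards [h1, hgq] with z hz hz'
    by_cases hzS : q z < 0
    · exact hz hzS
    · rw [hz']
      exact ENNReal.ofReal_of_nonpos (neg_nonpos.2 (not_lt.1 hzS))
  refine ⟨?_, by rw [hsum, withDensity_congr_ae hz, withDensity_zero, add_zero]⟩
  filter_upwards [hz] with z hz
  simpa using hz

end Duality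

section Characteristics

set_option linter.unusedSectionVars false

variable {E : Type*} [NormedAddCommGroup E] [InnerProductSpace ℝ E] [FiniteDimensional ℝ E]
  [MeasurableSpace E] [BorelSpace E]

variable {K : E × E → E} {L : ℝ} {f : ℝ → E → ℝ} {b : ℝ}

/-- The flow of the characteristics of the mean field equation with initial measure `μ`. -/
structure IsCharacteristic (K : E × E → E) (μ : Measure E) (b : ℝ) (X : ℝ → E → E) : Prop where
  init : ∀ z, X 0 z = z
  cont : ContinuousOn (Function.uncurry X) (Set.Icc 0 b ×ˢ Set.univ)
  int : ∀ t ∈ Set.Icc 0 b, ∀ x, Integrable (fun z => K (x, X t z)) μ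
  deriv : ∀ z, ∀ t ∈ Set.Icc 0 b,
    HasDerivWithinAt (fun t => X t z) (∫ z', K (X t z, X t z') ∂μ) (Set.Icc 0 b) t

theorem IsCharacteristic.continuous {μ : Measure E} {X : ℝ → E → E} (h : IsCharacteristic K μ b X)
    {t : ℝ} (ht : t ∈ Set.Icc 0 b) : Continuous (X t) := by
  rw [← continuousOn_univ]
  exact h.cont.comp (f := fun z => (t, z)) (by fun_prop) fun z _ => ⟨ht, trivial⟩

theorem IsMeanField.exists_isCharacteristic (H : IsMeanField K L f) (h1 : ∫ z, f 0 z = 1)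
    (h0 : 0 ≤ᵐ[volume] f 0) (hm : Integrable fun z => ‖z‖ * f 0 z) (hb : 0 ≤ b) {μ : Measure E}
    (hμ : μ = volume.withDensity fun z => ENNReal.ofReal (f 0 z)) :
    ∃ X, IsCharacteristic K μ b X ∧
      ∀ t ∈ Set.Icc 0 b, volume.withDensity (fun z => ENNReal.ofReal (f t z)) = μ.map (X t) := by
  have h1' : ∀ t, ∫ z, f t z = 1 := fun t => (H.integral_eq t 0).trans h1
  have hmem : (0 : ℝ) ∈ Set.Icc 0 b := ⟨le_rfl, hb⟩
  obtain ⟨C, hC⟩ := H.exists_tv_bound h1' 0 b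
  have hC0 : 0 ≤ C := (integral_nonneg fun z => abs_nonneg _).trans (hC 0 hmem)
  obtain ⟨M, hM⟩ := H.exists_hasMoment hC h1' hmem hm
  have hV := H.isLipField_meanVel hC0 hC hM
  have hf := H.isTransportSol hC
  obtain ⟨X, hX⟩ := hV.exists_flow hb
  have hK := H.continuous_kernel
  have hfin : IsFiniteMeasure μ := by
    rw [hμ]; exact isFiniteMeasure_withDensity_ofReal (H.int 0).2
  have hmap : ∀ t ∈ Set.Icc 0 b, 0 ≤ᵐ[volume] f t ∧
      volume.withDensity (fun z => ENNReal.ofReal (f t z)) = μ.map (X t) := fun t ht => by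
    have hX' : IsFlow X (fun t => meanVel K (f t)) 0 t (L * C) :=
      ⟨hX.init, fun z τ hτ => (hX.deriv z τ ⟨hτ.1, hτ.2.trans ht.2⟩).mono
        (Set.Icc_subset_Icc_right ht.2), fun τ hτ => hX.lip τ ⟨hτ.1, hτ.2.trans ht.2⟩⟩
    refine withDensity_eq_map (H.int t) (hX.continuous ht).measurable fun φ hφ => ?_
    rw [(hf.mono le_rfl ht.2).integral_eq hX' (hV.mono le_rfl ht.2) ht.1 hφ, hμ,
      integral_withDensity_ofReal (H.int 0)]
    refine integral_congr_ae ?_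
    filter_upwards [h0] with z hz
    rw [max_eq_left (show (0 : ℝ) ≤ f 0 z from hz)]
  have hae : ∀ t ∈ Set.Icc 0 b, ∀ x, (fun z => (ENNReal.ofReal (f t z)).toReal • K (x, z)) =ᵐ[volume]
      fun z => f t z • K (x, z) := fun t ht x => by
    filter_upwards [(hmap t ht).1] with z hz
    rw [ENNReal.toReal_ofReal hz]
  have hint : ∀ t ∈ Set.Icc 0 b, ∀ x, Integrable (fun z => K (x, X t z)) μ := fun t ht x => by
    have h2 := H.integrable_kernel hM ht x
    rw [← integrable_congr (hae t ht x), ← integrable_withDensity_iff_integrable_smul₀'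
      (H.int t).1.aemeasurable.ennreal_ofReal (ae_of_all _ fun _ => ENNReal.ofReal_lt_top),
      (hmap t ht).2, integrable_map_measure (by fun_prop) (hX.continuous ht).aemeasurable] at h2
    exact h2
  refine ⟨X, ⟨hX.init, ?_, hint, fun z t ht => ?_⟩, fun t ht => (hmap t ht).2⟩
  · refine continuousOn_prod_of_continuousOn_lipschitzOnWith' _ (exp (L * C * b)).toNNReal
      (fun t ht => (LipschitzWith.of_dist_le_mul fun x y => ?_).lipschitzOnWith)
      fun x _ t ht => (hX.deriv x t ht).continuousWithinAt
    rw [dist_eq_norm, dist_eq_norm, Real.coe_toNNReal _ (exp_pos _).le]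
    refine (hX.lip t ht x y).trans ?_
    have := hV.nonneg
    have := ht.2
    gcongr
    linarith
  · convert! hX.deriv z t ht using 1
    rw [meanVel, ← integral_congr_ae (hae t ht (X t z)), ← integral_withDensity_eq_integral_toReal_smul₀
      (H.int t).1.aemeasurable.ennreal_ofReal (ae_of_all _ fun _ => ENNReal.ofReal_lt_top),
      (hmap t ht).2, integral_map (hX.continuous ht).aemeasurable (by fun_prop)]

end Characteristics

section LawOfLargeNumbers

set_option linter.unusedSectionVars false

open scoped InnerProductSpace

variable {α F : Type*} [MeasurableSpace α] {μ : Measure α} [IsProbabilityMeasure μ]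
  [NormedAddCommGroup F] [InnerProductSpace ℝ F] [CompleteSpace F] {N : ℕ}
  {G : α → α → F} {h : α → ℝ}

theorem measurePreserving_pi_eval (i : Fin N) :
    MeasurePreserving (fun Z : Fin N → α => Z i) (Measure.pi fun _ => μ) μ :=
  measurePreserving_eval (fun _ => μ) i

theorem integrable_pi_comp_eval {g : α → ℝ} (hg : Integrable g μ) (i : Fin N) :
    Integrable (fun Z : Fin N → α => g (Z i)) (Measure.pi fun _ => μ) :=
  (measurePreserving_pi_eval i).integrable_comp_of_integrable hg

theorem integral_pi_comp_eval {g : α → ℝ} (hg : Integrable g μ) (i : Fin N) :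
    ∫ Z : Fin N → α, g (Z i) ∂(Measure.pi fun _ => μ) = ∫ z, g z ∂μ := by
  have h := (measurePreserving_pi_eval (μ := μ) i).map_eq
  conv_rhs => rw [← h]
  rw [integral_map (measurable_pi_apply i).aemeasurable (by rw [h]; exact hg.1)]

theorem stronglyMeasurable_pi_pair (hG : StronglyMeasurable (Function.uncurry G)) (i j : Fin N) :
    StronglyMeasurable fun Z : Fin N → α => G (Z i) (Z j) :=
  hG.comp_measurable (g := fun Z : Fin N → α => (Z i, Z j))
    ((measurable_pi_apply i).prodMk (measurable_pi_apply j))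

theorem integrable_inner_pair (hG : StronglyMeasurable (Function.uncurry G))
    (hh : ∀ x y, ‖G x y‖ ≤ h y) (h2 : Integrable (fun x => h x ^ 2) μ) (i j k : Fin N) :
    Integrable (fun Z : Fin N → α => ⟪G (Z i) (Z j), G (Z i) (Z k)⟫_ℝ) (Measure.pi fun _ => μ) := by
  refine ((integrable_pi_comp_eval h2 j).add (integrable_pi_comp_eval h2 k)).mono'
    ((stronglyMeasurable_pi_pair hG i j).inner (stronglyMeasurable_pi_pair hG i k)).aestronglyMeasurable
    (ae_of_all _ fun Z => ?_)
  refine (norm_inner_le_norm _ _).trans ?_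
  have h1 := mul_le_mul (hh (Z i) (Z j)) (hh (Z i) (Z k)) (norm_nonneg _)
    ((norm_nonneg _).trans (hh (Z i) (Z j)))
  have h3 := two_mul_le_add_sq (h (Z j)) (h (Z k))
  have h4 := sq_nonneg (h (Z j))
  have h5 := sq_nonneg (h (Z k))
  simp only [Pi.add_apply]
  linarith

theorem integral_inner_pair_eq_zero (hG : StronglyMeasurable (Function.uncurry G))
    (hh : ∀ x y, ‖G x y‖ ≤ h y) (h2 : Integrable (fun x => h x ^ 2) μ)
    (h0 : ∀ x, ∫ y, G x y ∂μ = 0) (hi : ∀ x, Integrable (G x) μ) {i j k : Fin N} (hik : i ≠ k)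
    (hjk : j ≠ k) :
    ∫ Z : Fin N → α, ⟪G (Z i) (Z j), G (Z i) (Z k)⟫_ℝ ∂(Measure.pi fun _ => μ) = 0 := by
  obtain _ | n := N
  · exact k.elim0
  obtain ⟨i, rfl⟩ := Fin.exists_succAbove_eq hik
  obtain ⟨j, rfl⟩ := Fin.exists_succAbove_eq hjk
  have hmp := measurePreserving_piFinSuccAbove (fun _ : Fin (n + 1) => μ) k
  let g : α × (Fin n → α) → ℝ := fun p => ⟪G (p.2 i) (p.2 j), G (p.2 i) p.1⟫_ℝ
  have hg : ∀ Z : Fin (n + 1) → α, ⟪G (Z (k.succAbove i)) (Z (k.succAbove j)), G (Z (k.succAbove i)) (Z k)⟫_ℝ =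
      g (MeasurableEquiv.piFinSuccAbove (fun _ => α) k Z) := fun Z => rfl
  have hint := integrable_inner_pair (μ := μ) hG hh h2 (k.succAbove i) (k.succAbove j) k
  simp only [hg] at hint ⊢
  rw [hmp.integral_comp', integral_prod_symm _ ((hmp.integrable_comp_emb (g := g)
    (MeasurableEquiv.measurableEmbedding _)).1 hint)]
  simp only [g, integral_inner (hi _), h0, inner_zero_right, integral_zero]

/-- The quantitative law of large numbers for an average of conditionally centred variables. -/
theorem integral_norm_average_le (hG : StronglyMeasurable (Function.uncurry G))
    (hh : ∀ x y, ‖G x y‖ ≤ h y) (h2 : Integrable (fun x => h x ^ 2) μ)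
    (h0 : ∀ x, ∫ y, G x y ∂μ = 0) (hi : ∀ x, Integrable (G x) μ) (i : Fin N) :
    Integrable (fun Z : Fin N → α => ‖(N : ℝ)⁻¹ • ∑ j, G (Z i) (Z j)‖) (Measure.pi fun _ => μ) ∧
    ∫ Z : Fin N → α, ‖(N : ℝ)⁻¹ • ∑ j, G (Z i) (Z j)‖ ∂(Measure.pi fun _ => μ) ≤
      √(∫ x, h x ^ 2 ∂μ) / √N := by
  set P : Measure (Fin N → α) := Measure.pi fun _ => μ
  set v := ∫ x, h x ^ 2 ∂μ
  have hN : (0 : ℝ) < N := by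
    have := i.pos
    exact_mod_cast this
  have hm : StronglyMeasurable fun Z : Fin N → α => (N : ℝ)⁻¹ • ∑ j, G (Z i) (Z j) := by
    refine StronglyMeasurable.const_smul ?_ _
    exact Finset.stronglyMeasurable_fun_sum _ fun j _ => stronglyMeasurable_pi_pair hG i j
  have hin := integrable_inner_pair (N := N) (μ := μ) hG hh h2
  have hsq : ∀ Z : Fin N → α, ‖(N : ℝ)⁻¹ • ∑ j, G (Z i) (Z j)‖ ^ 2 =
      ((N : ℝ)⁻¹) ^ 2 * ∑ j, ∑ k, ⟪G (Z i) (Z j), G (Z i) (Z k)⟫_ℝ := fun Z => by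
    rw [norm_smul, mul_pow, ← real_inner_self_eq_norm_sq (∑ j, G (Z i) (Z j)), sum_inner]
    simp only [inner_sum, norm_inv, inv_pow, Real.norm_natCast]
  have hi2 : Integrable (fun Z : Fin N → α => ‖(N : ℝ)⁻¹ • ∑ j, G (Z i) (Z j)‖ ^ 2) P := by
    simp only [hsq]
    exact (integrable_finsetSum _ fun j _ => integrable_finsetSum _ fun k _ => hin i j k).const_mul _
  have hle : ∫ Z, ‖(N : ℝ)⁻¹ • ∑ j, G (Z i) (Z j)‖ ^ 2 ∂P ≤ v / N := by
    simp only [hsq]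
    rw [integral_const_mul, integral_finsetSum _ fun j _ => integrable_finsetSum _ fun k _ => hin i j k]
    have h3 : ∀ j ∈ Finset.univ, ∫ Z, ∑ k, ⟪G (Z i) (Z j), G (Z i) (Z k)⟫_ℝ ∂P ≤ v := fun j _ => by
      rw [integral_finsetSum _ fun k _ => hin i j k, Finset.sum_eq_single j]
      · refine le_of_le_of_eq ?_ (integral_pi_comp_eval h2 j)
        refine integral_mono (hin i j j) (integrable_pi_comp_eval h2 j) fun Z => ?_
        simp only [real_inner_self_eq_norm_sq]
        exact pow_le_pow_left₀ (norm_nonneg _) (hh _ _) 2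
      · intro k _ hkj
        by_cases hik : i = k
        · subst hik
          rw [← integral_inner_pair_eq_zero hG hh h2 h0 hi hkj hkj]
          exact integral_congr_ae (ae_of_all _ fun Z => real_inner_comm _ _)
        · exact integral_inner_pair_eq_zero hG hh h2 h0 hi hik (Ne.symm hkj)
      · simp
    refine (mul_le_mul_of_nonneg_left (Finset.sum_le_sum h3) (by positivity)).trans (le_of_eq ?_)
    rw [Finset.sum_const, Finset.card_univ, Fintype.card_fin, nsmul_eq_mul]
    field_simp
  have hL2 : MemLp (fun Z : Fin N → α => ‖(N : ℝ)⁻¹ • ∑ j, G (Z i) (Z j)‖) 2 P := by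
    rw [memLp_two_iff_integrable_sq_norm hm.norm.aestronglyMeasurable]
    simpa only [norm_norm] using hi2
  refine ⟨hL2.integrable one_le_two, ?_⟩
  have hvar := ProbabilityTheory.variance_nonneg
    (fun Z : Fin N → α => ‖(N : ℝ)⁻¹ • ∑ j, G (Z i) (Z j)‖) P
  rw [ProbabilityTheory.variance_eq_sub hL2] at hvar
  rw [← Real.sqrt_div' _ hN.le]
  refine Real.le_sqrt_of_sq_le (le_trans ?_ hle)
  simp only [Pi.pow_apply] at hvar
  linarith

end LawOfLargeNumbers

section Gronwall

theorem norm_le_integral_of_norm_deriv_le {F : Type*} [NormedAddCommGroup F] [NormedSpace ℝ F]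
    {w w' : ℝ → F} {ρ : ℝ → ℝ} {Λ b : ℝ} (hρ : Continuous ρ) (hb : 0 ≤ b)
    (hw : ∀ t ∈ Set.Icc 0 b, HasDerivWithinAt w (w' t) (Set.Icc 0 b) t) (h0 : w 0 = 0)
    (hle : ∀ t ∈ Set.Icc 0 b, ‖w' t‖ ≤ Λ * ‖w t‖ + ρ t) :
    ‖w b‖ ≤ ∫ s in (0 : ℝ)..b, exp (Λ * (b - s)) * ρ s := by
  have hc : Continuous fun s => exp (-(Λ * s)) * ρ s := by fun_prop
  let I : ℝ → ℝ := fun t => ∫ s in (0 : ℝ)..t, exp (-(Λ * s)) * ρ s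
  have hI : ∀ t, HasDerivAt I (exp (-(Λ * t)) * ρ t) t := fun t =>
    (hc.integral_hasStrictDerivAt 0 t).hasDerivAt
  have key : ∀ ε > 0, ‖w b‖ ≤ exp (Λ * b) * I b + ε * (exp (Λ * b) * (1 + b)) := fun ε hε => by
    have hB : ∀ t, HasDerivAt (fun t => exp (Λ * t) * (I t + ε * (1 + t)))
        (Λ * (exp (Λ * t) * (I t + ε * (1 + t))) + ρ t + exp (Λ * t) * ε) t := fun t => by
      have h1 : HasDerivAt (fun t => exp (Λ * t)) (exp (Λ * t) * Λ) t := by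
        simpa using ((hasDerivAt_id t).const_mul Λ).exp
      have h2 : HasDerivAt (fun t => I t + ε * (1 + t)) (exp (-(Λ * t)) * ρ t + ε) t := by
        exact ((hI t).fun_add (((hasDerivAt_id' t).const_add 1).const_mul ε)).congr_deriv (by ring)
      refine (h1.mul h2).congr_deriv ?_
      have h3 : exp (Λ * t) * exp (-(Λ * t)) = 1 := by rw [← exp_add]; simp
      linear_combination ρ t * h3
    have h4 := image_norm_le_of_norm_deriv_right_lt_deriv_boundary' (f := w) (f' := w') (a := 0) (b := b)
      (fun t ht => (hw t ht).continuousWithinAt)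
      (fun t ht => (hw t ⟨ht.1, ht.2.le⟩).mono_of_mem_nhdsWithin (mem_of_superset
        (Icc_mem_nhdsGE_of_mem ⟨le_rfl, ht.2⟩) (Set.Icc_subset_Icc_left ht.1)))
      (B := fun t => exp (Λ * t) * (I t + ε * (1 + t))) (by simp [h0, I, hε.le])
      (fun t _ => (hB t).continuousAt.continuousWithinAt) (fun t _ => (hB t).hasDerivWithinAt)
      (fun t ht hwt => by
        have h5 := hle t ⟨ht.1, ht.2.le⟩
        rw [hwt] at h5
        have : 0 < exp (Λ * t) * ε := by positivity
        linarith) (Set.right_mem_Icc.2 hb)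
    linarith
  have hE : ∫ s in (0 : ℝ)..b, exp (Λ * (b - s)) * ρ s = exp (Λ * b) * I b := by
    rw [← intervalIntegral.integral_const_mul]
    congr 1; ext1 s
    rw [← mul_assoc, ← exp_add]
    congr 2; ring
  rw [hE]
  refine le_of_forall_pos_le_add fun η hη => ?_
  have hm : 0 < exp (Λ * b) * (1 + b) := by positivity
  have := key (η / (exp (Λ * b) * (1 + b))) (by positivity)
  rwa [div_mul_cancel₀ _ hm.ne'] at this

end Gronwall

section ParticleSystem

set_option linter.unusedSectionVars false

variable {E : Type*} [NormedAddCommGroup E] [InnerProductSpace ℝ E] [FiniteDimensional ℝ E]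
  [MeasurableSpace E] [BorelSpace E]

variable {K : E × E → E} {L : ℝ} {f : ℝ → E → ℝ} {b : ℝ} {N : ℕ}

theorem IsMeanField.norm_kernel_sub_le (H : IsMeanField K L f) (x y x' y' : E) :
    ‖K (x, y) - K (x', y')‖ ≤ L * ‖x - x'‖ + L * ‖y - y'‖ := by
  rw [← sub_add_sub_cancel (K (x, y)) (K (x', y))]
  exact norm_add_le_of_le (H.lip_left x x' y) (H.lip_right y y' x')

theorem IsMeanField.sum_norm_average_sub_le (H : IsMeanField K L f) (x y : Fin N → E) :
    ∑ i, ‖(N : ℝ)⁻¹ • ∑ j, K (x i, x j) - (N : ℝ)⁻¹ • ∑ j, K (y i, y j)‖ ≤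
      2 * L * ∑ i, ‖x i - y i‖ := by
  obtain rfl | hN := N.eq_zero_or_pos
  · simp
  have hN' : (N : ℝ) ≠ 0 := by positivity
  have h1 : ∀ i ∈ Finset.univ, ‖(N : ℝ)⁻¹ • ∑ j, K (x i, x j) - (N : ℝ)⁻¹ • ∑ j, K (y i, y j)‖ ≤
      L * ‖x i - y i‖ + (N : ℝ)⁻¹ * (L * ∑ j, ‖x j - y j‖) := fun i _ => by
    rw [← smul_sub, ← Finset.sum_sub_distrib, norm_smul, norm_inv, Real.norm_natCast]
    calc _ ≤ (N : ℝ)⁻¹ * ∑ j, (L * ‖x i - y i‖ + L * ‖x j - y j‖) := by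
          gcongr
          exact norm_sum_le_of_le _ fun j _ => H.norm_kernel_sub_le _ _ _ _
      _ = _ := by
          rw [Finset.sum_add_distrib, Finset.sum_const, Finset.card_univ, Fintype.card_fin,
            nsmul_eq_mul, ← Finset.mul_sum, mul_add, inv_mul_cancel_left₀ hN']
  refine (Finset.sum_le_sum h1).trans (le_of_eq ?_)
  rw [Finset.sum_add_distrib, Finset.sum_const, Finset.card_univ, Fintype.card_fin, nsmul_eq_mul,
    ← Finset.mul_sum, mul_inv_cancel_left₀ hN']
  ring

/-- Stability of the particle system with respect to perturbations of the velocities. -/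
theorem IsMeanField.sum_norm_sub_le_integral (H : IsMeanField K L f) (hb : 0 ≤ b)
    {z x v : ℝ → Fin N → E} {ρ : ℝ → ℝ} (hρ : Continuous ρ) (h0 : z 0 = x 0)
    (hz : ∀ t, HasDerivAt z (fun i => (N : ℝ)⁻¹ • ∑ j, K (z t i, z t j)) t)
    (hx : ∀ i, ∀ t ∈ Set.Icc 0 b, HasDerivWithinAt (fun t => x t i) (v t i) (Set.Icc 0 b) t)
    (hle : ∀ t ∈ Set.Icc 0 b, ∑ i, ‖(N : ℝ)⁻¹ • ∑ j, K (x t i, x t j) - v t i‖ ≤ ρ t) :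
    ∑ i, ‖z b i - x b i‖ ≤ ∫ s in (0 : ℝ)..b, exp (2 * L * (b - s)) * ρ s := by
  let e := (PiLp.continuousLinearEquiv 1 ℝ fun _ : Fin N => E).symm
  have hd : ∀ t ∈ Set.Icc 0 b, HasDerivWithinAt (fun t => e (z t - x t))
      (e fun i => (N : ℝ)⁻¹ • ∑ j, K (z t i, z t j) - v t i) (Set.Icc 0 b) t := fun t ht =>
    e.hasFDerivAt.comp_hasDerivWithinAt t
      ((hz t).hasDerivWithinAt.sub (hasDerivWithinAt_pi.2 fun i => hx i t ht))
  have hn : ∀ y : Fin N → E, ‖e y‖ = ∑ i, ‖y i‖ := fun y => PiLp.norm_eq_of_L1 _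
  have := norm_le_integral_of_norm_deriv_le hρ hb hd (by simp [h0]) (Λ := 2 * L) fun t ht => by
    rw [hn, hn]
    have h1 : ∀ i ∈ Finset.univ, ‖(N : ℝ)⁻¹ • ∑ j, K (z t i, z t j) - v t i‖ ≤
        ‖(N : ℝ)⁻¹ • ∑ j, K (z t i, z t j) - (N : ℝ)⁻¹ • ∑ j, K (x t i, x t j)‖ +
          ‖(N : ℝ)⁻¹ • ∑ j, K (x t i, x t j) - v t i‖ := fun i _ => norm_sub_le_norm_sub_add_norm_sub ..
    refine (Finset.sum_le_sum h1).trans ?_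
    rw [Finset.sum_add_distrib]
    exact add_le_add (H.sum_norm_average_sub_le _ _) (hle t ht)
  rwa [hn] at this

/-- The particle flow commutes with permutations of the particles. -/
theorem IsMeanField.comp_perm (H : IsMeanField K L f) (hb : 0 ≤ b)
    {T : ℝ → (Fin N → E) → Fin N → E} (hT0 : ∀ Z, T 0 Z = Z)
    (hT : ∀ Z t, HasDerivAt (fun s => T s Z) (fun i => (N : ℝ)⁻¹ • ∑ j, K (T t Z i, T t Z j)) t)
    (Z : Fin N → E) (σ : Equiv.Perm (Fin N)) : T b (Z ∘ σ) = T b Z ∘ σ := by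
  have h := H.sum_norm_sub_le_integral hb (z := fun t => T t (Z ∘ σ)) (x := fun t => T t Z ∘ σ)
    (v := fun t i => (N : ℝ)⁻¹ • ∑ j, K (T t Z (σ i), T t Z j)) (ρ := fun _ => 0)
    continuous_const (by simp [hT0]) (hT _)
    (fun i t _ => (hasDerivAt_pi.1 (hT Z t) (σ i)).hasDerivWithinAt) (fun t _ => le_of_eq ?_)
  · simp only [mul_zero, intervalIntegral.integral_zero] at h
    have h1 := (Finset.sum_eq_zero_iff_of_nonneg fun i _ => norm_nonneg _).1
      (le_antisymm h (Finset.sum_nonneg fun i _ => norm_nonneg _))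
    ext1 i
    exact sub_eq_zero.1 (norm_eq_zero.1 (h1 i (Finset.mem_univ i)))
  · refine Finset.sum_eq_zero fun i _ => ?_
    rw [norm_eq_zero, sub_eq_zero]
    congr 1
    exact Equiv.sum_comp σ fun j => K (T t Z (σ i), T t Z j)

end ParticleSystem

section Fluctuation

set_option linter.unusedSectionVars false

variable {E : Type*} [NormedAddCommGroup E] [InnerProductSpace ℝ E] [FiniteDimensional ℝ E]
  [MeasurableSpace E] [BorelSpace E]

variable {K : E × E → E} {L : ℝ} {f : ℝ → E → ℝ} {b : ℝ} {N : ℕ} {μ : Measure E}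
  [IsProbabilityMeasure μ] {X : ℝ → E → E}

theorem IsCharacteristic.norm_velocity_sub_le (hX : IsCharacteristic K μ b X)
    (H : IsMeanField K L f) {t : ℝ} (ht : t ∈ Set.Icc 0 b) (x y : E) :
    ‖∫ z, K (x, X t z) ∂μ - ∫ z, K (y, X t z) ∂μ‖ ≤ L * ‖x - y‖ := by
  rw [← integral_sub (hX.int t ht x) (hX.int t ht y)]
  refine (norm_integral_le_of_norm_le (integrable_const (L * ‖x - y‖))
    (ae_of_all _ fun z => H.lip_left x y _)).trans (le_of_eq ?_)
  simp

theorem IsCharacteristic.norm_sub_le (hX : IsCharacteristic K μ b X) (H : IsMeanField K L f)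
    {t : ℝ} (ht : t ∈ Set.Icc 0 b) (z z' : E) :
    ‖X t z - X t z'‖ ≤ exp (L * t) * ‖z - z'‖ := by
  have hW : ∀ s ∈ Set.Ico 0 b, LipschitzOnWith L.toNNReal (fun x => ∫ y, K (x, X s y) ∂μ)
      Set.univ := fun s hs => (LipschitzWith.of_dist_le_mul fun x y => by
        rw [dist_eq_norm, dist_eq_norm, Real.coe_toNNReal _ H.nonneg]
        exact hX.norm_velocity_sub_le H ⟨hs.1, hs.2.le⟩ x y).lipschitzOnWith
  have := dist_le_of_trajectories_ODE_of_mem (v := fun s x => ∫ y, K (x, X s y) ∂μ)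
    (s := fun _ => Set.univ) (f := fun t => X t z) (g := fun t => X t z') (δ := ‖z - z'‖) hW
    (fun t ht => (hX.deriv z t ht).continuousWithinAt)
    (fun t ht => (hX.deriv z t ⟨ht.1, ht.2.le⟩).Ici_of_Icc ht) (fun t ht => trivial)
    (fun t ht => (hX.deriv z' t ht).continuousWithinAt)
    (fun t ht => (hX.deriv z' t ⟨ht.1, ht.2.le⟩).Ici_of_Icc ht) (fun t ht => trivial)
    (by rw [hX.init, hX.init, dist_eq_norm]) t ht
  rw [Real.coe_toNNReal _ H.nonneg, dist_eq_norm] at this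
  rw [sub_zero] at this
  linarith

theorem IsCharacteristic.isLipField (hX : IsCharacteristic K μ b X) (H : IsMeanField K L f)
    (hm : Integrable (fun z => ‖z‖) μ) :
    IsLipField (fun s x => ∫ z, K (x, X s z) ∂μ) 0 b L := by
  refine ⟨H.nonneg, fun t ht => hX.norm_velocity_sub_le H ht, fun x => ?_⟩
  have hc : ∀ z, ContinuousOn (fun t => X t z) (Set.Icc 0 b) := fun z t ht =>
    (hX.deriv z t ht).continuousWithinAt
  obtain ⟨M, hM⟩ := isCompact_Icc.exists_bound_of_continuousOn (hc 0)
  refine continuousOn_of_dominated (bound := fun z => L * (‖x‖ + (exp (L * b) * ‖z‖ + M)))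
    (fun t ht => (hX.int t ht x).1) (fun t ht => ae_of_all _ fun z => ?_) ?_
    (ae_of_all _ fun z => H.continuous_kernel.comp_continuousOn (continuousOn_const.prodMk (hc z)))
  · refine (H.norm_kernel_le x _).trans ?_
    have hL := H.nonneg
    gcongr
    refine (_root_.norm_sub_le _ _).trans ?_
    gcongr
    have h1 := hX.norm_sub_le H ht z 0
    have h2 := hM t ht
    rw [sub_zero] at h1
    have h3 := norm_le_norm_add_norm_sub (X t 0) (X t z)
    rw [norm_sub_rev] at h3
    have h4 : exp (L * t) * ‖z‖ ≤ exp (L * b) * ‖z‖ := by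
      gcongr; exact ht.2
    linarith
  · exact ((integrable_const _).add ((hm.const_mul _).add (integrable_const _))).const_mul _

/-- The centred interaction along the characteristics. -/
def fluctuation (K : E × E → E) (μ : Measure E) (X : ℝ → E → E) (s : ℝ) (x y : E) : E :=
  K (X s x, X s y) - ∫ z, K (X s x, X s z) ∂μ

theorem IsCharacteristic.continuousOn_fluctuation (hX : IsCharacteristic K μ b X)
    (H : IsMeanField K L f) (hm : Integrable (fun z => ‖z‖) μ) :
    ContinuousOn (fun p : ℝ × E × E => fluctuation K μ X p.1 p.2.1 p.2.2)
      (Set.Icc 0 b ×ˢ Set.univ) := by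
  have h1 : ContinuousOn (fun p : ℝ × E × E => X p.1 p.2.1) (Set.Icc 0 b ×ˢ Set.univ) :=
    hX.cont.comp (f := fun p : ℝ × E × E => (p.1, p.2.1)) (by fun_prop) fun p hp => ⟨hp.1, trivial⟩
  have h2 : ContinuousOn (fun p : ℝ × E × E => X p.1 p.2.2) (Set.Icc 0 b ×ˢ Set.univ) :=
    hX.cont.comp (f := fun p : ℝ × E × E => (p.1, p.2.2)) (by fun_prop) fun p hp => ⟨hp.1, trivial⟩
  refine (H.continuous_kernel.comp_continuousOn (h1.prodMk h2)).sub ?_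
  exact (hX.isLipField H hm).continuousOn_uncurry.comp
    (f := fun p : ℝ × E × E => (p.1, X p.1 p.2.1)) (continuousOn_fst.prodMk h1)
    fun p hp => ⟨hp.1, trivial⟩

theorem IsCharacteristic.integrable_fluctuation (hX : IsCharacteristic K μ b X) {s : ℝ}
    (hs : s ∈ Set.Icc 0 b) (x : E) : Integrable (fluctuation K μ X s x) μ :=
  (hX.int s hs _).sub (integrable_const _)

theorem IsCharacteristic.integral_fluctuation (hX : IsCharacteristic K μ b X) {s : ℝ}
    (hs : s ∈ Set.Icc 0 b) (x : E) : ∫ y, fluctuation K μ X s x y ∂μ = 0 := by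
  simp only [fluctuation]
  rw [integral_sub (hX.int s hs _) (integrable_const _)]
  simp

theorem IsCharacteristic.norm_fluctuation_le (hX : IsCharacteristic K μ b X)
    (H : IsMeanField K L f) (hm : Integrable (fun z => ‖z‖) μ) {s : ℝ} (hs : s ∈ Set.Icc 0 b)
    (x y : E) :
    ‖fluctuation K μ X s x y‖ ≤ L * exp (L * s) * (‖y‖ + ∫ z, ‖z‖ ∂μ) := by
  have h1 : fluctuation K μ X s x y = ∫ z, (K (X s x, X s y) - K (X s x, X s z)) ∂μ := by
    rw [integral_sub (integrable_const _) (hX.int s hs _)]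
    simp [fluctuation]
  have h2 : ∫ z, L * exp (L * s) * (‖y‖ + ‖z‖) ∂μ = L * exp (L * s) * (‖y‖ + ∫ z, ‖z‖ ∂μ) := by
    rw [integral_const_mul, integral_add (integrable_const _) hm]
    simp
  rw [h1, ← h2]
  refine norm_integral_le_of_norm_le (((integrable_const _).add hm).const_mul _)
    (ae_of_all _ fun z => ?_)
  refine (H.lip_right _ _ _).trans ?_
  rw [mul_assoc]
  have hL := H.nonneg
  gcongr
  refine (hX.norm_sub_le H hs y z).trans ?_
  gcongr
  exact _root_.norm_sub_le _ _

theorem IsCharacteristic.integral_norm_average_fluctuation_le (hX : IsCharacteristic K μ b X)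
    (H : IsMeanField K L f) (h2 : Integrable (fun z => ‖z‖ ^ 2) μ) {s : ℝ}
    (hs : s ∈ Set.Icc 0 b) (i : Fin N) :
    Integrable (fun Z : Fin N → E => ‖(N : ℝ)⁻¹ • ∑ j, fluctuation K μ X s (Z i) (Z j)‖)
      (Measure.pi fun _ => μ) ∧
    ∫ Z : Fin N → E, ‖(N : ℝ)⁻¹ • ∑ j, fluctuation K μ X s (Z i) (Z j)‖ ∂(Measure.pi fun _ => μ) ≤
      L * exp (L * s) * (2 * √(∫ z, ‖z‖ ^ 2 ∂μ) / √N) := by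
  have hL2 : MemLp (fun z : E => ‖z‖) 2 μ := by
    rw [memLp_two_iff_integrable_sq_norm continuous_norm.aestronglyMeasurable]
    simpa only [norm_norm] using h2
  have hm := hL2.integrable one_le_two
  have hvar := ProbabilityTheory.variance_nonneg (fun z : E => ‖z‖) μ
  rw [ProbabilityTheory.variance_eq_sub hL2] at hvar
  simp only [Pi.pow_apply] at hvar
  set m := ∫ z, ‖z‖ ∂μ
  set q := ∫ z, ‖z‖ ^ 2 ∂μ
  have hA : 0 ≤ L * exp (L * s) := mul_nonneg H.nonneg (exp_pos _).le
  have hexp : ∀ y : E, (L * exp (L * s) * (‖y‖ + m)) ^ 2 =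
      (L * exp (L * s)) ^ 2 * (‖y‖ ^ 2 + (2 * m * ‖y‖ + m ^ 2)) := fun y => by ring
  have hi : Integrable (fun y : E => (L * exp (L * s) * (‖y‖ + m)) ^ 2) μ := by
    simp only [hexp]
    exact (h2.add ((hm.const_mul _).add (integrable_const _))).const_mul _
  have hc : Continuous (Function.uncurry (fluctuation K μ X s)) := by
    rw [← continuousOn_univ]
    exact (hX.continuousOn_fluctuation H hm).comp (f := fun p : E × E => (s, p))
      (by fun_prop) fun p _ => ⟨hs, trivial⟩
  obtain ⟨h3, h4⟩ := integral_norm_average_le (μ := μ) (G := fluctuation K μ X s)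
    (h := fun y => L * exp (L * s) * (‖y‖ + m)) hc.stronglyMeasurable
    (fun x y => hX.norm_fluctuation_le H hm hs x y) hi (hX.integral_fluctuation hs)
    (hX.integrable_fluctuation hs) i
  refine ⟨h3, h4.trans ?_⟩
  rw [← mul_div_assoc]
  gcongr
  refine Real.sqrt_le_iff.2 ⟨by positivity, ?_⟩
  simp only [hexp]
  have hi1 : Integrable (fun y : E => 2 * m * ‖y‖ + m ^ 2) μ :=
    (hm.const_mul _).add (integrable_const _)
  rw [integral_const_mul, integral_add h2 hi1,
    integral_add (hm.const_mul _) (integrable_const _), integral_const_mul, mul_pow _ (2 * √q), mul_pow 2,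
    Real.sq_sqrt (integral_nonneg fun z => by positivity)]
  refine mul_le_mul_of_nonneg_left ?_ (sq_nonneg _)
  simp only [integral_const, probReal_univ, smul_eq_mul, one_mul]
  have h5 : 2 * m * m = 2 * m ^ 2 := by ring
  change q + (2 * m * m + m ^ 2) ≤ 2 ^ 2 * q
  linarith

end Fluctuation

section Coupling

set_option linter.unusedSectionVars false

theorem integral_mul_exp_le {L b : ℝ} :
    ∫ s in (0 : ℝ)..b, exp (2 * L * (b - s)) * (L * exp (L * s)) ≤ exp (2 * L * b) := by
  have hd : ∀ s ∈ Set.uIcc 0 b, HasDerivAt (fun s => -exp (L * (2 * b - s)))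
      (exp (2 * L * (b - s)) * (L * exp (L * s))) s := fun s _ => by
    have := ((((hasDerivAt_id' s).const_sub (2 * b)).const_mul L).exp).fun_neg
    refine this.congr_deriv ?_
    have h1 : exp (L * (2 * b - s)) = exp (2 * L * (b - s)) * exp (L * s) := by
      rw [← exp_add]; ring_nf
    rw [h1]
    ring
  rw [intervalIntegral.integral_eq_sub_of_hasDerivAt hd
    (Continuous.intervalIntegrable (by fun_prop) _ _)]
  have h1 : L * (2 * b - 0) = 2 * L * b := by ring
  have h2 := exp_pos (L * (2 * b - b))
  rw [h1]
  linarith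

variable {E : Type*} [NormedAddCommGroup E] [InnerProductSpace ℝ E] [FiniteDimensional ℝ E]
  [MeasurableSpace E] [BorelSpace E]

variable {K : E × E → E} {L : ℝ} {f : ℝ → E → ℝ} {b : ℝ} {N : ℕ} {μ : Measure E}
  [IsProbabilityMeasure μ] {X : ℝ → E → E} {T : ℝ → (Fin N → E) → Fin N → E}

theorem IsMeanField.lintegral_sum_norm_sub_le (H : IsMeanField K L f)
    (hX : IsCharacteristic K μ b X) (h2 : Integrable (fun z => ‖z‖ ^ 2) μ) (hb : 0 ≤ b)
    (hT0 : ∀ Z, T 0 Z = Z)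
    (hT : ∀ Z t, HasDerivAt (fun s => T s Z) (fun i => (N : ℝ)⁻¹ • ∑ j, K (T t Z i, T t Z j)) t) :
    ∫⁻ Z : Fin N → E, ENNReal.ofReal (∑ i, ‖T b Z i - X b (Z i)‖) ∂(Measure.pi fun _ => μ) ≤
      ENNReal.ofReal (N * (2 * √(∫ z, ‖z‖ ^ 2 ∂μ) / √N) * exp (2 * L * b)) := by
  set P : Measure (Fin N → E) := Measure.pi fun _ => μ
  set c : ℝ := 2 * √(∫ z, ‖z‖ ^ 2 ∂μ) / √N
  have hL := H.nonneg
  have hm : Integrable (fun z : E => ‖z‖) μ := by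
    refine MemLp.integrable one_le_two ((memLp_two_iff_integrable_sq_norm
      continuous_norm.aestronglyMeasurable).2 ?_)
    simpa only [norm_norm] using h2
  let r : ℝ → (Fin N → E) → ℝ := fun s Z =>
    ∑ i, ‖(N : ℝ)⁻¹ • ∑ j, fluctuation K μ X (Set.projIcc 0 b hb s) (Z i) (Z j)‖
  have hrc : Continuous (Function.uncurry r) := by
    have h3 : ∀ i j, Continuous fun p : ℝ × (Fin N → E) =>
        fluctuation K μ X (Set.projIcc 0 b hb p.1) (p.2 i) (p.2 j) := fun i j => by
      rw [← continuousOn_univ]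
      refine (hX.continuousOn_fluctuation H hm).comp
        (f := fun p : ℝ × (Fin N → E) => ((Set.projIcc 0 b hb p.1 : ℝ), p.2 i, p.2 j)) ?_
        fun p _ => ⟨(Set.projIcc 0 b hb p.1).2, trivial⟩
      have := continuous_projIcc (h := hb)
      fun_prop
    exact continuous_finsetSum _ fun i _ =>
      ((continuous_finsetSum _ fun j _ => h3 i j).const_smul _).norm
  have hrs : ∀ Z, Continuous fun s => r s Z := fun Z => hrc.uncurry_right Z
  have hr0 : ∀ s Z, 0 ≤ r s Z := fun s Z => Finset.sum_nonneg fun i _ => norm_nonneg _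
  have hpt : ∀ Z, ∑ i, ‖T b Z i - X b (Z i)‖ ≤ ∫ s in (0 : ℝ)..b, exp (2 * L * (b - s)) * r s Z :=
    fun Z => by
      refine H.sum_norm_sub_le_integral hb (z := fun t => T t Z) (x := fun t i => X t (Z i))
        (v := fun t i => ∫ z, K (X t (Z i), X t z) ∂μ) (hrs Z)
        (by ext1 i; rw [hT0, hX.init]) (hT Z) (fun i t ht => hX.deriv (Z i) t ht) fun t ht => ?_
      refine Finset.sum_le_sum fun i _ => le_of_eq ?_
      have hN : (N : ℝ) ≠ 0 := by
        have := i.pos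
        positivity
      simp only [fluctuation, Set.projIcc_of_mem hb ht]
      rw [Finset.sum_sub_distrib, smul_sub, Finset.sum_const, Finset.card_univ, Fintype.card_fin,
        ← Nat.cast_smul_eq_nsmul ℝ, inv_smul_smul₀ hN]
  have hrm : ∀ s ∈ Set.Ioc 0 b, ∫⁻ Z, ENNReal.ofReal (exp (2 * L * (b - s)) * r s Z) ∂P ≤
      ENNReal.ofReal (exp (2 * L * (b - s)) * (L * exp (L * s)) * (N * c)) := fun s hs => by
    have hs' : s ∈ Set.Icc 0 b := ⟨hs.1.le, hs.2⟩
    have h4 := fun i : Fin N => hX.integral_norm_average_fluctuation_le (N := N) H h2 hs' i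
    have hi : Integrable (r s) P := by
      simp only [r, Set.projIcc_of_mem hb hs']
      exact integrable_finsetSum _ fun i _ => (h4 i).1
    rw [← ofReal_integral_eq_lintegral_ofReal (hi.const_mul _)
      (ae_of_all _ fun Z => mul_nonneg (exp_pos _).le (hr0 s Z)), integral_const_mul, mul_assoc (exp _)]
    refine ENNReal.ofReal_le_ofReal (mul_le_mul_of_nonneg_left ?_ (exp_pos _).le)
    simp only [r, Set.projIcc_of_mem hb hs']
    rw [integral_finsetSum _ fun i _ => (h4 i).1]
    refine (Finset.sum_le_sum fun i _ => (h4 i).2).trans (le_of_eq ?_)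
    rw [Finset.sum_const, Finset.card_univ, Fintype.card_fin, nsmul_eq_mul]
    ring
  have hc0 : 0 ≤ N * c := by positivity
  clear_value r c
  have hec : Continuous fun s => exp (2 * L * (b - s)) := by fun_prop
  have hgc : Continuous fun p : (Fin N → E) × ℝ =>
      ENNReal.ofReal (exp (2 * L * (b - p.2)) * r p.2 p.1) :=
    ENNReal.continuous_ofReal.comp ((hec.comp continuous_snd).mul (hrc.comp continuous_swap))
  have hpt' : ∀ Z, ENNReal.ofReal (∑ i, ‖T b Z i - X b (Z i)‖) ≤
      ∫⁻ s in Set.Ioc 0 b, ENNReal.ofReal (exp (2 * L * (b - s)) * r s Z) := fun Z => by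
    have hcont : Continuous fun s => exp (2 * L * (b - s)) * r s Z := hec.mul (hrs Z)
    rw [← ofReal_integral_eq_lintegral_ofReal
      ((hcont.integrableOn_Icc (a := 0) (b := b)).mono_set Set.Ioc_subset_Icc_self)
      (ae_of_all _ fun s => mul_nonneg (exp_pos _).le (hr0 s Z)),
      ← intervalIntegral.integral_of_le hb]
    exact ENNReal.ofReal_le_ofReal (hpt Z)
  calc _ ≤ ∫⁻ Z, (∫⁻ s in Set.Ioc 0 b, ENNReal.ofReal (exp (2 * L * (b - s)) * r s Z)) ∂P :=
        lintegral_mono hpt'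
    _ = ∫⁻ s in Set.Ioc 0 b, (∫⁻ Z, ENNReal.ofReal (exp (2 * L * (b - s)) * r s Z) ∂P) :=
        lintegral_lintegral_swap hgc.measurable.aemeasurable
    _ ≤ ∫⁻ s in Set.Ioc 0 b,
          ENNReal.ofReal (exp (2 * L * (b - s)) * (L * exp (L * s)) * (N * c)) :=
        setLIntegral_mono' measurableSet_Ioc hrm
    _ ≤ _ := by
        have hcont : Continuous fun s =>
            exp (2 * L * (b - s)) * (L * exp (L * s)) * (N * c) := by fun_prop
        rw [← ofReal_integral_eq_lintegral_ofReal
          ((hcont.integrableOn_Icc (a := 0) (b := b)).mono_set Set.Ioc_subset_Icc_self)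
          (ae_of_all _ fun s => by positivity),
          ← intervalIntegral.integral_of_le hb, intervalIntegral.integral_mul_const, mul_comm]
        gcongr
        exact integral_mul_exp_le

/-- Mean distance between one particle and the corresponding characteristic. -/
theorem IsMeanField.lintegral_enorm_sub_le (H : IsMeanField K L f)
    (hX : IsCharacteristic K μ b X) (h2 : Integrable (fun z => ‖z‖ ^ 2) μ) (hb : 0 ≤ b)
    (hTm : Measurable (T b)) (hT0 : ∀ Z, T 0 Z = Z)
    (hT : ∀ Z t, HasDerivAt (fun s => T s Z) (fun i => (N : ℝ)⁻¹ • ∑ j, K (T t Z i, T t Z j)) t)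
    (i : Fin N) :
    ∫⁻ Z : Fin N → E, edist (T b Z i) (X b (Z i)) ∂(Measure.pi fun _ => μ) ≤
      ENNReal.ofReal (2 * √(∫ z, ‖z‖ ^ 2 ∂μ) / √N * exp (2 * L * b)) := by
  set c : ℝ := 2 * √(∫ z, ‖z‖ ^ 2 ∂μ) / √N
  have hXc := hX.continuous (t := b) ⟨hb, le_rfl⟩
  have hmeas : ∀ j, Measurable fun Z : Fin N → E => edist (T b Z j) (X b (Z j)) := fun j =>
    ((measurable_pi_apply j).comp hTm).edist (hXc.measurable.comp (measurable_pi_apply j))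
  have hex : ∀ j, ∫⁻ Z : Fin N → E, edist (T b Z j) (X b (Z j)) ∂(Measure.pi fun _ => μ) =
      ∫⁻ Z : Fin N → E, edist (T b Z i) (X b (Z i)) ∂(Measure.pi fun _ => μ) := fun j => by
    let σ : Equiv.Perm (Fin N) := Equiv.swap i j
    have hp := measurePreserving_piCongrLeft (fun _ : Fin N => μ) σ
    have he : ∀ Z : Fin N → E, MeasurableEquiv.piCongrLeft (fun _ => E) σ Z = Z ∘ σ := fun Z => by
      ext1 k
      obtain ⟨k, rfl⟩ := σ.surjective k
      simp [σ, MeasurableEquiv.coe_piCongrLeft, Equiv.piCongrLeft_apply_apply]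
    rw [← hp.lintegral_comp (hmeas i)]
    refine lintegral_congr fun Z => ?_
    rw [he, H.comp_perm hb hT0 hT]
    simp [σ]
  have hN : (0 : ℝ) < N := by
    have := i.pos
    exact_mod_cast this
  have h3 := H.lintegral_sum_norm_sub_le hX h2 hb hT0 hT
  have h4 : ∀ Z : Fin N → E, ENNReal.ofReal (∑ j, ‖T b Z j - X b (Z j)‖) =
      ∑ j, edist (T b Z j) (X b (Z j)) := fun Z => by
    rw [ENNReal.ofReal_sum_of_nonneg fun j _ => norm_nonneg _]
    simp only [edist_dist, dist_eq_norm]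
  simp only [h4] at h3
  rw [lintegral_finsetSum _ fun j _ => hmeas j, Finset.sum_congr rfl fun j _ => hex j,
    Finset.sum_const, Finset.card_univ, Fintype.card_fin, nsmul_eq_mul, mul_assoc,
    ENNReal.ofReal_mul hN.le, ENNReal.ofReal_natCast] at h3
  exact (ENNReal.mul_le_mul_iff_right (by simpa using hN.ne') (by simp)).1 h3

end Coupling

section MeanFieldCoupling

set_option linter.unusedSectionVars false

variable {E : Type*} [NormedAddCommGroup E] [InnerProductSpace ℝ E] [FiniteDimensional ℝ E]
  [MeasurableSpace E] [BorelSpace E]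

variable {K : E × E → E} {L : ℝ} {f : ℝ → E → ℝ} {b : ℝ} {N : ℕ} {μ : Measure E}
  [IsProbabilityMeasure μ] {T : ℝ → (Fin N → E) → Fin N → E}

/-- The first marginal of the particle system is coupled with the mean field solution. -/
theorem IsMeanField.exists_coupling (H : IsMeanField K L f) (h1 : ∫ z, f 0 z = 1)
    (h0 : 0 ≤ᵐ[volume] f 0) (hm : Integrable fun z => ‖z‖ * f 0 z)
    (hμ : μ = volume.withDensity fun z => ENNReal.ofReal (f 0 z))
    (h2 : Integrable (fun z => ‖z‖ ^ 2) μ) (hb : 0 ≤ b)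
    (hTm : Measurable (T b)) (hT0 : ∀ Z, T 0 Z = Z)
    (hT : ∀ Z t, HasDerivAt (fun s => T s Z) (fun i => (N : ℝ)⁻¹ • ∑ j, K (T t Z i, T t Z j)) t)
    (i : Fin N) :
    ∃ γ : Measure (E × E),
      γ.map Prod.fst = ((Measure.pi fun _ : Fin N => μ).map (T b)).map (fun Z => Z i) ∧
      γ.map Prod.snd = volume.withDensity (fun z => ENNReal.ofReal (f b z)) ∧
      ∫⁻ p, edist p.1 p.2 ∂γ ≤
        ENNReal.ofReal (2 * √(∫ z, ‖z‖ ^ 2 ∂μ) / √N * exp (2 * L * b)) := by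
  obtain ⟨X, hX, hmap⟩ := H.exists_isCharacteristic h1 h0 hm hb hμ
  have hbm : b ∈ Set.Icc 0 b := ⟨hb, le_rfl⟩
  have hTi : Measurable fun Z : Fin N → E => T b Z i := (measurable_pi_apply i).comp hTm
  have hXb := (hX.continuous hbm).measurable
  have hXi : Measurable fun Z : Fin N → E => X b (Z i) := hXb.comp (measurable_pi_apply i)
  refine ⟨(Measure.pi fun _ : Fin N => μ).map fun Z => (T b Z i, X b (Z i)), ?_, ?_, ?_⟩
  · rw [Measure.map_map measurable_fst (hTi.prodMk hXi),
      Measure.map_map (measurable_pi_apply i) hTm]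
    rfl
  · have he := congrArg (Measure.map (X b)) (measurePreserving_pi_eval (N := N) (μ := μ) i).map_eq
    rw [Measure.map_map hXb (measurable_pi_apply i)] at he
    rw [hmap b hbm, ← he, Measure.map_map measurable_snd (hTi.prodMk hXi)]
    rfl
  · rw [lintegral_map (measurable_fst.edist measurable_snd) (hTi.prodMk hXi)]
    exact H.lintegral_enorm_sub_le hX h2 hb hTm hT0 hT i

end MeanFieldCoupling

section Rate

theorem two_mul_sqrt_div_sqrt_mul_exp_le {a m L t : ℝ} {N d : ℕ} (hN : 1 ≤ N) (hm : m ≤ 1 + a) :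
    2 * √m / √N * exp (2 * L * t) ≤
      (2 * √(1 + a) + 1) * exp (2 * L * t) / (N : ℝ) ^ ((1 : ℝ) / (d + 4)) := by
  have hN1 : (1 : ℝ) ≤ N := by exact_mod_cast hN
  have hd : (1 : ℝ) / (d + 4) ≤ 1 / 2 := by
    gcongr
    have := (Nat.cast_nonneg d : (0 : ℝ) ≤ d)
    linarith
  have h1 : (N : ℝ) ^ ((1 : ℝ) / (d + 4)) ≤ √N := by
    rw [Real.sqrt_eq_rpow]
    exact Real.rpow_le_rpow_of_exponent_le hN1 hd
  have h2 : 0 < (N : ℝ) ^ ((1 : ℝ) / (d + 4)) := by positivity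
  rw [div_mul_eq_mul_div]
  gcongr
  have := Real.sqrt_le_sqrt hm
  linarith

end Rate

end AuxiliaryResults

/-- quantitative propagation of chaos for the first marginal:
there is a constant `C(a,d) > 0` depending only on `a` and `d` such that, for
every interaction kernel satisfying (HK1)-(HK2) with constant `L`, every initial
probability density `fin` with `∫|z|^{d+5} fin(z) dz = a` and every `t`, `N`,
`dist_{MK,1}(P_{N:1}(t), f(t,·)·Leb) ≤ C(a,d) e^{2L|t|}/N^{1/(d+4)}`, where
`P_N(t) = T_t#(fin·Leb)^{⊗N}` and `f` solves the mean field PDE with data `fin`. -/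
theorem stmt16 (d : ℕ) (a : ℝ) :
    ∃ C : ℝ, 0 < C ∧
    ∀ (L : ℝ), 0 ≤ L →
    ∀ (K : EuclideanSpace ℝ (Fin d) × EuclideanSpace ℝ (Fin d) →
        EuclideanSpace ℝ (Fin d)),
      ContDiff ℝ 1 K →
      (∀ z z' : EuclideanSpace ℝ (Fin d), K (z, z') = - K (z', z)) →
      (∀ z z' : EuclideanSpace ℝ (Fin d), ‖fderiv ℝ (fun w => K (w, z')) z‖ ≤ L) →
      (∀ z z' : EuclideanSpace ℝ (Fin d), ‖fderiv ℝ (fun w => K (z, w)) z'‖ ≤ L) →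
    ∀ fin : EuclideanSpace ℝ (Fin d) → ℝ,
      (∀ z, 0 ≤ fin z) → Integrable fin → (∫ z, fin z = 1) →
      Integrable (fun z => ‖z‖ ^ (d + 5) * fin z) →
      (∫ z, ‖z‖ ^ (d + 5) * fin z = a) →
    ∀ T : (N : ℕ) → ℝ → (Fin N → EuclideanSpace ℝ (Fin d)) →
        (Fin N → EuclideanSpace ℝ (Fin d)),
      (∀ N t, Measurable (T N t)) → (∀ N Z, T N 0 Z = Z) →
      (∀ N : ℕ, 1 ≤ N → ∀ Z t, HasDerivAt (fun s => T N s Z)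
        (fun i => (N : ℝ)⁻¹ • ∑ j : Fin N, K (T N t Z i, T N t Z j)) t) →
    ∀ f : ℝ → EuclideanSpace ℝ (Fin d) → ℝ,
      (∀ t, Integrable (f t)) →
      (f 0 =ᵐ[(volume : Measure (EuclideanSpace ℝ (Fin d)))] fin) →
      IsWeakMeanFieldSol K f →
    ∀ t : ℝ, ∀ N : ℕ, ∀ hN : 1 ≤ N,
      distMK1
        (Measure.map (fun Z : Fin N → EuclideanSpace ℝ (Fin d) => Z ⟨0, hN⟩)
          (Measure.map (T N t) (Measure.pi (fun _ : Fin N => densMeasure fin))))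
        (densMeasure (f t)) ≤
        ENNReal.ofReal (C * Real.exp (2 * L * |t|) / (N : ℝ) ^ ((1 : ℝ) / (d + 4))) := by
  refine ⟨2 * √(1 + a) + 1, by positivity, ?_⟩
  intro L hL K hK hanti hKl _ fin hfin hfi hf1 hmi hma T hTm hT0 hT f hf hf0 hsol t N hN
  have H : IsMeanField K L f := ⟨hL, hK, hanti, fun x y z => by
    have hd : Differentiable ℝ fun w => K (w, z) :=
      (hK.differentiable one_ne_zero).comp (by fun_prop)
    exact convex_univ.norm_image_sub_le_of_norm_fderiv_le (𝕜 := ℝ) (fun w _ => hd w)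
      (fun w _ => hKl w z) trivial trivial, hf, hsol⟩
  have hpow : ∀ z : EuclideanSpace ℝ (Fin d), ∀ k, k ≤ d + 5 → ‖z‖ ^ k ≤ 1 + ‖z‖ ^ (d + 5) :=
    fun z k hk => by
      obtain h | h := le_total ‖z‖ 1
      · have := pow_le_one₀ (n := k) (norm_nonneg z) h
        have : 0 ≤ ‖z‖ ^ (d + 5) := by positivity
        linarith
      · have := pow_le_pow_right₀ h hk
        linarith
  have hki : ∀ k ≤ d + 5, Integrable fun z => ‖z‖ ^ k * fin z := fun k hk =>
    (hfi.add hmi).mono' ((by fun_prop : Continuous fun z : EuclideanSpace ℝ (Fin d) =>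
      ‖z‖ ^ k).aestronglyMeasurable.mul hfi.1) (ae_of_all _ fun z => by
        rw [norm_mul, norm_pow, norm_norm, Real.norm_of_nonneg (hfin z), Pi.add_apply,
          ← one_add_mul]
        exact mul_le_mul_of_nonneg_right (hpow z k hk) (hfin z))
  have hμ : densMeasure fin = volume.withDensity fun z => ENNReal.ofReal (f 0 z) :=
    withDensity_congr_ae (hf0.mono fun z hz => by simp only [hz])
  have hprob : IsProbabilityMeasure (densMeasure fin) := ⟨by
    rw [densMeasure, withDensity_apply _ MeasurableSet.univ, Measure.restrict_univ,
      ← ofReal_integral_eq_lintegral_ofReal hfi (ae_of_all _ hfin), hf1, ENNReal.ofReal_one]⟩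
  have h1 : ∫ z, f 0 z = 1 := (integral_congr_ae hf0).trans hf1
  have h0 : 0 ≤ᵐ[volume] f 0 := hf0.mono fun z hz => (hfin z).trans_eq hz.symm
  have hm : Integrable fun z => ‖z‖ * f 0 z :=
    (hki 1 (by lia)).congr (hf0.mono fun z hz => by simp only [hz, pow_one])
  have hfm : AEMeasurable (fun z => ENNReal.ofReal (fin z)) volume :=
    hfi.1.aemeasurable.ennreal_ofReal
  have hsm : ∀ z, (ENNReal.ofReal (fin z)).toReal • ‖z‖ ^ 2 = ‖z‖ ^ 2 * fin z := fun z => by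
    rw [ENNReal.toReal_ofReal (hfin z), smul_eq_mul, mul_comm]
  have h2 : Integrable (fun z => ‖z‖ ^ 2) (densMeasure fin) := by
    rw [densMeasure, integrable_withDensity_iff_integrable_smul₀' hfm
      (ae_of_all _ fun _ => ENNReal.ofReal_lt_top)]
    simpa only [hsm] using hki 2 (by lia)
  have hm2 : ∫ z, ‖z‖ ^ 2 ∂(densMeasure fin) ≤ 1 + a := by
    rw [densMeasure, integral_withDensity_eq_integral_toReal_smul₀ hfm
      (ae_of_all _ fun _ => ENNReal.ofReal_lt_top)]
    simp only [hsm]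
    rw [← hf1, ← hma, ← integral_add hfi hmi]
    refine integral_mono (hki 2 (by lia)) (hfi.add hmi) fun z => ?_
    beta_reduce
    rw [← one_add_mul]
    exact mul_le_mul_of_nonneg_right (hpow z 2 (by lia)) (hfin z)
  have hcpl : ∃ γ : Measure (EuclideanSpace ℝ (Fin d) × EuclideanSpace ℝ (Fin d)),
      γ.map Prod.fst = ((Measure.pi fun _ : Fin N => densMeasure fin).map (T N t)).map
        (fun Z => Z ⟨0, hN⟩) ∧
      γ.map Prod.snd = densMeasure (f t) ∧
      ∫⁻ p, edist p.1 p.2 ∂γ ≤ ENNReal.ofReal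
        (2 * √(∫ z, ‖z‖ ^ 2 ∂(densMeasure fin)) / √N * exp (2 * L * |t|)) := by
    obtain ht | ht := le_total 0 t
    · rw [abs_of_nonneg ht]
      exact H.exists_coupling h1 h0 hm hμ h2 ht (hTm N t) (hT0 N) (hT N hN) _
    · have hT' : ∀ Z s, HasDerivAt (fun s => T N (-s) Z)
          (fun i => (N : ℝ)⁻¹ • ∑ j, -K (T N (-s) Z i, T N (-s) Z j)) s := fun Z s => by
        refine ((hT N hN Z (-s)).scomp s (hasDerivAt_neg s)).congr_deriv ?_
        ext1 i
        simp
      have := H.reverse.exists_coupling (T := fun s => T N (-s)) (b := -t) (μ := densMeasure fin)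
        (by simpa using h1) (by simpa using h0) (by simpa using hm) (by simpa using hμ) h2
        (neg_nonneg.2 ht) (by simpa using hTm N t) (by simpa using hT0 N) hT' ⟨0, hN⟩
      rw [abs_of_nonpos ht]
      simp only [neg_neg] at this
      exact this
  obtain ⟨γ, hγ1, hγ2, hγ⟩ := hcpl
  refine (iInf₂_le γ ⟨hγ1, hγ2⟩).trans (hγ.trans (ENNReal.ofReal_le_ofReal ?_))
  exact two_mul_sqrt_div_sqrt_mul_exp_le hN hm2
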